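/- Let p be a prime number and let F be a field extension of the p-adic field ℚ_p that is finitely generated as a field extension of ℚ_p and of transcendence degree one over ℚ_p. Let ℓ be a prime with ℓ ≠ p. Then there exists a finite-dimensional central division algebra D over F which is a noncrossed product, and whose period equals its index, both being a power of ℓ: that is, there exist d ≥ 1 and a central division algebra D over F with dim_F D = ℓ^{2d}, with the class of D in Br(F) of order ℓ^d, such that no maximal subfield of D is a Galois extension of F (equivalently: there is no commutative F-subalgebra K of D which is a field, satisfies (dim_F K)² = dim_F D, and is Galois over F). -/

import Mathlib

open scoped TensorProduct

/-- A (finite-dimensional) central division algebra over a field `F`: a finite-dimensional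
`F`-algebra that is a division ring whose center is exactly `F`. -/
structure CentralDivisionAlgebra (F : Type) [Field F] : Type 1 where
  carrier : Type
  [divisionRing : DivisionRing carrier]
  [algebra : Algebra F carrier]
  finiteDimensional : FiniteDimensional F carrier
  central : Subalgebra.center F carrier = ⊥

attribute [instance] CentralDivisionAlgebra.divisionRing CentralDivisionAlgebra.algebra

/-- An `F`-algebra is *split* if it is isomorphic to a matrix algebra over `F`. -/
def IsSplitAlgebra (F : Type) [Field F] (A : Type) [Ring A] [Algebra F A] : Prop :=
  ∃ n : ℕ, 0 < n ∧ Nonempty (A ≃ₐ[F] Matrix (Fin n) (Fin n) F)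

/-- The class of `A` in the Brauer group `Br(F)` has order exactly `m`:
the `m`-th tensor power of `A` over `F` is split, while no smaller positive tensor
power is split.  (The order of `[A]` in `Br(F)` is the least `m > 0` with `[A]^m = 1`,
and `[A]^k = [A^{⊗k}]`.) -/
def BrauerClassHasOrder (F : Type) [Field F] (A : Type) [Ring A] [Algebra F A]
    (m : ℕ) : Prop :=
  0 < m ∧ IsSplitAlgebra F (⨂[F] (_ : Fin m), A) ∧
    ∀ k : ℕ, 0 < k → k < m → ¬ IsSplitAlgebra F (⨂[F] (_ : Fin k), A)

/-- A division algebra `D` central over a field `F` is a *noncrossed product* if no maximal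
subfield of `D` is Galois over `F`; i.e. there is no commutative `F`-subalgebra `K` of `D`
which is a field, satisfies `(dim_F K)² = dim_F D`, and is a Galois extension of `F`. -/
def IsNoncrossedProduct (F : Type) [Field F] (D : Type) [DivisionRing D]
    [Algebra F D] : Prop :=
  ¬ ∃ (K : Subalgebra F D) (hK : IsField K),
      (Module.finrank F K) ^ 2 = Module.finrank F D ∧
      @IsGalois F _ K hK.toField (by exact inferInstance)

section
set_option linter.unusedSectionVars false
set_option linter.style.haveILetI false
set_option linter.unusedSimpArgs false

theorem nc_mul_apply {X : Type*} [AddCommGroup X] (u v : AddMonoid.End X) (x : X) : (u * v) x = u (v x) := rfl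

/-- Bicyclic Galois data: two commuting automorphisms generating freely. -/
structure NCBi (F T : Type) [Field F] [Field T] [Algebra F T] where
  sg : T ≃ₐ[F] T
  ta : T ≃ₐ[F] T
  n : ℕ
  l : ℕ
  hn : 0 < n
  hl : 0 < l
  comm : sg * ta = ta * sg
  sgn : sg ^ n = 1
  tal : ta ^ l = 1
  inj : Function.Injective (fun ij : Fin n × Fin l => sg ^ (ij.1 : ℕ) * ta ^ (ij.2 : ℕ))
  fix : ∀ x : T, sg x = x → ta x = x → x ∈ (algebraMap F T).range

namespace NCBi
variable {F T : Type} [Field F] [Field T] [Algebra F T] (S : NCBi F T)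

theorem indep {lam : Fin S.n × Fin S.l → T}
    (h : ∀ c : T, ∑ ij, lam ij * (S.sg ^ (ij.1 : ℕ) * S.ta ^ (ij.2 : ℕ)) c = 0) : ∀ ij, lam ij = 0 := by
  have key := linearIndependent_monoidHom T T
  have hinj : Function.Injective (fun ij : Fin S.n × Fin S.l =>
      ((S.sg ^ (ij.1 : ℕ) * S.ta ^ (ij.2 : ℕ) : T ≃ₐ[F] T) : T →* T)) := by
    intro a b hab
    apply S.inj
    ext x
    exact DFunLike.congr_fun hab x
  have := key.comp _ hinj
  rw [Fintype.linearIndependent_iff] at this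
  apply this
  ext c
  simpa using h c


theorem sum_shift {M : Type*} [AddCommMonoid M] (f : ℕ → M) {n : ℕ} (hn : 0 < n) (h : f n = f 0) :
    ∑ i : Fin n, f (i + 1) = ∑ i : Fin n, f i := by
  obtain ⟨m, rfl⟩ : ∃ m, n = m + 1 := ⟨n - 1, by omega⟩
  rw [Fin.sum_univ_castSucc, Fin.sum_univ_succ]
  simp [h, add_comm]

section descent
variable {X : Type} [AddCommGroup X] [Module T X] (u v : AddMonoid.End X)

theorem semi_pow {u : AddMonoid.End X} {s : T ≃ₐ[F] T} (hu : ∀ (c : T) x, u (c • x) = s c • u x) (i : ℕ) (c : T) (x : X) :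
    (u ^ i) (c • x) = (s ^ i) c • (u ^ i) x := by
  induction i generalizing c x with
  | zero => simp
  | succ k ih => rw [pow_succ, pow_succ, nc_mul_apply, nc_mul_apply, hu, ih]; rfl

/-- The averaging operator. -/
def avg (x : X) : X := ∑ ij : Fin S.n × Fin S.l, (u ^ (ij.1 : ℕ) * v ^ (ij.2 : ℕ)) x

theorem avg_fix_u (hun : u ^ S.n = 1) (x : X) : u (S.avg u v x) = S.avg u v x := by
  unfold avg
  rw [map_sum, Fintype.sum_prod_type_right, Fintype.sum_prod_type_right]
  refine Finset.sum_congr rfl fun j _ => ?_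
  have := sum_shift (fun i => (u ^ i * v ^ (j : ℕ)) x) S.hn (by simp [hun])
  rw [← this]
  refine Finset.sum_congr rfl fun i _ => ?_
  simp [pow_succ', nc_mul_apply]

theorem avg_fix_v (huv : Commute u v) (hvl : v ^ S.l = 1) (x : X) : v (S.avg u v x) = S.avg u v x := by
  unfold avg
  rw [map_sum, Fintype.sum_prod_type, Fintype.sum_prod_type]
  refine Finset.sum_congr rfl fun i _ => ?_
  have := sum_shift (fun j => (u ^ (i : ℕ) * v ^ j) x) S.hl (by simp [hvl])
  rw [← this]
  refine Finset.sum_congr rfl fun j _ => ?_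
  change (v * (u ^ (i : ℕ) * v ^ (j : ℕ))) x = _
  rw [pow_succ', ← mul_assoc, ← mul_assoc, (huv.pow_left _).eq]

/-- fixed vectors -/
def fixd (hu : ∀ (c : T) x, u (c • x) = S.sg c • u x) (hv : ∀ (c : T) x, v (c • x) = S.ta c • v x)
   [Module F X] [IsScalarTower F T X] : Submodule F X where
  carrier := {x | u x = x ∧ v x = x}
  add_mem' := by
    rintro a b ⟨h1, h2⟩ ⟨h3, h4⟩
    exact ⟨by rw [map_add, h1, h3], by rw [map_add, h2, h4]⟩
  zero_mem' := ⟨map_zero _, map_zero _⟩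
  smul_mem' := by
    rintro c x ⟨h1, h2⟩
    rw [← algebraMap_smul T c x]
    exact ⟨by rw [hu, h1, AlgEquiv.commutes], by rw [hv, h2, AlgEquiv.commutes]⟩

variable {u v} (hu : ∀ (c : T) x, u (c • x) = S.sg c • u x) (hv : ∀ (c : T) x, v (c • x) = S.ta c • v x)
   [Module F X] [IsScalarTower F T X]

theorem mem_fixd {x : X} : x ∈ S.fixd u v hu hv ↔ u x = x ∧ v x = x := Iff.rfl

theorem avg_smul (hu : ∀ (c : T) x, u (c • x) = S.sg c • u x) (hv : ∀ (c : T) x, v (c • x) = S.ta c • v x) (c : T) (x : X) :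
    S.avg u v (c • x) = ∑ ij : Fin S.n × Fin S.l,
      (S.sg ^ (ij.1 : ℕ) * S.ta ^ (ij.2 : ℕ)) c • (u ^ (ij.1 : ℕ) * v ^ (ij.2 : ℕ)) x := by
  unfold avg
  refine Finset.sum_congr rfl fun ij _ => ?_
  rw [nc_mul_apply, nc_mul_apply, semi_pow hv, semi_pow hu]; rfl

theorem span_fixd (huv : Commute u v) (hun : u ^ S.n = 1) (hvl : v ^ S.l = 1) :
    Submodule.span T (S.fixd u v hu hv : Set X) = ⊤ := by
  by_contra hne
  obtain ⟨lam, hlam, hle⟩ := Submodule.exists_le_ker_of_lt_top _ (lt_top_iff_ne_top.mpr hne)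
  apply hlam
  ext x
  have h1 : ∀ c : T, lam (S.avg u v (c • x)) = 0 := fun c => by
    have : S.avg u v (c • x) ∈ S.fixd u v hu hv :=
      ⟨S.avg_fix_u u v hun _, S.avg_fix_v u v huv hvl _⟩
    exact hle (Submodule.subset_span this)
  have h2 := S.indep (lam := fun ij => lam ((u ^ (ij.1 : ℕ) * v ^ (ij.2 : ℕ)) x)) (by
    intro c
    rw [← h1 c, avg_smul S hu hv, map_sum]
    refine Finset.sum_congr rfl fun ij _ => ?_
    rw [map_smul, smul_eq_mul, mul_comm])
  have := h2 (⟨0, S.hn⟩, ⟨0, S.hl⟩)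
  simpa using this

theorem linInd_fixd {ι : Type*} {b : ι → X} (hb : LinearIndependent F b)
    (hf : ∀ i, b i ∈ S.fixd u v hu hv) : LinearIndependent T b := by
  classical
  rw [linearIndependent_iff'] at hb ⊢
  intro s g hg
  -- trace of an element
  have tr : ∀ c : T, ∃ r : F, algebraMap F T r =
      ∑ ij : Fin S.n × Fin S.l, (S.sg ^ (ij.1 : ℕ) * S.ta ^ (ij.2 : ℕ)) c := by
    intro c
    let us : AddMonoid.End T := (S.sg : T →+ T)
    let vs : AddMonoid.End T := (S.ta : T →+ T)
    have hup : ∀ i, ∀ c, (us ^ i) c = (S.sg ^ i) c := by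
      intro i; induction i with
      | zero => simp
      | succ k ih => intro c; rw [pow_succ, pow_succ, nc_mul_apply, ih]; rfl
    have hvp : ∀ i, ∀ c, (vs ^ i) c = (S.ta ^ i) c := by
      intro i; induction i with
      | zero => simp
      | succ k ih => intro c; rw [pow_succ, pow_succ, nc_mul_apply, ih]; rfl
    have hav : S.avg us vs c =
      ∑ ij : Fin S.n × Fin S.l, (S.sg ^ (ij.1 : ℕ) * S.ta ^ (ij.2 : ℕ)) c := by
      unfold avg
      refine Finset.sum_congr rfl fun ij _ => ?_
      rw [nc_mul_apply, hup, hvp]; rfl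
    rw [← hav]
    apply S.fix
    · exact S.avg_fix_u us vs (by ext c; rw [hup, S.sgn]; rfl) c
    · exact S.avg_fix_v us vs (by ext c; exact DFunLike.congr_fun S.comm c)
        (by ext c; rw [hvp, S.tal]; rfl) c
  choose t ht using tr
  have huf : ∀ i k, (u ^ k) (b i) = b i := fun i k => by
    induction k with
    | zero => rfl
    | succ k ih => rw [pow_succ, nc_mul_apply, (hf i).1, ih]
  have hvf : ∀ i k, (v ^ k) (b i) = b i := fun i k => by
    induction k with
    | zero => rfl
    | succ k ih => rw [pow_succ, nc_mul_apply, (hf i).2, ih]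
  have h1 : ∀ c : T, ∑ i ∈ s, t (c * g i) • b i = 0 := by
    intro c
    have : S.avg u v (c • ∑ i ∈ s, g i • b i) = 0 := by
      rw [hg, smul_zero]; unfold avg; simp
    rw [← this, Finset.smul_sum]
    have hadd : S.avg u v (∑ i ∈ s, c • g i • b i) = ∑ i ∈ s, S.avg u v (c • g i • b i) := by
      unfold avg; rw [Finset.sum_comm]; simp
    rw [hadd]
    refine Finset.sum_congr rfl fun i _ => ?_
    rw [smul_smul, avg_smul S hu hv, ← algebraMap_smul T, ht, Finset.sum_smul]
    refine Finset.sum_congr rfl fun ij _ => ?_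
    rw [nc_mul_apply, hvf, huf]
  intro i hi
  by_contra hgi
  have h3 : ∀ c, t (c * g i) = 0 := fun c => hb s _ (h1 c) i hi
  have h4 := S.indep (lam := fun _ => 1) (by
    intro c
    have := ht (c / g i * g i)
    rw [h3, map_zero, div_mul_cancel₀ _ hgi] at this
    simpa using this.symm) (⟨0, S.hn⟩, ⟨0, S.hl⟩)
  exact one_ne_zero h4

theorem exists_basis_fixd [FiniteDimensional T X] (huv : Commute u v) (hun : u ^ S.n = 1) (hvl : v ^ S.l = 1) :
    ∃ (ι : Type) (_ : Fintype ι) (bF : Module.Basis ι F (S.fixd u v hu hv)) (bT : Module.Basis ι T X),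
      ∀ i, bT i = (bF i : X) := by
  let bF := Module.Basis.ofVectorSpace F (S.fixd u v hu hv)
  have hli : LinearIndependent T (fun i => (bF i : X)) :=
    S.linInd_fixd hu hv (bF.linearIndependent.map' (Submodule.subtype _) (Submodule.ker_subtype _))
      (fun i => (bF i).2)
  have hsp : ⊤ ≤ Submodule.span T (Set.range (fun i => (bF i : X))) := by
    rw [← S.span_fixd hu hv huv hun hvl, Submodule.span_le]
    intro x hx
    have : (⟨x, hx⟩ : S.fixd u v hu hv) ∈ Submodule.span F (Set.range bF) := by
      rw [bF.span_eq]; trivial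
    have h2 : x ∈ (Submodule.span F (Set.range bF)).map (Submodule.subtype _) :=
      ⟨⟨x, hx⟩, this, rfl⟩
    rw [Submodule.map_span, ← Set.range_comp] at h2
    exact Submodule.span_le_restrictScalars F T _ h2
  let bT := Module.Basis.mk hli hsp
  haveI := Module.Finite.finite_basis bT
  refine ⟨_, Fintype.ofFinite _, bF, bT, fun i => ?_⟩
  simp [bT]

theorem finrank_fixd [FiniteDimensional T X] (huv : Commute u v) (hun : u ^ S.n = 1) (hvl : v ^ S.l = 1) :
    Module.finrank F (S.fixd u v hu hv) = Module.finrank T X := by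
  obtain ⟨ι, _, bF, bT, -⟩ := S.exists_basis_fixd hu hv huv hun hvl
  rw [Module.finrank_eq_card_basis bF, Module.finrank_eq_card_basis bT]

end descent
end NCBi
end

section
set_option linter.unusedSectionVars false
set_option linter.style.haveILetI false
set_option linter.unusedSimpArgs false
open Matrix

namespace NCBi
variable {F T : Type} [Field F] [Field T] [Algebra F T] (S : NCBi F T)

section nrm
variable {ι : Type} [Fintype ι] [DecidableEq ι] {κ : Type} [Fintype κ] [DecidableEq κ]

/-- `B σ(B) σ²(B) …` -/
def nrm (s : T ≃ₐ[F] T) (B : Matrix ι ι T) : ℕ → Matrix ι ι T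
  | 0 => 1
  | k + 1 => B * (nrm s B k).map s

theorem map_map_pow {m k : Type*} (s : T ≃ₐ[F] T) (X : Matrix m k T) (i : ℕ) :
    (X.map (s ^ i : T ≃ₐ[F] T)).map s = X.map (s ^ (i + 1) : T ≃ₐ[F] T) := by
  ext a b; simp only [Matrix.map_apply, pow_succ']; rfl

theorem map_one' {m : Type*} [DecidableEq m] (s : T ≃ₐ[F] T) : (1 : Matrix m m T).map s = 1 :=
  Matrix.map_one _ (map_zero _) (map_one _)

theorem map_alg {m : Type*} [DecidableEq m] (s : T ≃ₐ[F] T) (f : F) :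
    ((algebraMap F T f) • (1 : Matrix m m T)).map s = (algebraMap F T f) • (1 : Matrix m m T) := by
  ext a b
  simp only [Matrix.map_apply, Matrix.smul_apply, smul_eq_mul, map_mul, AlgEquiv.commutes]
  by_cases h : a = b
  · subst h; simp
  · simp [h]

theorem nrm_intertwine {s : T ≃ₐ[F] T} {B : Matrix ι ι T} {b : Matrix κ κ T} {w : Matrix ι κ T}
    (h : B * w.map s = w * b) (k : ℕ) : nrm s B k * w.map (s ^ k : T ≃ₐ[F] T) = w * nrm s b k := by
  induction k with
  | zero =>
    have : w.map ⇑(s ^ 0) = w := by ext; simp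
    rw [this]; simp [nrm]
  | succ k ih =>
    rw [nrm, nrm, ← map_map_pow, Matrix.mul_assoc, ← Matrix.map_mul, ih, Matrix.map_mul, ← Matrix.mul_assoc, h, Matrix.mul_assoc]

theorem det_nrm (s : T ≃ₐ[F] T) (B : Matrix ι ι T) (k : ℕ) :
    (nrm s B k).det = ∏ i ∈ Finset.range k, (s ^ i) B.det := by
  induction k with
  | zero => simp [nrm]
  | succ k ih =>
    rw [nrm, det_mul, Finset.prod_range_succ']
    have : ((nrm s B k).map s).det = s ((nrm s B k).det) := by
      rw [AlgEquiv.map_det]; rfl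
    rw [this, ih, map_prod, mul_comm]
    simp [pow_succ']

/-- twisted descent datum with values `f`, `t`. -/
structure Tw (f t : F) (B B' : Matrix ι ι T) : Prop where
  hB : nrm S.sg B S.n = algebraMap F T f • 1
  hB' : nrm S.ta B' S.l = algebraMap F T t • 1
  hc : B * B'.map S.sg = B' * B.map S.ta

variable {S} {f t : F} {B B' : Matrix ι ι T}

theorem isUnit_of_nrm {s : T ≃ₐ[F] T} {n : ℕ} (hn : 0 < n) {f : F} (hf : f ≠ 0)
    (h : nrm s B n = algebraMap F T f • 1) : IsUnit B.det := by
  have h1 := congrArg det h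
  rw [det_nrm, det_smul, det_one, mul_one] at h1
  have h2 : (∏ i ∈ Finset.range n, (s ^ i) B.det) ≠ 0 := by
    rw [h1]; exact pow_ne_zero _ (by simpa using hf)
  rw [Finset.prod_ne_zero_iff] at h2
  have := h2 0 (by simpa using hn)
  simpa using this

theorem Tw.unit (h : S.Tw f t B B') (hf : f ≠ 0) : IsUnit B.det := isUnit_of_nrm S.hn hf h.hB
theorem Tw.unit' (h : S.Tw f t B B') (ht : t ≠ 0) : IsUnit B'.det := isUnit_of_nrm S.hl ht h.hB'

/-- the rank one condition -/
def Sc (S : NCBi F T) (f t : F) (b b' : T) : Prop :=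
  ∏ i ∈ Finset.range S.n, (S.sg ^ i) b = algebraMap F T f ∧
  ∏ i ∈ Finset.range S.l, (S.ta ^ i) b' = algebraMap F T t ∧ b * S.sg b' = b' * S.ta b

theorem Tw.det (h : S.Tw f t B B') :
    S.Sc (f ^ Fintype.card ι) (t ^ Fintype.card ι) B.det B'.det := by
  refine ⟨?_, ?_, ?_⟩
  · rw [← det_nrm, h.hB, det_smul, det_one, mul_one, map_pow]
  · rw [← det_nrm, h.hB', det_smul, det_one, mul_one, map_pow]
  · have := congrArg Matrix.det h.hc
    rw [det_mul, det_mul] at this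
    rw [AlgEquiv.map_det, AlgEquiv.map_det]; exact this

/-- transport along `w` with a left inverse -/
theorem Tw.restrict (h : S.Tw f t B B') {w : Matrix ι κ T} {w' : Matrix κ ι T} (hw : w' * w = 1)
    {b b' : Matrix κ κ T} (hb : B * w.map S.sg = w * b) (hb' : B' * w.map S.ta = w * b') :
    S.Tw f t b b' := by
  have cancel : ∀ {x y : Matrix κ κ T}, w * x = w * y → x = y := fun {x y} hxy => by
    have := congrArg (w' * ·) hxy
    simpa [← Matrix.mul_assoc, hw] using this
  refine ⟨?_, ?_, ?_⟩
  · apply cancel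
    have := nrm_intertwine hb S.n
    rw [← this, h.hB, S.sgn]
    ext; simp
  · apply cancel
    have := nrm_intertwine hb' S.l
    rw [← this, h.hB', S.tal]
    ext; simp
  · apply cancel
    rw [← Matrix.mul_assoc, ← hb, Matrix.mul_assoc, ← Matrix.map_mul, ← hb', Matrix.map_mul, ← Matrix.mul_assoc, h.hc,
      ← Matrix.mul_assoc w, ← hb', Matrix.mul_assoc, Matrix.mul_assoc, ← Matrix.map_mul, ← hb, Matrix.map_mul]
    congr 2
    ext a c
    simp only [Matrix.map_apply]
    exact DFunLike.congr_fun S.comm _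

end nrm

section alg
variable {ι : Type} [Fintype ι] [DecidableEq ι]

/-- the algebra -/
def dAlg (S : NCBi F T) (B B' : Matrix ι ι T) : Subalgebra F (Matrix ι ι T) where
  carrier := {X | X * B = B * X.map S.sg ∧ X * B' = B' * X.map S.ta}
  mul_mem' := by
    rintro X Y ⟨h1, h2⟩ ⟨h3, h4⟩
    refine ⟨?_, ?_⟩
    · rw [mul_assoc, h3, ← mul_assoc, h1, mul_assoc, Matrix.map_mul]
    · rw [mul_assoc, h4, ← mul_assoc, h2, mul_assoc, Matrix.map_mul]
  add_mem' := by
    rintro X Y ⟨h1, h2⟩ ⟨h3, h4⟩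
    refine ⟨?_, ?_⟩
    · rw [add_mul, h1, h3, Matrix.map_add _ (map_add _), mul_add]
    · rw [add_mul, h2, h4, Matrix.map_add _ (map_add _), mul_add]
  algebraMap_mem' r := by
    have : algebraMap F (Matrix ι ι T) r = algebraMap F T r • 1 := by
      rw [Algebra.algebraMap_eq_smul_one, algebraMap_smul]
    rw [this]
    constructor
    · rw [map_alg]; simp
    · rw [map_alg]; simp

variable {S} {f t : F} {B B' : Matrix ι ι T}

theorem mem_dAlg {X : Matrix ι ι T} :
    X ∈ S.dAlg B B' ↔ X * B = B * X.map S.sg ∧ X * B' = B' * X.map S.ta := Iff.rfl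

/-- conjugation operator -/
noncomputable def cOp (s : T ≃ₐ[F] T) (B : Matrix ι ι T) : AddMonoid.End (Matrix ι ι T) where
  toFun X := B * X.map s * B⁻¹
  map_zero' := by rw [Matrix.map_zero _ (map_zero _)]; simp
  map_add' X Y := by rw [Matrix.map_add _ (map_add _), mul_add, add_mul]

theorem cOp_apply (s : T ≃ₐ[F] T) (B X : Matrix ι ι T) : cOp s B X = B * X.map s * B⁻¹ := rfl

theorem map_inv' (s : T ≃ₐ[F] T) {B : Matrix ι ι T} (hB : IsUnit B.det) : (B.map s)⁻¹ = (B⁻¹).map s := by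
  apply Matrix.inv_eq_right_inv
  rw [← Matrix.map_mul, mul_nonsing_inv _ hB, map_one']

theorem map_smul' (s : T ≃ₐ[F] T) (c : T) {m k : Type*} (X : Matrix m k T) : (c • X).map s = s c • X.map s := by
  ext; simp

theorem cOp_smul (s : T ≃ₐ[F] T) (B : Matrix ι ι T) (c : T) (X : Matrix ι ι T) :
    cOp s B (c • X) = s c • cOp s B X := by
  rw [cOp_apply, cOp_apply, map_smul', mul_smul_comm, smul_mul_assoc]

theorem nrm_unit (s : T ≃ₐ[F] T) {B : Matrix ι ι T} (hB : IsUnit B.det) (k : ℕ) : IsUnit (nrm s B k).det := by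
  rw [det_nrm, isUnit_iff_ne_zero, Finset.prod_ne_zero_iff]
  intro i _
  exact (map_ne_zero_iff _ (s ^ i : T ≃ₐ[F] T).injective).mpr hB.ne_zero

theorem cOp_pow (s : T ≃ₐ[F] T) {B : Matrix ι ι T} (hB : IsUnit B.det) (k : ℕ) (X : Matrix ι ι T) :
    (cOp s B ^ k) X = nrm s B k * X.map (s ^ k : T ≃ₐ[F] T) * (nrm s B k)⁻¹ := by
  induction k with
  | zero =>
    have : X.map ⇑(s ^ 0) = X := by ext; simp
    rw [this]; simp [nrm]
  | succ k ih =>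
    rw [pow_succ', nc_mul_apply, ih, cOp_apply, nrm, Matrix.map_mul, Matrix.map_mul, map_map_pow,
      Matrix.mul_inv_rev, map_inv' s (nrm_unit s hB k)]
    simp only [mul_assoc]

theorem cOp_pow_one (s : T ≃ₐ[F] T) {B : Matrix ι ι T} (hB : IsUnit B.det) {n : ℕ} (hs : s ^ n = 1) {f : F}
    (hf : f ≠ 0) (h : nrm s B n = algebraMap F T f • 1) : cOp s B ^ n = 1 := by
  ext1 X
  rw [cOp_pow s hB, h, hs]
  have h1 : (algebraMap F T f • (1 : Matrix ι ι T))⁻¹ = (algebraMap F T f)⁻¹ • 1 := by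
    apply Matrix.inv_eq_right_inv
    have : algebraMap F T f ≠ 0 := by simpa using hf
    rw [smul_mul_smul_comm, mul_inv_cancel₀ this]; simp
  have h2 : X.map ⇑(1 : T ≃ₐ[F] T) = X := by ext; simp
  have : algebraMap F T f ≠ 0 := by simpa using hf
  rw [h1, h2, smul_mul_assoc, one_mul, mul_smul_comm, mul_one, smul_smul, inv_mul_cancel₀ this, one_smul]
  rfl

theorem cOp_comm (h : S.Tw f t B B') (hf : f ≠ 0) (ht : t ≠ 0) : Commute (cOp S.sg B) (cOp S.ta B') := by
  have hB := h.unit hf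
  have hB' := h.unit' ht
  ext1 X
  rw [nc_mul_apply, nc_mul_apply, cOp_apply, cOp_apply, cOp_apply, cOp_apply]
  rw [Matrix.map_mul, Matrix.map_mul, Matrix.map_mul, Matrix.map_mul, ← map_inv' _ hB, ← map_inv' _ hB']
  have h1 : (X.map S.ta).map S.sg = (X.map S.sg).map S.ta := by
    ext a c
    simp only [Matrix.map_apply]
    exact DFunLike.congr_fun S.comm _
  have h2 := congrArg (·⁻¹) h.hc
  simp only [Matrix.mul_inv_rev] at h2
  have e1 : B * (B'.map S.sg * (X.map S.ta).map S.sg * (B'.map S.sg)⁻¹) * B⁻¹ =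
     (B * B'.map S.sg) * (X.map S.ta).map S.sg * ((B'.map S.sg)⁻¹ * B⁻¹) := by
    simp only [mul_assoc]
  rw [e1, h2, h.hc, h1]
  simp only [mul_assoc]

theorem cOp_fix_iff (s : T ≃ₐ[F] T) {B : Matrix ι ι T} (hB : IsUnit B.det) (X : Matrix ι ι T) :
    cOp s B X = X ↔ X * B = B * X.map s := by
  rw [cOp_apply]
  constructor
  · intro h
    conv_lhs => rw [← h]
    rw [mul_assoc, nonsing_inv_mul _ hB, mul_one]
  · intro h
    rw [← h, mul_assoc, mul_nonsing_inv _ hB, mul_one]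

theorem dAlg_toSubmodule (h : S.Tw f t B B') (hf : f ≠ 0) (ht : t ≠ 0) :
    Subalgebra.toSubmodule (S.dAlg B B') =
      S.fixd (cOp S.sg B) (cOp S.ta B') (cOp_smul _ _) (cOp_smul _ _) := by
  ext X
  rw [Subalgebra.mem_toSubmodule, mem_dAlg, mem_fixd, cOp_fix_iff _ (h.unit hf), cOp_fix_iff _ (h.unit' ht)]

theorem span_dAlg (h : S.Tw f t B B') (hf : f ≠ 0) (ht : t ≠ 0) :
    Submodule.span T (S.dAlg B B' : Set (Matrix ι ι T)) = ⊤ := by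
  have := S.span_fixd (cOp_smul S.sg B) (cOp_smul S.ta B') (cOp_comm h hf ht)
    (cOp_pow_one _ (h.unit hf) S.sgn hf h.hB) (cOp_pow_one _ (h.unit' ht) S.tal ht h.hB')
  rw [← dAlg_toSubmodule h hf ht] at this
  exact this

theorem finrank_dAlg (h : S.Tw f t B B') (hf : f ≠ 0) (ht : t ≠ 0) :
    Module.finrank F (S.dAlg B B') = Fintype.card ι ^ 2 := by
  have := S.finrank_fixd (cOp_smul S.sg B) (cOp_smul S.ta B') (cOp_comm h hf ht)
    (cOp_pow_one _ (h.unit hf) S.sgn hf h.hB) (cOp_pow_one _ (h.unit' ht) S.tal ht h.hB')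
  rw [← dAlg_toSubmodule h hf ht] at this
  rw [Subalgebra.finrank_toSubmodule] at this
  rw [this, Module.finrank_matrix]
  simp [sq]

theorem scalar_fix {s : T ≃ₐ[F] T} (hB : IsUnit B.det) [Nonempty ι] {c : T}
    (h : (c • (1 : Matrix ι ι T)) * B = B * (c • (1 : Matrix ι ι T)).map s) : s c = c := by
  rw [map_smul', map_one', smul_mul_assoc, one_mul, mul_smul_comm, mul_one] at h
  have h2 := congrArg (· * B⁻¹) h
  simp only [smul_mul_assoc, mul_nonsing_inv _ hB] at h2
  obtain ⟨i⟩ := ‹Nonempty ι›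
  have := congrFun (congrFun h2 i) i
  simpa using this.symm

theorem commute_all (h : S.Tw f t B B') (hf : f ≠ 0) (ht : t ≠ 0) {X : Matrix ι ι T}
    (hX : ∀ Y ∈ S.dAlg B B', Y * X = X * Y) (Y : Matrix ι ι T) : Y * X = X * Y := by
  have : Y ∈ Submodule.span T (S.dAlg B B' : Set (Matrix ι ι T)) := by
    rw [span_dAlg h hf ht]; trivial
  induction this using Submodule.span_induction with
  | mem x hx => exact hX x hx
  | zero => simp
  | add x y _ _ hx hy => rw [add_mul, hx, hy, mul_add]
  | smul a x _ hx => rw [smul_mul_assoc, hx, mul_smul_comm]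

theorem scalar_of_commute {X : Matrix ι ι T} (hX : ∀ Y : Matrix ι ι T, Y * X = X * Y) :
    ∃ c : T, X = c • 1 := by
  have := Matrix.mem_range_scalar_of_commute_single (M := X) (fun i j _ => hX _)
  obtain ⟨c, hc⟩ := this
  exact ⟨c, by rw [← hc]; ext a b; simp [Matrix.one_apply, Matrix.diagonal_apply]⟩

theorem center_dAlg [Nonempty ι] (h : S.Tw f t B B') (hf : f ≠ 0) (ht : t ≠ 0) :
    Subalgebra.center F (S.dAlg B B') = ⊥ := by
  rw [eq_bot_iff]
  rintro ⟨X, hX⟩ hc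
  rw [Subalgebra.mem_center_iff] at hc
  obtain ⟨c, rfl⟩ := scalar_of_commute (commute_all h hf ht (X := X) (fun Y hY =>
    congrArg Subtype.val (hc ⟨Y, hY⟩)))
  obtain ⟨r, hr⟩ := S.fix c (scalar_fix (h.unit hf) hX.1) (scalar_fix (h.unit' ht) hX.2)
  rw [Algebra.mem_bot]
  refine ⟨r, Subtype.ext ?_⟩
  change algebraMap F (Matrix ι ι T) r = _
  change _ = c • (1 : Matrix ι ι T)
  rw [Algebra.algebraMap_eq_smul_one, ← hr, algebraMap_smul]

theorem dAlg_unit (h : S.Tw f t B B') 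
    (LB : ∀ (r : ℕ) (b b' : T), S.Sc (f ^ r) (t ^ r) b b' → Fintype.card ι ∣ r)
    {X : Matrix ι ι T} (hX : X ∈ S.dAlg B B') (h0 : X ≠ 0) : IsUnit X.det := by
  let W := LinearMap.range X.mulVecLin
  let bs := Module.finBasis T W
  let r := Module.finrank T W
  let w : Matrix ι (Fin r) T := Matrix.of fun i j => (bs j : ι → T) i
  -- every matrix X * y is w * b
  have key : ∀ {κ : Type} (y : Matrix ι κ T), ∃ b : Matrix (Fin r) κ T, X * y = w * b := by
    intro κ y
    refine ⟨Matrix.of fun i j => bs.repr ⟨X.mulVecLin (fun a => y a j), ⟨_, rfl⟩⟩ i, ?_⟩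
    ext i j
    have := congrArg (fun z : W => (z : ι → T) i)
      (bs.sum_repr ⟨X.mulVecLin (fun a => y a j), ⟨_, rfl⟩⟩)
    rw [Matrix.mul_apply, Matrix.mul_apply]
    refine Eq.trans this.symm ?_
    simp only [Submodule.coe_sum, Finset.sum_apply, Submodule.coe_smul, Pi.smul_apply, smul_eq_mul]
    refine Finset.sum_congr rfl fun k _ => ?_
    rw [mul_comm]; rfl
  have hy : ∃ y : Matrix ι (Fin r) T, w = X * y := by
    have : ∀ j, ∃ y : ι → T, X.mulVecLin y = bs j := fun j => (bs j).2
    choose y hy using this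
    refine ⟨Matrix.of fun i j => y j i, ?_⟩
    ext i j
    have := congrFun (hy j) i
    simp only [w, Matrix.of_apply, ← this, Matrix.mulVecLin_apply, Matrix.mul_apply]
    rfl
  obtain ⟨y, hy⟩ := hy
  have hinv : ∃ w' : Matrix (Fin r) ι T, w' * w = 1 := by
    have hinj : Function.Injective w.mulVec := by
      rw [Matrix.mulVec_injective_iff]
      exact bs.linearIndependent.map' W.subtype (Submodule.ker_subtype _)
    obtain ⟨g, hg⟩ := LinearMap.exists_leftInverse_of_injective w.mulVecLin
      (LinearMap.ker_eq_bot.mpr hinj)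
    refine ⟨LinearMap.toMatrix' g, ?_⟩
    have h5 := congrArg LinearMap.toMatrix' hg
    rw [LinearMap.toMatrix'_comp, LinearMap.toMatrix'_id] at h5
    rw [← h5, ← Matrix.toLin'_apply', LinearMap.toMatrix'_toLin']
  obtain ⟨w', hw'⟩ := hinv
  obtain ⟨b, hb⟩ := key (B * y.map S.sg)
  obtain ⟨b', hb'⟩ := key (B' * y.map S.ta)
  rw [← Matrix.mul_assoc, hX.1, Matrix.mul_assoc, ← Matrix.map_mul, ← hy] at hb
  rw [← Matrix.mul_assoc, hX.2, Matrix.mul_assoc, ← Matrix.map_mul, ← hy] at hb'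
  have hdvd := LB _ _ _ (h.restrict hw' hb hb').det
  rw [Fintype.card_fin] at hdvd
  have hr : r ≠ 0 := by
    intro hr
    apply h0
    have : W = ⊥ := Submodule.finrank_eq_zero.mp hr
    have h3 := LinearMap.range_eq_bot.mp this
    ext i j
    have := congrFun (LinearMap.congr_fun h3 (Pi.single j 1)) i
    simpa using this
  have hle : Fintype.card ι ≤ r := Nat.le_of_dvd (Nat.pos_of_ne_zero hr) hdvd
  have htop : W = ⊤ := by
    apply Submodule.eq_top_of_finrank_eq
    apply le_antisymm (Submodule.finrank_le _)
    simpa using hle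
  have hsurj : Function.Surjective X.mulVecLin := LinearMap.range_eq_top.mp htop
  have : Function.Surjective X.mulVec := hsurj
  rw [Matrix.mulVec_surjective_iff_isUnit] at this
  exact (Matrix.isUnit_iff_isUnit_det _).mp this

end alg
end NCBi
end

section
set_option linter.unusedSectionVars false
set_option linter.style.haveILetI false
set_option linter.unusedSimpArgs false
open Matrix
open scoped TensorProduct

namespace NCBi
variable {F T : Type} [Field F] [Field T] [Algebra F T] {S : NCBi F T}
variable {ι : Type} [Fintype ι] [DecidableEq ι] {f t : F} {B B' : Matrix ι ι T}

/-- Kronecker product of a family. -/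
def kpr {k : ℕ} (X : Fin k → Matrix ι ι T) : Matrix (Fin k → ι) (Fin k → ι) T :=
  Matrix.of fun x y => ∏ i, X i (x i) (y i)

theorem kpr_mul {k : ℕ} (X Y : Fin k → Matrix ι ι T) : kpr X * kpr Y = kpr (X * Y) := by
  ext x y
  simp only [kpr, Matrix.mul_apply, Matrix.of_apply, Pi.mul_apply, Finset.prod_univ_sum,
    Fintype.piFinset_univ, Finset.prod_mul_distrib]

theorem kpr_one {k : ℕ} : kpr (1 : Fin k → Matrix ι ι T) = 1 := by
  ext x y
  simp only [kpr, Matrix.of_apply, Pi.one_apply, Matrix.one_apply]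
  rw [Fintype.prod_ite_zero]
  simp [funext_iff]

theorem kpr_map {k : ℕ} (s : T ≃ₐ[F] T) (X : Fin k → Matrix ι ι T) :
    (kpr X).map s = kpr (fun i => (X i).map s) := by
  ext x y
  simp [kpr]

/-- Kronecker product as multilinear map over `T`. -/
def kprMul (k : ℕ) : MultilinearMap T (fun _ : Fin k => Matrix ι ι T) (Matrix (Fin k → ι) (Fin k → ι) T) where
  toFun := kpr
  map_update_add' := by
    intro _ m i x y
    ext a b
    have h : ∀ z : Matrix ι ι T, (∏ j, Function.update m i z j (a j) (b j)) =
        z (a i) (b i) * ∏ j ∈ Finset.univ.erase i, m j (a j) (b j) := by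
      intro z
      rw [← Finset.mul_prod_erase _ _ (Finset.mem_univ i)]
      congr 1
      · simp
      · refine Finset.prod_congr rfl fun j hj => ?_
        rw [Function.update_of_ne (Finset.ne_of_mem_erase hj)]
    have e : ‹DecidableEq (Fin k)› = instDecidableEqFin k := Subsingleton.elim _ _
    subst e
    simp only [kpr, Matrix.of_apply, Matrix.add_apply, h, add_mul]
  map_update_smul' := by
    intro _ m i c x
    ext a b
    have h : ∀ z : Matrix ι ι T, (∏ j, Function.update m i z j (a j) (b j)) =
        z (a i) (b i) * ∏ j ∈ Finset.univ.erase i, m j (a j) (b j) := by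
      intro z
      rw [← Finset.mul_prod_erase _ _ (Finset.mem_univ i)]
      congr 1
      · simp
      · refine Finset.prod_congr rfl fun j hj => ?_
        rw [Function.update_of_ne (Finset.ne_of_mem_erase hj)]
    have e : ‹DecidableEq (Fin k)› = instDecidableEqFin k := Subsingleton.elim _ _
    subst e
    simp only [kpr, Matrix.of_apply, Matrix.smul_apply, h, smul_eq_mul, mul_assoc]

theorem kprMul_apply (k : ℕ) (X : Fin k → Matrix ι ι T) : kprMul k X = kpr X := rfl

/-- Kronecker representation. -/
def kap (D : Subalgebra F (Matrix ι ι T)) (k : ℕ) :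
    (⨂[F] (_ : Fin k), D) →ₐ[F] Matrix (Fin k → ι) (Fin k → ι) T :=
  PiTensorProduct.liftAlgHom
    (((kprMul (ι := ι) (T := T) k).restrictScalars F).compLinearMap (fun _ => D.val.toLinearMap))
    (by
      change kpr (fun _ => _) = _
      exact kpr_one)
    (by
      intro x y
      change kpr (fun i => ((x i * y i : D) : Matrix ι ι T)) = kpr _ * kpr _
      rw [kpr_mul]; rfl)

theorem kap_tprod (D : Subalgebra F (Matrix ι ι T)) (k : ℕ) (X : Fin k → D) :
    kap D k (PiTensorProduct.tprod F X) = kpr (fun i => (X i : Matrix ι ι T)) := by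
  exact PiTensorProduct.lift.tprod X

theorem nrm_kpr (s : T ≃ₐ[F] T) (B : Matrix ι ι T) (k j : ℕ) :
    nrm s (kpr (fun _ : Fin k => B)) j = kpr (fun _ : Fin k => nrm s B j) := by
  induction j with
  | zero => simp only [nrm]; exact kpr_one.symm
  | succ j ih => rw [nrm, ih, kpr_map, kpr_mul]; rfl

theorem kpr_smul_one (c : T) (k : ℕ) : kpr (fun _ : Fin k => c • (1 : Matrix ι ι T)) = c ^ k • 1 := by
  have := (kprMul (ι := ι) (T := T) k).map_smul_univ (fun _ => c) (fun _ => 1)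
  rw [kprMul_apply, kprMul_apply] at this
  rw [this, Finset.prod_const, Finset.card_univ, Fintype.card_fin]
  congr 1
  exact kpr_one

theorem Tw.kpr (h : S.Tw f t B B') (k : ℕ) :
    S.Tw (f ^ k) (t ^ k) (kpr (fun _ : Fin k => B)) (kpr (fun _ : Fin k => B')) := by
  refine ⟨?_, ?_, ?_⟩
  · rw [nrm_kpr, h.hB, kpr_smul_one, map_pow]
  · rw [nrm_kpr, h.hB', kpr_smul_one, map_pow]
  · rw [kpr_map, kpr_map, kpr_mul, kpr_mul]
    congr 1
    funext _
    exact h.hc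

theorem kap_mem (k : ℕ) (x : ⨂[F] (_ : Fin k), S.dAlg B B') :
    kap (S.dAlg B B') k x ∈ S.dAlg (kpr (fun _ : Fin k => B)) (kpr (fun _ : Fin k => B')) := by
  induction x using PiTensorProduct.induction_on with
  | smul_tprod r X =>
    rw [map_smul, kap_tprod]
    apply Subalgebra.smul_mem
    rw [mem_dAlg, kpr_map, kpr_map, kpr_mul, kpr_mul, kpr_mul, kpr_mul]
    constructor
    · congr 1; funext i; exact (X i).2.1
    · congr 1; funext i; exact (X i).2.2
  | add x y hx hy => rw [map_add]; exact add_mem hx hy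

theorem span_kap (h : S.Tw f t B B') (hf : f ≠ 0) (ht : t ≠ 0) (k : ℕ) :
    Submodule.span T (Set.range (kap (S.dAlg B B') k)) = ⊤ := by
  have hspan := span_dAlg h hf ht
  have key : ∀ X : Fin k → Matrix ι ι T, kpr X ∈ Submodule.span T (Set.range (kap (S.dAlg B B') k)) := by
    intro X
    have h1 : ∀ i, ∃ (c : (S.dAlg B B') →₀ T), X i = c.sum fun d a => a • (d : Matrix ι ι T) := by
      intro i
      have : X i ∈ Submodule.span T (Set.range (Subtype.val : S.dAlg B B' → Matrix ι ι T)) := by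
        rw [Subtype.range_coe]
        have h3 : X i ∈ (⊤ : Submodule T (Matrix ι ι T)) := trivial
        rwa [← hspan] at h3
      rw [Finsupp.mem_span_range_iff_exists_finsupp] at this
      obtain ⟨c, hc⟩ := this
      exact ⟨c, hc.symm⟩
    choose c hc using h1
    have h2 : X = fun i => ∑ d ∈ (c i).support, c i d • (d : Matrix ι ι T) := funext hc
    rw [h2, ← kprMul_apply, MultilinearMap.map_sum_finset]
    refine Submodule.sum_mem _ fun r _ => ?_
    rw [(kprMul k).map_smul_univ (fun i => c i (r i)) (fun i => (r i : Matrix ι ι T))]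
    apply Submodule.smul_mem
    apply Submodule.subset_span
    exact ⟨_, kap_tprod _ k r⟩
  rw [eq_top_iff]
  intro Z _
  rw [Matrix.matrix_eq_sum_single Z]
  refine Submodule.sum_mem _ fun x _ => Submodule.sum_mem _ fun y _ => ?_
  have : Matrix.single x y (Z x y) = Z x y • kpr (fun i => Matrix.single (x i) (y i) (1 : T)) := by
    ext a b
    simp only [kpr, Matrix.smul_apply, Matrix.of_apply, Matrix.single_apply]
    rw [Fintype.prod_ite_zero]
    simp only [forall_and, ← funext_iff, Finset.prod_const_one, smul_eq_mul, mul_ite, mul_one, mul_zero]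
  rw [this]
  exact Submodule.smul_mem _ _ (key _)

theorem finrank_tens (h : S.Tw f t B B') (hf : f ≠ 0) (ht : t ≠ 0) (k : ℕ) :
    Module.finrank F (⨂[F] (_ : Fin k), S.dAlg B B') = (Fintype.card (Fin k → ι)) ^ 2 := by
  have : Module.Finite F (S.dAlg B B') := by
    by_cases hc : Nonempty ι
    · apply Module.finite_of_finrank_pos
      rw [finrank_dAlg h hf ht]
      have := Fintype.card_pos (α := ι)
      positivity
    · rw [not_nonempty_iff] at hc
      infer_instance
  let b := Module.finBasis F (S.dAlg B B')
  rw [Module.finrank_eq_card_basis (Basis.piTensorProduct (fun _ : Fin k => b))]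
  rw [Fintype.card_pi, Fintype.card_pi]
  simp only [Fintype.card_fin, Finset.prod_const, Finset.card_univ, finrank_dAlg h hf ht]
  rw [← pow_mul, ← pow_mul, mul_comm]

theorem scalar_of_commute_F {m : Type} [Fintype m] [DecidableEq m] {X : Matrix m m T}
    (hX : ∀ Y : Matrix m m F, Y.map (algebraMap F T) * X = X * Y.map (algebraMap F T)) :
    ∃ c : T, X = c • 1 := by
  have := Matrix.mem_range_scalar_of_commute_single (M := X) (fun i j _ => by
    have := hX (Matrix.single i j 1)
    have e : (Matrix.single i j (1:F)).map (algebraMap F T) = Matrix.single i j 1 := by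
      simp [Matrix.map_single]
    rwa [e] at this)
  obtain ⟨c, hc⟩ := this
  exact ⟨c, by rw [← hc]; ext a b; simp [Matrix.one_apply, Matrix.diagonal_apply]⟩

theorem nrm_smul_one {m : Type} [Fintype m] [DecidableEq m] (s : T ≃ₐ[F] T) (b : T) (j : ℕ) :
    nrm s (b • (1 : Matrix m m T)) j = (∏ i ∈ Finset.range j, (s ^ i) b) • 1 := by
  induction j with
  | zero => simp [nrm]
  | succ j ih =>
    rw [nrm, ih, map_smul', map_one', Finset.prod_range_succ']
    simp only [map_prod, smul_mul_smul_comm, mul_one]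
    rw [mul_comm]
    simp [pow_succ']

theorem Tw.scalar {m : Type} [Fintype m] [DecidableEq m] [Nonempty m] {b b' : T}
    (h : S.Tw f t (b • (1 : Matrix m m T)) (b' • 1)) : S.Sc f t b b' := by
  obtain ⟨h1, h2, h3⟩ := h
  rw [nrm_smul_one] at h1 h2
  have i := Classical.arbitrary m
  refine ⟨?_, ?_, ?_⟩
  · simpa [Algebra.smul_def] using congrFun (congrFun h1 i) i
  · simpa [Algebra.smul_def] using congrFun (congrFun h2 i) i
  · rw [map_smul', map_smul', map_one', map_one'] at h3
    have h4 := congrFun (congrFun h3 i) i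
    simp at h4
    rw [mul_comm, h4, mul_comm]

/-- a representation of a matrix algebra of the full size is the standard one. -/
theorem exists_P {m : ℕ} (hm : 0 < m) {N : Type} [Fintype N] [DecidableEq N] (hcard : Fintype.card N = m)
    (lam : Matrix (Fin m) (Fin m) F →ₐ[F] Matrix N N T) :
    ∃ (P : Matrix N (Fin m) T) (P' : Matrix (Fin m) N T), P' * P = 1 ∧ P * P' = 1 ∧
      ∀ X, lam X * P = P * X.map (algebraMap F T) := by
  let z : Fin m := ⟨0, hm⟩
  have h0 : lam (Matrix.single z z 1) ≠ 0 := by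
    intro h0
    have h1 : ∀ i, lam (Matrix.single i i 1) = 0 := by
      intro i
      have : Matrix.single i i (1:F) = Matrix.single i z 1 * Matrix.single z z 1 * Matrix.single z i 1 := by
        simp
      rw [this, map_mul, map_mul, h0]; simp
    have h2 : lam 1 = 0 := by
      have : (1 : Matrix (Fin m) (Fin m) F) = ∑ i, Matrix.single i i 1 := by
        ext a b
        simp only [Matrix.sum_apply, Matrix.single_apply, Matrix.one_apply]
        by_cases hab : a = b
        · subst hab; simp
        · simp only [hab, if_false]
          symm
          apply Finset.sum_eq_zero
          rintro x _
          rw [if_neg]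
          rintro ⟨rfl, h⟩
          exact hab h
      rw [this, map_sum]; simp [h1]
    rw [map_one] at h2
    haveI : Nonempty N := Fintype.card_pos_iff.mp (by omega)
    exact one_ne_zero h2
  obtain ⟨w, hw⟩ : ∃ w : N → T, lam (Matrix.single z z 1) *ᵥ w ≠ 0 := by
    by_contra hcon
    push Not at hcon
    apply h0
    ext i j
    have := congrFun (hcon (Pi.single j 1)) i
    simpa using this
  let P : Matrix N (Fin m) T := Matrix.of fun a i => (lam (Matrix.single i z 1) *ᵥ w) a
  have hP : ∀ X, lam X * P = P * X.map (algebraMap F T) := by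
    intro X
    ext a i
    have e1 : (lam X * P) a i = ((lam X) *ᵥ (lam (Matrix.single i z 1) *ᵥ w)) a := rfl
    rw [e1, Matrix.mulVec_mulVec, ← map_mul]
    have e2 : X * Matrix.single i z 1 = ∑ k, X k i • Matrix.single k z 1 := by
      ext c d
      simp only [Matrix.sum_apply, Matrix.smul_apply, Matrix.single_apply, Matrix.mul_apply, smul_eq_mul]
      by_cases hd : z = d <;> simp [hd]
    rw [e2, map_sum]
    simp only [map_smul]
    rw [Matrix.sum_mulVec, Finset.sum_apply, Matrix.mul_apply]
    refine Finset.sum_congr rfl fun k _ => ?_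
    rw [Matrix.smul_mulVec, Pi.smul_apply, Algebra.smul_def, mul_comm]
    rfl
  have hinj : Function.Injective P.mulVecLin := by
    rw [← LinearMap.ker_eq_bot, LinearMap.ker_eq_bot']
    intro c hc
    have hc' : P *ᵥ c = 0 := hc
    ext j
    have h3 : lam (Matrix.single z j 1) *ᵥ (P *ᵥ c) = 0 := by rw [hc']; simp
    rw [Matrix.mulVec_mulVec, hP, ← Matrix.mulVec_mulVec] at h3
    have e : (Matrix.single z j (1:F)).map (algebraMap F T) *ᵥ c = Pi.single z (c j) := by
      ext a
      simp only [Matrix.mulVec, dotProduct, Matrix.map_apply, Matrix.single_apply, Pi.single_apply]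
      by_cases ha : a = z
      · subst ha; simp [apply_ite]
      · simp [ha, Ne.symm ha]
    rw [e] at h3
    have h4 : P *ᵥ Pi.single z (c j) = c j • (lam (Matrix.single z z 1) *ᵥ w) := by
      ext a
      simp [P, mul_comm]
    rw [h4] at h3
    exact (smul_eq_zero.mp h3).resolve_right hw
  obtain ⟨g, hg⟩ := LinearMap.exists_leftInverse_of_injective P.mulVecLin
      (LinearMap.ker_eq_bot.mpr hinj)
  have hleft : LinearMap.toMatrix' g * P = 1 := by
    have h5 := congrArg LinearMap.toMatrix' hg
    rw [LinearMap.toMatrix'_comp, LinearMap.toMatrix'_id] at h5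
    rw [← h5, ← Matrix.toLin'_apply', LinearMap.toMatrix'_toLin']
  refine ⟨P, LinearMap.toMatrix' g, hleft, ?_, hP⟩
  have e : Fin m ≃ N := Fintype.equivOfCardEq (by simp [hcard])
  exact (Matrix.mul_eq_one_comm_of_equiv e).mp hleft

theorem period_lower [Nonempty ι] (h : S.Tw f t B B') (hf : f ≠ 0) (ht : t ≠ 0)
    (LB : ∀ (r : ℕ) (b b' : T), S.Sc (f ^ r) (t ^ r) b b' → Fintype.card ι ∣ r)
    {k m : ℕ} (hm : 0 < m) (e : (⨂[F] (_ : Fin k), S.dAlg B B') ≃ₐ[F] Matrix (Fin m) (Fin m) F) :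
    Fintype.card ι ∣ k := by
  have hcard : Fintype.card (Fin k → ι) = m := by
    have h1 := finrank_tens h hf ht k
    rw [e.toLinearEquiv.finrank_eq, Module.finrank_matrix] at h1
    simp only [Fintype.card_fin, Module.finrank_self, mul_one] at h1
    rw [← sq] at h1
    exact (Nat.pow_left_injective (n := 2) (by norm_num) h1).symm
  let lam := (kap (S.dAlg B B') k).comp e.symm.toAlgHom
  obtain ⟨P, P', hP', hP, hl⟩ := exists_P hm hcard lam
  have key : ∀ (s : T ≃ₐ[F] T) (Q : Matrix (Fin k → ι) (Fin k → ι) T)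
      (hQ : ∀ X, lam X * Q = Q * (lam X).map s), ∃ b : T, Q * P.map s = P * (b • (1 : Matrix (Fin m) (Fin m) T)) := by
    intro s Q hQ
    obtain ⟨b, hb⟩ := scalar_of_commute_F (F := F) (X := P' * (Q * P.map s)) (by
      intro Y
      have hY : (Y.map (algebraMap F T)).map s = Y.map (algebraMap F T) := by ext; simp
      have h1 : P * (Y.map (algebraMap F T) * (P' * (Q * P.map s))) =
        P * ((P' * (Q * P.map s)) * Y.map (algebraMap F T)) := by
        rw [← Matrix.mul_assoc, ← hl, Matrix.mul_assoc, ← Matrix.mul_assoc P, hP, Matrix.one_mul,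
          ← Matrix.mul_assoc, hQ, Matrix.mul_assoc, ← Matrix.map_mul, hl, Matrix.map_mul, hY,
          Matrix.mul_assoc P', ← Matrix.mul_assoc P, hP, Matrix.one_mul, Matrix.mul_assoc]
      have := congrArg (P' * ·) h1
      simpa only [← Matrix.mul_assoc, hP', Matrix.one_mul] using this)
    refine ⟨b, ?_⟩
    rw [← hb, ← Matrix.mul_assoc, hP, Matrix.one_mul]
  obtain ⟨b, hb⟩ := key S.sg (kpr (fun _ : Fin k => B)) (fun X => (kap_mem k _).1)
  obtain ⟨b', hb'⟩ := key S.ta (kpr (fun _ : Fin k => B')) (fun X => (kap_mem k _).2)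
  haveI : Nonempty (Fin m) := ⟨⟨0, hm⟩⟩
  exact LB k b b' ((h.kpr k).restrict hP' hb hb').scalar

end NCBi
end

section
set_option linter.unusedSectionVars false
set_option linter.style.haveILetI false
set_option linter.unusedSimpArgs false
open Matrix
open scoped TensorProduct

namespace NCBi
variable {F T : Type} [Field F] [Field T] [Algebra F T] {S : NCBi F T}
variable {ι : Type} [Fintype ι] [DecidableEq ι] {f t : F} {B B' : Matrix ι ι T}

/-- vector operator -/
def vOp (s : T ≃ₐ[F] T) (B : Matrix ι ι T) : AddMonoid.End (ι → T) where
  toFun x := B *ᵥ (fun i => s (x i))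
  map_zero' := by ext; simp [Matrix.mulVec, dotProduct]
  map_add' x y := by ext; simp [Matrix.mulVec, dotProduct, mul_add, Finset.sum_add_distrib]

theorem vOp_apply (s : T ≃ₐ[F] T) (B : Matrix ι ι T) (x : ι → T) : vOp s B x = B *ᵥ (fun i => s (x i)) := rfl

theorem vOp_smul (s : T ≃ₐ[F] T) (B : Matrix ι ι T) (c : T) (x : ι → T) :
    vOp s B (c • x) = s c • vOp s B x := by
  rw [vOp_apply, vOp_apply, ← Matrix.mulVec_smul]
  congr 1; ext; simp

theorem map_mulVec (s : T ≃ₐ[F] T) {m : Type*} (B : Matrix m ι T) (x : ι → T) :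
    (fun i => s ((B *ᵥ x) i)) = B.map s *ᵥ (fun i => s (x i)) := by
  ext i; simp [Matrix.mulVec, dotProduct]

theorem vOp_pow (s : T ≃ₐ[F] T) (B : Matrix ι ι T) (k : ℕ) (x : ι → T) :
    (vOp s B ^ k) x = nrm s B k *ᵥ (fun i => (s ^ k : T ≃ₐ[F] T) (x i)) := by
  induction k with
  | zero => simp [nrm]
  | succ k ih =>
    rw [pow_succ', nc_mul_apply, ih, vOp_apply, nrm, map_mulVec, Matrix.mulVec_mulVec]
    congr 1
    funext i
    rw [pow_succ']; rfl

theorem vOp_comm (hc : B * B'.map S.sg = B' * B.map S.ta) : Commute (vOp S.sg B) (vOp S.ta B') := by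
  ext1 x
  rw [nc_mul_apply, nc_mul_apply, vOp_apply, vOp_apply, vOp_apply, vOp_apply, map_mulVec, map_mulVec,
    Matrix.mulVec_mulVec, Matrix.mulVec_mulVec, hc]
  congr 1
  ext i
  exact DFunLike.congr_fun S.comm _

theorem hilbert90 (h : S.Tw 1 1 B B') : ∃ (P : Matrix ι (Fin (Fintype.card ι)) T)
    (P' : Matrix (Fin (Fintype.card ι)) ι T), P' * P = 1 ∧ P * P' = 1 ∧
    B * P.map S.sg = P ∧ B' * P.map S.ta = P := by
  have hu1 : vOp S.sg B ^ S.n = 1 := by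
    ext1 x
    rw [vOp_pow, h.hB, S.sgn]; simp
  have hv1 : vOp S.ta B' ^ S.l = 1 := by
    ext1 x
    rw [vOp_pow, h.hB', S.tal]; simp
  obtain ⟨κ, _, bF, bT, hb⟩ := S.exists_basis_fixd (X := ι → T) (vOp_smul S.sg B) (vOp_smul S.ta B')
    (vOp_comm h.hc) hu1 hv1
  have hc : Fintype.card κ = Fintype.card ι := by
    rw [← Module.finrank_eq_card_basis bT]; simp
  let e : κ ≃ Fin (Fintype.card ι) := Fintype.equivFinOfCardEq hc
  let b := bT.reindex e
  refine ⟨(Pi.basisFun T ι).toMatrix b, b.toMatrix (Pi.basisFun T ι),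
    Module.Basis.toMatrix_mul_toMatrix_flip _ _, Module.Basis.toMatrix_mul_toMatrix_flip _ _, ?_, ?_⟩
  · ext i j
    have h1 := congrFun (bF (e.symm j)).2.1 i
    have h2 : (Pi.basisFun T ι).toMatrix b i j = (bF (e.symm j) : ι → T) i := by
      simp [Module.Basis.toMatrix_apply, b, hb]
    rw [h2, ← h1]
    simp [vOp_apply, Matrix.mul_apply, Matrix.mulVec, dotProduct, Module.Basis.toMatrix_apply, b, hb]
  · ext i j
    have h1 := congrFun (bF (e.symm j)).2.2 i
    have h2 : (Pi.basisFun T ι).toMatrix b i j = (bF (e.symm j) : ι → T) i := by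
      simp [Module.Basis.toMatrix_apply, b, hb]
    rw [h2, ← h1]
    simp [vOp_apply, Matrix.mul_apply, Matrix.mulVec, dotProduct, Module.Basis.toMatrix_apply, b, hb]

theorem nrm_smul (s : T ≃ₐ[F] T) (b : T) (B : Matrix ι ι T) (j : ℕ) :
    nrm s (b • B) j = (∏ i ∈ Finset.range j, (s ^ i) b) • nrm s B j := by
  induction j with
  | zero => simp [nrm]
  | succ j ih =>
    rw [nrm, ih, map_smul', Finset.prod_range_succ', nrm]
    simp only [map_prod, smul_mul_smul_comm]
    rw [mul_comm]
    simp [pow_succ']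

theorem Tw.normalize (h : S.Tw f t B B') (hf : f ≠ 0) (ht : t ≠ 0) {b b' : T} (hs : S.Sc f t b b') :
    S.Tw 1 1 (b⁻¹ • B) (b'⁻¹ • B') := by
  obtain ⟨h1, h2, h3⟩ := hs
  have hf' : algebraMap F T f ≠ 0 := by simpa using hf
  have ht' : algebraMap F T t ≠ 0 := by simpa using ht
  refine ⟨?_, ?_, ?_⟩
  · rw [nrm_smul, h.hB]
    simp only [map_inv₀, Finset.prod_inv_distrib, h1, smul_smul, inv_mul_cancel₀ hf', map_one]
  · rw [nrm_smul, h.hB']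
    simp only [map_inv₀, Finset.prod_inv_distrib, h2, smul_smul, inv_mul_cancel₀ ht', map_one]
  · rw [map_smul', map_smul', smul_mul_smul_comm, smul_mul_smul_comm, h.hc, map_inv₀, map_inv₀,
      ← mul_inv, ← mul_inv, h3]

theorem period_upper [Nonempty ι] (h : S.Tw f t B B') (hf : f ≠ 0) (ht : t ≠ 0) :
    ∃ m : ℕ, 0 < m ∧ Nonempty ((⨂[F] (_ : Fin (Fintype.card ι)), S.dAlg B B') ≃ₐ[F] Matrix (Fin m) (Fin m) F) := by
  set k := Fintype.card ι with hk
  have hsc := h.det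
  rw [← hk] at hsc
  have hn := (h.kpr k).normalize (pow_ne_zero _ hf) (pow_ne_zero _ ht) hsc
  have H90 := hilbert90 hn
  let N := Fin k → ι
  have hmpos : 0 < Fintype.card N := Fintype.card_pos
  refine ⟨Fintype.card N, hmpos, ?_⟩
  obtain ⟨P, P', h1, h2, h3, h4⟩ := H90
  change Matrix N (Fin (Fintype.card N)) T at P
  change Matrix (Fin (Fintype.card N)) N T at P'
  have hcard : Fintype.card N = Fintype.card N := rfl
  have hfr0 := finrank_tens h hf ht k
  change Module.finrank F (⨂[F] (_ : Fin k), S.dAlg B B') = Fintype.card N ^ 2 at hfr0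
  generalize Fintype.card N = m at *
  let C : Matrix N N T →ₐ[F] Matrix (Fin m) (Fin m) T := AlgHom.ofLinearMap
    { toFun := fun X => P' * X * P
      map_add' := fun X Y => by rw [Matrix.mul_add, Matrix.add_mul]
      map_smul' := fun c X => by simp }
    (by change P' * (1 : Matrix N N T) * P = 1; rw [Matrix.mul_one, h1])
    (by
      intro X Y
      change P' * (X * Y) * P = P' * X * P * (P' * Y * P)
      calc P' * (X * Y) * P = P' * X * (1 : Matrix N N T) * Y * P := by simp [Matrix.mul_assoc]
        _ = _ := by rw [← h2]; simp only [Matrix.mul_assoc])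
  have hC : ∀ X, C X = P' * X * P := fun X => rfl
  have hbd : B.det ≠ 0 := (h.unit hf).ne_zero
  have hbd' : B'.det ≠ 0 := (h.unit' ht).ne_zero
  have fixs : ∀ (s : T ≃ₐ[F] T) (c : T) (_ : c ≠ 0) (Q X : Matrix N N T), c⁻¹ • Q * P.map s = P →
      X * Q = Q * X.map s → (C X).map s = C X := by
    intro s c hc Q X hQ hX
    have e1 : (P'.map s) * (P.map s) = 1 := by rw [← Matrix.map_mul, h1, map_one']
    have e2 : Q * P.map s = c • P := by
      conv_rhs => rw [← hQ, Matrix.smul_mul, smul_smul, mul_inv_cancel₀ hc, one_smul]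
    have e0 : P.map s * P'.map s = 1 := by rw [← Matrix.map_mul, h2, map_one']
    have e3 : P' * Q = c • P'.map s := by
      calc P' * Q = P' * Q * (P.map s * P'.map s) := by rw [e0, Matrix.mul_one]
        _ = P' * (Q * P.map s) * P'.map s := by simp only [Matrix.mul_assoc]
        _ = _ := by rw [e2]; simp [h1]
    have e4 : c • (C X).map s = c • C X := by
      rw [hC, Matrix.map_mul, Matrix.map_mul, ← Matrix.smul_mul, ← Matrix.smul_mul, ← e3,
        Matrix.mul_assoc P', ← hX, Matrix.mul_assoc, Matrix.mul_assoc, e2]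
      simp [Matrix.mul_assoc]
    have := congrArg (c⁻¹ • ·) e4
    simpa [smul_smul, inv_mul_cancel₀ hc] using this
  let j : Matrix (Fin m) (Fin m) F →ₐ[F] Matrix (Fin m) (Fin m) T := (Algebra.ofId F T).mapMatrix
  have hj : Function.Injective j := by
    intro X Y hXY
    ext a b
    have := congrFun (congrFun hXY a) b
    exact (algebraMap F T).injective this
  let K := kap (S.dAlg B B') k
  have hrange : ∀ x, C (K x) ∈ j.range := by
    intro x
    obtain ⟨m1, m2⟩ := kap_mem (S := S) (B := B) (B' := B') k x
    have f1 := fixs S.sg B.det hbd _ _ h3 m1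
    have f2 := fixs S.ta B'.det hbd' _ _ h4 m2
    have : ∀ a b, ∃ r, algebraMap F T r = C (K x) a b := fun a b =>
      S.fix _ (congrFun (congrFun f1 a) b) (congrFun (congrFun f2 a) b)
    choose r hr using this
    refine ⟨Matrix.of r, ?_⟩
    ext a b
    exact hr a b
  let phi : (⨂[F] (_ : Fin k), S.dAlg B B') →ₐ[F] Matrix (Fin m) (Fin m) F :=
    (AlgEquiv.ofInjective j hj).symm.toAlgHom.comp ((C.comp K).codRestrict j.range hrange)
  have hphi : ∀ x, j (phi x) = C (K x) := by
    intro x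
    have := (AlgEquiv.ofInjective j hj).apply_symm_apply ((C.comp K).codRestrict j.range hrange x)
    exact congrArg Subtype.val this
  have hsurj : Function.Surjective phi.toLinearMap := by
    rw [← LinearMap.range_eq_top]
    by_contra hne
    obtain ⟨lam, hlam, hle⟩ := Submodule.exists_le_ker_of_lt_top _ (lt_top_iff_ne_top.mpr hne)
    let L : Matrix (Fin m) (Fin m) T →ₗ[T] T :=
      ∑ a, ∑ b, algebraMap F T (lam (Matrix.single a b 1)) • Matrix.entryLinearMap T T a b
    have hL : ∀ X : Matrix (Fin m) (Fin m) T, L X = ∑ a, ∑ b, algebraMap F T (lam (Matrix.single a b 1)) * X a b := by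
      intro X; simp [L, LinearMap.sum_apply, Algebra.smul_def]
    have hLj : ∀ X, L (j X) = algebraMap F T (lam X) := by
      intro X
      rw [hL]
      conv_rhs => rw [Matrix.matrix_eq_sum_single X]
      rw [map_sum, map_sum]
      refine Finset.sum_congr rfl fun a _ => ?_
      rw [map_sum, map_sum]
      refine Finset.sum_congr rfl fun b _ => ?_
      have e : Matrix.single a b (X a b) = X a b • Matrix.single a b 1 := by simp
      rw [e, map_smul, smul_eq_mul, map_mul, mul_comm]
      rfl
    let CT : Matrix N N T →ₗ[T] Matrix (Fin m) (Fin m) T :=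
      { toFun := fun X => P' * X * P
        map_add' := fun X Y => by rw [Matrix.mul_add, Matrix.add_mul]
        map_smul' := fun c X => by simp }
    have h0 : ∀ Z : Matrix N N T, L (CT Z) = 0 := by
      intro Z
      have : (⊤ : Submodule T (Matrix N N T)) ≤ LinearMap.ker (L.comp CT) := by
        rw [← span_kap h hf ht k, Submodule.span_le]
        rintro _ ⟨x, rfl⟩
        change L (C (K x)) = 0
        rw [← hphi, hLj]
        have : lam (phi x) = 0 := hle ⟨x, rfl⟩
        rw [this, map_zero]
      exact this (Submodule.mem_top (x := Z))
    apply hlam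
    ext X
    have h5 : L (j X) = 0 := by
      have := h0 (P * j X * P')
      have e : CT (P * j X * P') = j X := by
        change P' * (P * j X * P') * P = j X
        rw [Matrix.mul_assoc, Matrix.mul_assoc, Matrix.mul_assoc, h1, Matrix.mul_one, ← Matrix.mul_assoc, h1, Matrix.one_mul]
      rwa [e] at this
    rw [hLj] at h5
    simpa using h5
  have hfr : Module.finrank F (⨂[F] (_ : Fin k), S.dAlg B B') = Module.finrank F (Matrix (Fin m) (Fin m) F) := by
    rw [hfr0, Module.finrank_matrix]
    simp only [Fintype.card_fin, Module.finrank_self, mul_one]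
    rw [sq]
  haveI : FiniteDimensional F (S.dAlg B B') := by
    apply Module.finite_of_finrank_pos
    rw [finrank_dAlg h hf ht]
    exact pow_pos Fintype.card_pos 2
  haveI : Module.Finite F (⨂[F] (_ : Fin k), S.dAlg B B') := PiTensorProduct.finite
  have hinj : Function.Injective phi.toLinearMap := by
    have key : ∀ (V W : Type) [Ring V] [Algebra F V] [Module.Finite F V] [Ring W] [Algebra F W] [Module.Finite F W]
        (g : V →ₗ[F] W), Module.finrank F V = Module.finrank F W → Function.Surjective g → Function.Injective g := by
      intro V W _ _ _ _ _ _ g h1 h2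
      exact (LinearMap.injective_iff_surjective_of_finrank_eq_finrank h1).mpr h2
    exact key (⨂[F] (_ : Fin k), S.dAlg B B') (Matrix (Fin m) (Fin m) F) phi.toLinearMap hfr hsurj
  exact ⟨AlgEquiv.ofBijective phi ⟨hinj, hsurj⟩⟩

end NCBi
end

section
set_option linter.unusedSectionVars false
set_option linter.style.haveILetI false
set_option linter.unusedSimpArgs false
open Matrix
open scoped TensorProduct

namespace NCBi
variable {F T : Type} [Field F] [Field T] [Algebra F T] {S : NCBi F T}
variable {ι : Type} [Fintype ι] [DecidableEq ι] {f t : F} {B B' : Matrix ι ι T}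

theorem vOp_mul (s s' : T ≃ₐ[F] T) (B B' : Matrix ι ι T) :
    vOp s B * vOp s' B' = vOp (s * s') (B * B'.map s) := by
  ext1 x
  rw [nc_mul_apply, vOp_apply, vOp_apply, vOp_apply, map_mulVec, Matrix.mulVec_mulVec]
  rfl

theorem vOp_one : vOp (1 : T ≃ₐ[F] T) (1 : Matrix ι ι T) = 1 := by
  ext1 x
  rw [vOp_apply]; simp

theorem vOp_pow' (s : T ≃ₐ[F] T) (B : Matrix ι ι T) (k : ℕ) :
    vOp s B ^ k = vOp (s ^ k) (nrm s B k) := by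
  ext1 x
  rw [vOp_pow, vOp_apply]

theorem vOp_inj {s : T ≃ₐ[F] T} {B B' : Matrix ι ι T} (h : vOp s B = vOp s B') : B = B' := by
  ext i j
  have := congrFun (DFunLike.congr_fun h (Pi.single j 1)) i
  rw [vOp_apply, vOp_apply] at this
  have e : (fun i => s ((Pi.single j 1 : ι → T) i)) = Pi.single j 1 := by
    ext k
    by_cases hk : k = j
    · subst hk; simp
    · simp [hk]
  rw [e] at this
  simpa using this

/-- the matrix of `u^i v^j` -/
def Mij (S : NCBi F T) (B B' : Matrix ι ι T) (i j : ℕ) : Matrix ι ι T :=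
  nrm S.sg B i * (nrm S.ta B' j).map (S.sg ^ i : T ≃ₐ[F] T)

theorem vOp_Mij (i j : ℕ) : vOp S.sg B ^ i * vOp S.ta B' ^ j = vOp (S.sg ^ i * S.ta ^ j) (S.Mij B B' i j) := by
  rw [vOp_pow', vOp_pow', vOp_mul, Mij]

theorem vOp_scalar_pow (c : F) (k : ℕ) : vOp (1 : T ≃ₐ[F] T) (algebraMap F T c • (1 : Matrix ι ι T)) ^ k =
    vOp (1 : T ≃ₐ[F] T) (algebraMap F T (c ^ k) • 1) := by
  induction k with
  | zero => simp [vOp_one]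
  | succ k ih =>
    rw [pow_succ, ih, vOp_mul, map_smul', map_one']
    rw [one_mul, AlgEquiv.one_apply, smul_mul_smul_comm, one_mul, ← map_mul, pow_succ]

theorem nrm_Mij (h : S.Tw f t B B') (i j : ℕ) :
    nrm (S.sg ^ i * S.ta ^ j) (S.Mij B B' i j) (S.n * S.l) =
      algebraMap F T (f ^ (i * S.l) * t ^ (j * S.n)) • 1 := by
  have hcS : Commute S.sg S.ta := S.comm
  have hs : (S.sg ^ i * S.ta ^ j) ^ (S.n * S.l) = 1 := by
    rw [(hcS.pow_pow i j).mul_pow, ← pow_mul, ← pow_mul,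
      show i * (S.n * S.l) = S.n * (i * S.l) by ring, show j * (S.n * S.l) = S.l * (j * S.n) by ring,
      pow_mul S.sg, pow_mul S.ta, S.sgn, S.tal]; simp
  apply vOp_inj (s := (1 : T ≃ₐ[F] T))
  have e1 : vOp (1 : T ≃ₐ[F] T) (nrm (S.sg ^ i * S.ta ^ j) (S.Mij B B' i j) (S.n * S.l)) =
      (vOp S.sg B ^ i * vOp S.ta B' ^ j) ^ (S.n * S.l) := by
    rw [vOp_Mij, vOp_pow', hs]
  have hc : Commute (vOp S.sg B) (vOp S.ta B') := vOp_comm h.hc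
  rw [e1, (hc.pow_pow i j).mul_pow, ← pow_mul, ← pow_mul,
      show i * (S.n * S.l) = S.n * (i * S.l) by ring, show j * (S.n * S.l) = S.l * (j * S.n) by ring,
      pow_mul (vOp S.sg B), pow_mul (vOp S.ta B'), vOp_pow' S.sg, vOp_pow' S.ta, h.hB, h.hB', S.sgn, S.tal, vOp_scalar_pow, vOp_scalar_pow,
      vOp_mul, map_smul', map_one']
  rw [one_mul, AlgEquiv.one_apply, smul_mul_smul_comm, one_mul, ← map_mul]

theorem dAlg_Mij {X : Matrix ι ι T} (hX : X ∈ S.dAlg B B') (i j : ℕ) :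
    X * S.Mij B B' i j = S.Mij B B' i j * X.map (S.sg ^ i * S.ta ^ j : T ≃ₐ[F] T) := by
  obtain ⟨h1, h2⟩ := mem_dAlg.mp hX
  have c1 : Commute (vOp (1 : T ≃ₐ[F] T) X) (vOp S.sg B) := by
    change _ * _ = _ * _
    rw [vOp_mul, vOp_mul, one_mul, mul_one, ← h1]; rfl
  have c2 : Commute (vOp (1 : T ≃ₐ[F] T) X) (vOp S.ta B') := by
    change _ * _ = _ * _
    rw [vOp_mul, vOp_mul, one_mul, mul_one, ← h2]; rfl
  have c3 := (c1.pow_right i).mul_right (c2.pow_right j)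
  rw [vOp_Mij] at c3
  have := c3.eq
  rw [vOp_mul, vOp_mul, one_mul, mul_one] at this
  exact vOp_inj this

theorem exists_beta (h : S.Tw f t B B') {T' : Type} [Field T'] [Algebra F T'] [Algebra T T'] [IsScalarTower F T T']
    {X : Matrix ι ι T} (hX : X ∈ S.dAlg B B') {th : T'} {v : ι → T'} (hv : v ≠ 0)
    (hXv : X.map (algebraMap T T') *ᵥ v = th • v)
    (huniq : ∀ w, X.map (algebraMap T T') *ᵥ w = th • w → ∃ c : T', w = c • v)
    {g : T' ≃ₐ[F] T'} (hg : g th = th) {i j : ℕ}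
    (hgT : ∀ x : T, g (algebraMap T T' x) = algebraMap T T' ((S.sg ^ i * S.ta ^ j : T ≃ₐ[F] T) x))
    (hgn : g ^ (S.n * S.l) = 1) :
    ∃ β : T', ∏ k ∈ Finset.range (S.n * S.l), (g ^ k) β = algebraMap F T' (f ^ (i * S.l) * t ^ (j * S.n)) := by
  set s := (S.sg ^ i * S.ta ^ j : T ≃ₐ[F] T) with hs
  set M := S.Mij B B' i j with hM
  have hmap : ∀ Y : Matrix ι ι T, (Y.map (algebraMap T T')).map g = (Y.map s).map (algebraMap T T') := by
    intro Y; ext a b; exact hgT _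
  have hnrm : ∀ k, nrm g (M.map (algebraMap T T')) k = (nrm s M k).map (algebraMap T T') := by
    intro k
    induction k with
    | zero => simp [nrm]
    | succ k ih => rw [nrm, ih, hmap, nrm, Matrix.map_mul]
  have h1 : X.map (algebraMap T T') *ᵥ (vOp g (M.map (algebraMap T T')) v) = th • vOp g (M.map (algebraMap T T')) v := by
    rw [vOp_apply, Matrix.mulVec_mulVec, ← Matrix.map_mul, dAlg_Mij hX, Matrix.map_mul, ← hs, ← hmap,
      ← Matrix.mulVec_mulVec, ← map_mulVec, hXv]
    have := vOp_smul g (M.map (algebraMap T T')) th v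
    rw [vOp_apply, vOp_apply, hg] at this
    exact this
  obtain ⟨β, hβ⟩ := huniq _ h1
  refine ⟨β, ?_⟩
  have h2 : ∀ k, (vOp g (M.map (algebraMap T T')) ^ k) v = (∏ k ∈ Finset.range k, (g ^ k) β) • v := by
    intro k
    induction k with
    | zero => simp
    | succ k ih =>
      rw [pow_succ', nc_mul_apply, ih, vOp_smul, hβ, smul_smul, Finset.prod_range_succ']
      simp only [map_prod, pow_succ']
      rfl
  have h3 := h2 (S.n * S.l)
  rw [vOp_pow, hnrm, hgn, nrm_Mij h] at h3
  obtain ⟨a, ha⟩ := Function.ne_iff.mp hv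
  have h4 := congrFun h3 a
  have e : (algebraMap F T (f ^ (i * S.l) * t ^ (j * S.n)) • (1 : Matrix ι ι T)).map (algebraMap T T') =
      algebraMap F T' (f ^ (i * S.l) * t ^ (j * S.n)) • 1 := by
    ext a b
    rw [IsScalarTower.algebraMap_apply F T T']
    by_cases hab : a = b
    · subst hab; simp
    · simp [hab]
  rw [e] at h4
  simp only [Matrix.smul_mulVec, Pi.smul_apply, smul_eq_mul, Matrix.one_mulVec, AlgEquiv.one_apply] at h4
  exact (mul_right_cancel₀ ha h4).symm

end NCBi
end

section
set_option linter.unusedSectionVars false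
set_option linter.style.haveILetI false
set_option linter.unusedSimpArgs false
open Matrix
open scoped TensorProduct

namespace NCBi
variable {F T : Type} [Field F] [Field T] [Algebra F T] {S : NCBi F T}
variable {ι : Type} [Fintype ι] [DecidableEq ι] {f t : F} {B B' : Matrix ι ι T}

/-- the arithmetic condition preventing Galois maximal subfields -/
def NCcond (S : NCBi F T) (f t : F) (δ : ℕ) : Prop :=
  ∀ (T' : Type) [Field T'] [Algebra F T'] [Algebra T T'] [IsScalarTower F T T']
    [FiniteDimensional F T'] [IsGalois F T'] (K' : IntermediateField F T') [IsGalois F K'],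
    Module.finrank F K' = δ →
    (∀ g : T' ≃ₐ[F] T', (∀ x ∈ K', g x = x) → (∀ x : T, g (algebraMap T T' x) = algebraMap T T' x) → g = 1) →
    ¬ ∀ g : T' ≃ₐ[F] T', (∀ x ∈ K', g x = x) → ∀ i j : ℕ,
      (∀ x : T, g (algebraMap T T' x) = algebraMap T T' ((S.sg ^ i * S.ta ^ j : T ≃ₐ[F] T) x)) →
      ∃ β : T', ∏ k ∈ Finset.range (S.n * S.l), (g ^ k) β =
        algebraMap F T' (f ^ (i * S.l) * t ^ (j * S.n))

theorem charpoly_fix {s : T ≃ₐ[F] T} {X B : Matrix ι ι T} (hB : IsUnit B.det) (h : X * B = B * X.map s) :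
    X.charpoly.map (s : T →+* T) = X.charpoly := by
  rw [← Matrix.charpoly_map]
  have hu : IsUnit B := (Matrix.isUnit_iff_isUnit_det B).mpr hB
  obtain ⟨u, rfl⟩ := hu
  have e : X.map (s : T →+* T) = (↑u⁻¹ : Matrix ι ι T) * X * (↑u : Matrix ι ι T) := by
    rw [Matrix.mul_assoc, h, ← Matrix.mul_assoc, Units.inv_mul, Matrix.one_mul]; rfl
  rw [e, Matrix.coe_units_inv, Matrix.charpoly_units_conj']

theorem charpoly_desc (h : S.Tw f t B B') (hf : f ≠ 0) (ht : t ≠ 0) {X : Matrix ι ι T} (hX : X ∈ S.dAlg B B') :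
    ∃ c : Polynomial F, c.Monic ∧ c.natDegree = Fintype.card ι ∧ c.map (algebraMap F T) = X.charpoly := by
  obtain ⟨h1, h2⟩ := mem_dAlg.mp hX
  have f1 := charpoly_fix (h.unit hf) h1
  have f2 := charpoly_fix (h.unit' ht) h2
  have hl : X.charpoly ∈ Polynomial.lifts (algebraMap F T) := by
    rw [Polynomial.lifts_iff_coeff_lifts]
    intro k
    refine S.fix _ ?_ ?_
    · have := congrArg (fun q => Polynomial.coeff q k) f1
      simpa using this
    · have := congrArg (fun q => Polynomial.coeff q k) f2
      simpa using this
  obtain ⟨c, hc1, hc2, hc3⟩ := Polynomial.lifts_and_natDegree_eq_and_monic hl (Matrix.charpoly_monic X)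
  exact ⟨c, hc3, by rw [hc2, Matrix.charpoly_natDegree_eq_dim], hc1⟩

theorem charpoly_eq_minpoly (h : S.Tw f t B B') (hf : f ≠ 0) (ht : t ≠ 0) (X : S.dAlg B B')
    (hX : (minpoly F X).natDegree = Fintype.card ι) :
    (minpoly F X).map (algebraMap F T) = (X : Matrix ι ι T).charpoly := by
  obtain ⟨c, h1, h2, h3⟩ := charpoly_desc h hf ht X.2
  have h4 : Polynomial.aeval (X : Matrix ι ι T) c = 0 := by
    have := Matrix.aeval_self_charpoly (X : Matrix ι ι T)
    rw [← h3, Polynomial.aeval_map_algebraMap] at this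
    exact this
  have h5 : Polynomial.aeval X c = 0 := by
    apply Subtype.ext
    have := Polynomial.aeval_algHom_apply (S.dAlg B B').val X c
    rw [← Subalgebra.coe_val, ← this]
    simpa using h4
  have hintg : IsIntegral F X := ⟨c, h1, h5⟩
  have h6 : c = minpoly F X := (Polynomial.eq_of_monic_of_dvd_of_natDegree_le (minpoly.monic hintg) h1
    (minpoly.dvd F X h5) (by rw [h2, hX]))
  rw [← h6, h3]

theorem exists_eigen {T' : Type} [Field T'] [Algebra F T'] [Algebra T T'] [IsScalarTower F T T']
    (X : Matrix ι ι T) (m : Polynomial F) (hm : m.map (algebraMap F T) = X.charpoly) (hsep : m.Separable)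
    (th : T') (hth : Polynomial.aeval th m = 0) :
    ∃ v : ι → T', v ≠ 0 ∧ X.map (algebraMap T T') *ᵥ v = th • v ∧
    (∀ w, X.map (algebraMap T T') *ᵥ w = th • w → ∃ c : T', w = c • v) := by
  set Y := X.map (algebraMap T T') with hY
  have hc : Y.charpoly = m.map (algebraMap F T') := by
    rw [hY, Matrix.charpoly_map, ← hm, Polynomial.map_map, ← IsScalarTower.algebraMap_eq]
  have hch : (Matrix.toLin' Y).charpoly = m.map (algebraMap F T') := by
    rw [Matrix.charpoly_toLin', hc]
  have hroot : (Matrix.toLin' Y).charpoly.IsRoot th := by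
    rw [hch, Polynomial.IsRoot, Polynomial.eval_map_algebraMap, hth]
  have hev : Module.End.HasEigenvalue (Matrix.toLin' Y) th := by
    rw [Module.End.hasEigenvalue_iff_isRoot_charpoly]; exact hroot
  obtain ⟨v, hv⟩ := hev.exists_hasEigenvector
  have hv1 : Y *ᵥ v = th • v := by
    have := hv.apply_eq_smul
    rwa [Matrix.toLin'_apply] at this
  refine ⟨v, hv.2, hv1, ?_⟩
  intro w hw
  have hfr : Module.finrank T' (Module.End.eigenspace (Matrix.toLin' Y) th) ≤ 1 := by
    refine (LinearMap.finrank_eigenspace_le _ _).trans ?_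
    rw [hch]
    exact Polynomial.rootMultiplicity_le_one_of_separable hsep.map th
  obtain ⟨c, hc⟩ := (finrank_le_one_iff.mp hfr)
  have hwm : w ∈ Module.End.eigenspace (Matrix.toLin' Y) th := by
    rw [Module.End.mem_eigenspace_iff, Matrix.toLin'_apply, hw]
  obtain ⟨a, ha⟩ := hc ⟨v, hv.1⟩
  obtain ⟨b, hb⟩ := hc ⟨w, hwm⟩
  have ha' : a • (c : ι → T') = v := congrArg Subtype.val ha
  have hb' : b • (c : ι → T') = w := congrArg Subtype.val hb
  have ha0 : a ≠ 0 := by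
    rintro rfl
    exact hv.2 (by rw [← ha', zero_smul])
  refine ⟨b * a⁻¹, ?_⟩
  rw [← ha', smul_smul, mul_assoc, inv_mul_cancel₀ ha0, mul_one, hb']

/-- Key: no Galois maximal subfield. `K` an abstract field embedded in `dAlg`. -/
theorem no_galois [Nonempty ι] [FiniteDimensional F T] [IsGalois F T] (h : S.Tw f t B B') (hf : f ≠ 0) (ht : t ≠ 0)
    (hNC : S.NCcond f t (Fintype.card ι))
    {K : Type} [Field K] [Algebra F K] [FiniteDimensional F K] [IsGalois F K] (hK : Module.finrank F K = Fintype.card ι)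
    (j : K →ₐ[F] S.dAlg B B') (hj : Function.Injective j) : False := by
  let Ω := AlgebraicClosure T
  obtain ⟨th, hth⟩ := Field.exists_primitive_element F K
  let φ : K →ₐ[F] Ω := IsAlgClosed.lift
  let ψ : T →ₐ[F] Ω := IsScalarTower.toAlgHom F T Ω
  let T' : IntermediateField F Ω := φ.fieldRange ⊔ ψ.fieldRange
  haveI g1 : IsGalois F φ.fieldRange := IsGalois.of_algEquiv (AlgEquiv.ofInjectiveField φ)
  haveI g2 : IsGalois F ψ.fieldRange := IsGalois.of_algEquiv (AlgEquiv.ofInjectiveField ψ)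
  haveI : FiniteDimensional F φ.fieldRange := LinearEquiv.finiteDimensional (AlgEquiv.ofInjectiveField φ).toLinearEquiv
  haveI : FiniteDimensional F ψ.fieldRange := LinearEquiv.finiteDimensional (AlgEquiv.ofInjectiveField ψ).toLinearEquiv
  haveI : FiniteDimensional F T' := IntermediateField.finiteDimensional_sup _ _
  haveI : Normal F T' := IntermediateField.normal_sup F Ω φ.fieldRange ψ.fieldRange
  haveI : Algebra.IsSeparable F T' := IntermediateField.isSeparable_sup F Ω φ.fieldRange ψ.fieldRange
  haveI : IsGalois F T' := {}
  let ψ' : T →ₐ[F] T' := ψ.codRestrict T'.toSubalgebra (fun x => (le_sup_right : ψ.fieldRange ≤ T') ⟨x, rfl⟩)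
  let φ' : K →ₐ[F] T' := φ.codRestrict T'.toSubalgebra (fun x => (le_sup_left : φ.fieldRange ≤ T') ⟨x, rfl⟩)
  letI : Algebra T T' := ψ'.toRingHom.toAlgebra
  haveI : IsScalarTower F T T' := IsScalarTower.of_algebraMap_eq (fun x => (ψ'.commutes x).symm)
  have hal : ∀ x, algebraMap T T' x = ψ' x := fun x => rfl
  haveI : IsGalois F φ'.fieldRange := IsGalois.of_algEquiv (AlgEquiv.ofInjectiveField φ')
  have hgen : ∀ g : T' ≃ₐ[F] T', (∀ x ∈ φ'.fieldRange, g x = x) →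
      (∀ x : T, g (algebraMap T T' x) = algebraMap T T' x) → g = 1 := by
    intro g h1 h2
    let E : IntermediateField F T' := IntermediateField.fixedField (Subgroup.zpowers g)
    have hE : ∀ x : T', g x = x → x ∈ E := by
      intro x hx
      rw [IntermediateField.mem_fixedField_iff]
      intro g' hg'
      have : Subgroup.zpowers g ≤ MulAction.stabilizer (T' ≃ₐ[F] T') x := by
        rw [Subgroup.zpowers_le]; exact hx
      exact this hg'
    have hle : T' ≤ IntermediateField.lift E := by
      refine sup_le ?_ ?_
      · rintro _ ⟨x, rfl⟩
        exact ⟨φ' x, hE _ (h1 _ ⟨x, rfl⟩), rfl⟩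
      · rintro _ ⟨x, rfl⟩
        exact ⟨ψ' x, hE _ (h2 x), rfl⟩
    ext1 x
    obtain ⟨y, hy, hyx⟩ := hle x.2
    have : y = x := Subtype.ext hyx
    subst this
    exact (IntermediateField.mem_fixedField_iff _ _).mp hy g (Subgroup.mem_zpowers g)
  refine hNC T' φ'.fieldRange ?_ hgen ?_
  · rw [← hK]; exact (AlgEquiv.ofInjectiveField φ').toLinearEquiv.finrank_eq.symm
  · intro g hg i j' hgT
    have hmin : minpoly F (j th) = minpoly F th := minpoly.algHom_eq j hj th
    have hdeg : (minpoly F (j th)).natDegree = Fintype.card ι := by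
      rw [hmin, ← hK]
      exact (Field.primitive_element_iff_minpoly_natDegree_eq F th).mp hth
    have hcm := charpoly_eq_minpoly h hf ht (j th) hdeg
    rw [hmin] at hcm
    obtain ⟨v, hv1, hv2, hv3⟩ := exists_eigen (T' := T') _ _ hcm (Algebra.IsSeparable.isSeparable F th) (φ' th)
      (by rw [Polynomial.aeval_algHom_apply, minpoly.aeval, map_zero])
    refine exists_beta h (j th).2 hv1 hv2 hv3 (hg _ ⟨th, rfl⟩) hgT ?_
    apply hgen
    · intro x hx
      have : g ∈ MulAction.stabilizer (T' ≃ₐ[F] T') x := hg x hx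
      exact (Subgroup.pow_mem _ this (S.n * S.l))
    · intro x
      have hcS : Commute S.sg S.ta := S.comm
      have hs : (S.sg ^ i * S.ta ^ j') ^ (S.n * S.l) = 1 := by
        rw [(hcS.pow_pow i j').mul_pow, ← pow_mul, ← pow_mul,
          show i * (S.n * S.l) = S.n * (i * S.l) by ring, show j' * (S.n * S.l) = S.l * (j' * S.n) by ring,
          pow_mul S.sg, pow_mul S.ta, S.sgn, S.tal]; simp
      have hk : ∀ k : ℕ, (g ^ k) (algebraMap T T' x) = algebraMap T T' (((S.sg ^ i * S.ta ^ j') ^ k : T ≃ₐ[F] T) x) := by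
        intro k
        induction k with
        | zero => simp
        | succ k ih =>
          rw [pow_succ', AlgEquiv.mul_apply, ih, hgT, ← AlgEquiv.mul_apply, ← pow_succ']
      rw [hk, hs, AlgEquiv.one_apply]

end NCBi
end

section
set_option linter.unusedSectionVars false
set_option linter.style.haveILetI false
set_option linter.unusedSimpArgs false
open Matrix
open scoped TensorProduct

namespace NCBi
variable {F T : Type} [Field F] [Field T] [Algebra F T] {S : NCBi F T}
variable {ι : Type} [Fintype ι] [DecidableEq ι] {f t : F} {B B' : Matrix ι ι T}

theorem partA [Nonempty ι] [FiniteDimensional F T] [IsGalois F T] (h : S.Tw f t B B') (hf : f ≠ 0) (ht : t ≠ 0)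
    (LB : ∀ (r : ℕ) (b b' : T), S.Sc (f ^ r) (t ^ r) b b' → Fintype.card ι ∣ r)
    (hNC : S.NCcond f t (Fintype.card ι)) :
    ∃ D : CentralDivisionAlgebra F, Module.finrank F D.carrier = Fintype.card ι ^ 2 ∧
      BrauerClassHasOrder F D.carrier (Fintype.card ι) ∧ IsNoncrossedProduct F D.carrier := by
  haveI hfin : FiniteDimensional F (S.dAlg B B') := by
    apply Module.finite_of_finrank_pos
    rw [finrank_dAlg h hf ht]
    exact pow_pos Fintype.card_pos 2
  haveI : Nontrivial (S.dAlg B B') := ⟨0, 1, fun e => zero_ne_one (congrArg (fun z : S.dAlg B B' => (z : Matrix ι ι T)) e)⟩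
  haveI : NoZeroDivisors (S.dAlg B B') := ⟨by
    intro X Y hXY
    by_contra! hne
    have h1 : (X : Matrix ι ι T) ≠ 0 := fun e => hne.1 (Subtype.ext e)
    have hu := dAlg_unit h LB X.2 h1
    have hXY' : (X : Matrix ι ι T) * (Y : Matrix ι ι T) = 0 := congrArg Subtype.val hXY
    apply hne.2
    apply Subtype.ext
    change (Y : Matrix ι ι T) = 0
    have := congrArg (fun Z => (X : Matrix ι ι T)⁻¹ * Z) hXY'
    simpa [← Matrix.mul_assoc, Matrix.nonsing_inv_mul _ hu] using this⟩
  haveI : IsDomain (S.dAlg B B') := NoZeroDivisors.to_isDomain _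
  letI dr : DivisionRing (S.dAlg B B') := divisionRingOfFiniteDimensional F (S.dAlg B B')
  let D : CentralDivisionAlgebra F :=
    { carrier := S.dAlg B B'
      divisionRing := dr
      algebra := (S.dAlg B B').algebra
      finiteDimensional := hfin
      central := center_dAlg h hf ht }
  refine ⟨D, finrank_dAlg h hf ht, ⟨Fintype.card_pos, ?_, ?_⟩, ?_⟩
  · exact period_upper h hf ht
  · rintro k hk hk2 ⟨m, hm, ⟨e⟩⟩
    have := period_lower h hf ht LB hm e
    exact absurd (Nat.le_of_dvd hk this) (by omega)
  · rintro ⟨K, hK, hdim, hgal⟩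
    letI := hK.toField
    have hKr : Module.finrank F K = Fintype.card ι := by
      rw [show Module.finrank F D.carrier = Fintype.card ι ^ 2 from finrank_dAlg h hf ht] at hdim
      exact Nat.pow_left_injective (n := 2) (by norm_num) hdim
    haveI : FiniteDimensional F K := Module.finite_of_finrank_pos (by rw [hKr]; exact Fintype.card_pos)
    exact no_galois (K := K) h hf ht hNC hKr K.val Subtype.val_injective

end NCBi
end

section
set_option linter.unusedSectionVars false
set_option linter.style.haveILetI false
set_option linter.unusedSimpArgs false

open WithZero

namespace PlB

/-- A normalised discrete place of the field `K` with residue field `k`. -/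
structure Place (K k : Type) [Field K] [Field k] where
  v : Valuation K ℤᵐ⁰
  r : K → k
  r_one : r 1 = 1
  r_add : ∀ {x y}, v x ≤ 1 → v y ≤ 1 → r (x + y) = r x + r y
  r_mul : ∀ {x y}, v x ≤ 1 → v y ≤ 1 → r (x * y) = r x * r y
  r_eq_zero : ∀ {x}, v x ≤ 1 → (r x = 0 ↔ v x < 1)
  surj : ∀ y, ∃ x, v x ≤ 1 ∧ r x = y
  unif : ∃ x, v x = exp (-1 : ℤ)

namespace Place
variable {K k : Type} [Field K] [Field k] (p : Place K k)

theorem r_zero : p.r 0 = 0 := (p.r_eq_zero (by simp)).2 (by simp)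

theorem r_neg {x} (hx : p.v x ≤ 1) : p.r (-x) = - p.r x := by
  have h := p.r_add hx (y := -x) (by simpa using hx)
  rw [add_neg_cancel, p.r_zero] at h
  exact (neg_eq_of_add_eq_zero_right h.symm).symm

theorem r_sub {x y} (hx : p.v x ≤ 1) (hy : p.v y ≤ 1) : p.r (x - y) = p.r x - p.r y := by
  rw [sub_eq_add_neg, p.r_add hx (by simpa using hy), p.r_neg hy, sub_eq_add_neg]

theorem v_pow_le {x} (hx : p.v x ≤ 1) (n : ℕ) : p.v (x ^ n) ≤ 1 := by
  rw [map_pow]; exact pow_le_one' hx n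

theorem r_pow {x} (hx : p.v x ≤ 1) (n : ℕ) : p.r (x ^ n) = p.r x ^ n := by
  induction n with
  | zero => simp [p.r_one]
  | succ n ih => rw [pow_succ, p.r_mul (p.v_pow_le hx n) hx, ih, pow_succ]

theorem v_prod_le {ι : Type*} (s : Finset ι) (g : ι → K) (h : ∀ i ∈ s, p.v (g i) ≤ 1) :
    p.v (∏ i ∈ s, g i) ≤ 1 := by
  rw [map_prod]; exact Finset.prod_le_one' h

theorem r_prod {ι : Type*} (s : Finset ι) (g : ι → K) (h : ∀ i ∈ s, p.v (g i) ≤ 1) :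
    p.r (∏ i ∈ s, g i) = ∏ i ∈ s, p.r (g i) := by
  classical
  induction s using Finset.induction_on with
  | empty => simp [p.r_one]
  | insert a s ha ih =>
    rw [Finset.prod_insert ha, Finset.prod_insert ha,
      p.r_mul (h _ (Finset.mem_insert_self _ _))
        (p.v_prod_le _ _ fun i hi => h i (Finset.mem_insert_of_mem hi)),
      ih fun i hi => h i (Finset.mem_insert_of_mem hi)]

theorem r_ne_zero {x} (hx : p.v x = 1) : p.r x ≠ 0 := by
  rw [Ne, p.r_eq_zero hx.le, hx]; exact lt_irrefl _

theorem v_eq_one_of_r_ne {x} (hx : p.v x ≤ 1) (h : p.r x ≠ 0) : p.v x = 1 :=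
  le_antisymm hx (not_lt.1 fun h' => h ((p.r_eq_zero hx).2 h'))

theorem r_inv {x} (hx : p.v x = 1) : p.r x⁻¹ = (p.r x)⁻¹ := by
  have h0 : x ≠ 0 := by rintro rfl; simp at hx
  have h := p.r_mul hx.le (y := x⁻¹) (by simp [hx])
  rw [mul_inv_cancel₀ h0, p.r_one] at h
  exact eq_inv_of_mul_eq_one_right h.symm

theorem r_div {x y} (hx : p.v x ≤ 1) (hy : p.v y = 1) : p.r (x / y) = p.r x / p.r y := by
  rw [div_eq_mul_inv, p.r_mul hx (by simp [hy]), p.r_inv hy, div_eq_mul_inv]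

theorem v_add_le {x y} (hx : p.v x ≤ 1) (hy : p.v y ≤ 1) : p.v (x + y) ≤ 1 :=
  (p.v.map_add _ _).trans (max_le hx hy)

theorem v_sub_le {x y} (hx : p.v x ≤ 1) (hy : p.v y ≤ 1) : p.v (x - y) ≤ 1 :=
  (p.v.map_sub _ _).trans (max_le hx hy)

theorem v_mul_le {x y} (hx : p.v x ≤ 1) (hy : p.v y ≤ 1) : p.v (x * y) ≤ 1 := by
  rw [map_mul]; exact mul_le_one' hx hy

theorem r_natCast (n : ℕ) : p.v (n : K) ≤ 1 ∧ p.r (n : K) = n := by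
  induction n with
  | zero => simp [p.r_zero]
  | succ n ih =>
    push_cast
    exact ⟨p.v_add_le ih.1 (by simp), by rw [p.r_add ih.1 (by simp), ih.2, p.r_one]⟩

theorem r_congr {x y} (hx : p.v x ≤ 1) (h : p.v (x - y) < 1) : p.r x = p.r y := by
  have hy : p.v y ≤ 1 := by
    have := p.v_sub_le hx h.le
    simpa using this
  have := (p.r_eq_zero h.le).2 h
  rw [p.r_sub hx hy] at this
  exact sub_eq_zero.1 this

theorem r_eq_iff {x y} (hx : p.v x ≤ 1) (hy : p.v y ≤ 1) : p.r x = p.r y ↔ p.v (x - y) < 1 := by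
  rw [← sub_eq_zero, ← p.r_sub hx hy, p.r_eq_zero (p.v_sub_le hx hy)]

/-- the order -/
noncomputable def ord (x : K) : ℤ := - log (p.v x)

theorem v_ne {x : K} (hx : x ≠ 0) : p.v x ≠ 0 := (p.v.ne_zero_iff).2 hx

theorem v_eq_exp {x : K} (hx : x ≠ 0) : p.v x = exp (- p.ord x) := by
  rw [ord, neg_neg, exp_log (p.v_ne hx)]

theorem ord_of_v {x : K} {m : ℤ} (h : p.v x = exp (-m)) : p.ord x = m := by
  rw [ord, h, log_exp, neg_neg]

theorem ord_mul {x y : K} (hx : x ≠ 0) (hy : y ≠ 0) : p.ord (x * y) = p.ord x + p.ord y := by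
  rw [ord, map_mul, log_mul (p.v_ne hx) (p.v_ne hy), ord, ord]; ring

theorem ord_pow (x : K) (n : ℕ) : p.ord (x ^ n) = n * p.ord x := by
  rw [ord, map_pow, log_pow, ord]; simp

theorem ord_zpow (x : K) (n : ℤ) : p.ord (x ^ n) = n * p.ord x := by
  rw [ord, map_zpow₀, log_zpow, ord]; simp

theorem ord_eq_zero {x : K} (hx : x ≠ 0) : p.ord x = 0 ↔ p.v x = 1 := by
  rw [p.v_eq_exp hx]; simp

theorem ord_one_of {x : K} (hx : p.v x = 1) : p.ord x = 0 := by
  rw [ord, hx]; simp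

theorem ord_prod {ι : Type*} (s : Finset ι) (g : ι → K) (h : ∀ i ∈ s, g i ≠ 0) :
    p.ord (∏ i ∈ s, g i) = ∑ i ∈ s, p.ord (g i) := by
  classical
  induction s using Finset.induction_on with
  | empty => simp [ord]
  | insert a s ha ih =>
    rw [Finset.prod_insert ha, Finset.sum_insert ha, p.ord_mul (h _ (Finset.mem_insert_self _ _))
      (Finset.prod_ne_zero_iff.2 fun i hi => h i (Finset.mem_insert_of_mem hi)),
      ih fun i hi => h i (Finset.mem_insert_of_mem hi)]

theorem ord_surj (m : ℤ) : ∃ x : K, x ≠ 0 ∧ p.ord x = m := by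
  obtain ⟨x, hx⟩ := p.unif
  have h0 : x ≠ 0 := by rintro rfl; rw [map_zero] at hx; exact exp_ne_zero hx.symm
  refine ⟨x ^ m, zpow_ne_zero _ h0, ?_⟩
  rw [ord_zpow, p.ord_of_v hx, mul_one]

/-- distinct roots of unity have distinct reductions -/
theorem v_root {C : K} {N : ℕ} (hN : N ≠ 0) (h : C ^ N = 1) : p.v C = 1 := by
  have : p.v C ^ N = 1 := by rw [← map_pow, h, map_one]
  rcases lt_trichotomy (p.v C) 1 with h1 | h1 | h1
  · exact absurd this (pow_lt_one₀ zero_le h1 hN).ne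
  · exact h1
  · exact absurd this (one_lt_pow₀ h1 hN).ne'

theorem prim_root {C : K} {N : ℕ} [NeZero (N : k)] (h : IsPrimitiveRoot C N) :
    IsPrimitiveRoot (p.r C) N := by
  have hN : N ≠ 0 := by rintro rfl; exact NeZero.ne (((0 : ℕ) : k)) (by simp)
  have hv := p.v_root hN h.pow_eq_one
  haveI : NeZero N := ⟨hN⟩
  have hroots : ∀ j, p.r (C ^ j) = p.r C ^ j := fun j => p.r_pow hv.le j
  have hpow : p.r C ^ N = 1 := by rw [← hroots, h.pow_eq_one, p.r_one]
  -- simple roots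
  refine IsPrimitiveRoot.mk_of_lt _ (Nat.pos_of_ne_zero hN) hpow ?_
  intro l hl0 hl hC
  have hfac : (Polynomial.X ^ N - 1 : Polynomial K)
      = ∏ j ∈ Finset.range N, (Polynomial.X - Polynomial.C (C ^ j)) := by
    rw [Polynomial.X_pow_sub_one_eq_prod (Nat.pos_of_ne_zero hN) h]
    symm
    refine Finset.prod_bij (fun j _ => C ^ j) ?_ ?_ ?_ ?_
    · intro j _
      rw [Polynomial.mem_nthRootsFinset (Nat.pos_of_ne_zero hN), ← pow_mul, mul_comm, pow_mul,
        h.pow_eq_one, one_pow]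
    · intro i hi j hj hij
      exact h.pow_inj (Finset.mem_range.1 hi) (Finset.mem_range.1 hj) hij
    · intro z hz
      rw [Polynomial.mem_nthRootsFinset (Nat.pos_of_ne_zero hN)] at hz
      obtain ⟨i, hi, rfl⟩ := h.eq_pow_of_pow_eq_one hz
      exact ⟨i, Finset.mem_range.2 hi, rfl⟩
    · intro j _; rfl
  -- derivative at 1 : N = ∏_{0<j<N} (1 - C^j)
  have hder : (N : K) = ∏ j ∈ (Finset.range N).erase 0, (1 - C ^ j) := by
    have h1 := congrArg Polynomial.derivative hfac
    rw [Polynomial.derivative_prod_finset] at h1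
    have h2 := congrArg (Polynomial.eval 1) h1
    rw [Polynomial.eval_finsetSum, Finset.sum_eq_single_of_mem 0
      (Finset.mem_range.2 (Nat.pos_of_ne_zero hN))] at h2
    · simpa [Polynomial.eval_prod, Polynomial.derivative_X_pow] using h2
    · intro j hj hj0
      rw [Polynomial.eval_mul, Polynomial.eval_prod,
        Finset.prod_eq_zero (i := 0)]
      · simp
      · exact Finset.mem_erase.2 ⟨hj0.symm, Finset.mem_range.2 (Nat.pos_of_ne_zero hN)⟩
      · simp
  have h3 := congrArg p.r hder
  rw [(p.r_natCast N).2, p.r_prod _ _ (fun j _ => p.v_sub_le (by simp) (p.v_pow_le hv.le j)),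
    Finset.prod_eq_zero (i := l)] at h3
  · exact NeZero.ne _ h3
  · exact Finset.mem_erase.2 ⟨hl0.ne', Finset.mem_range.2 hl⟩
  · rw [p.r_sub (by simp) (p.v_pow_le hv.le _), hroots, hC, p.r_one, sub_self]

end Place

/-- `q` lies over `p` with ramification index `e`. -/
structure Over {K k L R : Type} [Field K] [Field k] [Field L] [Field R] [Algebra K L]
    [Algebra k R] (p : Place K k) (q : Place L R) (e : ℕ) : Prop where
  epos : 0 < e
  v : ∀ x, q.v (algebraMap K L x) = p.v x ^ e
  r : ∀ x, p.v x ≤ 1 → q.r (algebraMap K L x) = algebraMap k R (p.r x)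

theorem Over.v_le {K k L R : Type} [Field K] [Field k] [Field L] [Field R] [Algebra K L]
    [Algebra k R] {p : Place K k} {q : Place L R} {e : ℕ} (h : Over p q e) {x : K}:
    q.v (algebraMap K L x) ≤ 1 ↔ p.v x ≤ 1 := by
  rw [h.v]; exact pow_le_one_iff h.epos.ne'

theorem Over.ord {K k L R : Type} [Field K] [Field k] [Field L] [Field R] [Algebra K L]
    [Algebra k R] {p : Place K k} {q : Place L R} {e : ℕ} (h : Over p q e) (x : K):
    q.ord (algebraMap K L x) = e * p.ord x := by
  rw [Place.ord, h.v, log_pow, Place.ord]; simp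

theorem Over.v_one {K k L R : Type} [Field K] [Field k] [Field L] [Field R] [Algebra K L]
    [Algebra k R] {p : Place K k} {q : Place L R} {e : ℕ} (h : Over p q e) {x : K}
    (hx : p.v x = 1) : q.v (algebraMap K L x) = 1 := by
  rw [h.v, hx, one_pow]

end PlB
end

section
set_option linter.unusedSectionVars false
set_option linter.style.haveILetI false
set_option linter.unusedSimpArgs false

open WithZero IsDedekindDomain

namespace PlB
section ded
variable {A K R : Type} [CommRing A] [IsDedekindDomain A] [Field K] [Algebra A K]
  [IsFractionRing A K] [Field R] (w : HeightOneSpectrum A) (ρ : A →+* R)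

open Classical in
noncomputable def dedR (x : K) : R :=
  if h : w.valuation K x ≤ 1 then
    ρ (w.exists_primeCompl_mul_eq_of_integer x h).choose /
      ρ (w.exists_primeCompl_mul_eq_of_integer x h).choose_spec.choose
  else 0

variable {w ρ}
theorem dedR_eq (hk : ∀ a, ρ a = 0 ↔ a ∈ w.asIdeal) {x : K} {a s : A} (hs : s ∉ w.asIdeal)
    (h : x * algebraMap A K s = algebraMap A K a) : dedR w ρ x = ρ a / ρ s := by
  have hvs : w.valuation K (algebraMap A K s) = 1 := w.valuation_eq_one_iff_notMem.2 hs
  have hx : w.valuation K x ≤ 1 := by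
    have := congrArg (w.valuation K) h
    rw [map_mul, hvs, mul_one] at this
    rw [this]; exact w.valuation_le_one a
  rw [dedR, dif_pos hx]
  have h2 := (w.exists_primeCompl_mul_eq_of_integer x hx).choose_spec.choose_spec
  set a' := (w.exists_primeCompl_mul_eq_of_integer x hx).choose
  set s' := (w.exists_primeCompl_mul_eq_of_integer x hx).choose_spec.choose
  have hs' : (s' : A) ∉ w.asIdeal := s'.2
  rw [div_eq_div_iff (by rwa [Ne, hk]) (by rwa [Ne, hk]), ← map_mul, ← map_mul]
  congr 1
  apply IsFractionRing.injective A K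
  rw [map_mul, map_mul, ← h2, ← h]; ring

theorem ded_frac {x : K} (hx : w.valuation K x ≤ 1) : ∃ a s : A, s ∉ w.asIdeal ∧
    x * algebraMap A K s = algebraMap A K a := by
  obtain ⟨a, s, h⟩ := w.exists_primeCompl_mul_eq_of_integer x hx
  exact ⟨a, s, s.2, h⟩

variable (w ρ) in
/-- The place attached to a maximal ideal of a Dedekind domain. -/
noncomputable def dedPlace (K : Type) [Field K] [Algebra A K]
    [IsFractionRing A K] (hk : ∀ a, ρ a = 0 ↔ a ∈ w.asIdeal) (hs : Function.Surjective ρ) :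
    Place K R where
  v := w.valuation K
  r := dedR w ρ
  r_one := by
    rw [dedR_eq hk (a := 1) (s := 1) (by rw [← hk]; simp) (by simp)]; simp
  r_add := by
    intro x y hx hy
    obtain ⟨a, s, hs, h⟩ := ded_frac hx
    obtain ⟨a', s', hs', h'⟩ := ded_frac hy
    have h1 := hs; have h2 := hs'
    rw [← hk] at h1 h2
    rw [dedR_eq hk hs h, dedR_eq hk hs' h', dedR_eq hk (a := a * s' + a' * s) (s := s * s')
      (w.isPrime.mul_notMem hs hs') (by simp only [map_mul, map_add, ← h, ← h']; ring),
      div_add_div _ _ h1 h2]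
    simp only [map_mul, map_add]; ring
  r_mul := by
    intro x y hx hy
    obtain ⟨a, s, hs, h⟩ := ded_frac hx
    obtain ⟨a', s', hs', h'⟩ := ded_frac hy
    have h1 := hs; have h2 := hs'
    rw [← hk] at h1 h2
    rw [dedR_eq hk hs h, dedR_eq hk hs' h', dedR_eq hk (a := a * a') (s := s * s')
      (w.isPrime.mul_notMem hs hs') (by simp only [map_mul, map_add, ← h, ← h']; ring),
      div_mul_div_comm]
    simp only [map_mul, map_add]
  r_eq_zero := by
    intro x hx
    obtain ⟨a, s, hs, h⟩ := ded_frac hx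
    have h1 := hs
    rw [← hk] at h1
    rw [dedR_eq hk hs h, div_eq_zero_iff, or_iff_left h1, hk]
    have hvs : w.valuation K (algebraMap A K s) = 1 := w.valuation_eq_one_iff_notMem.2 hs
    have := congrArg (w.valuation K) h
    rw [map_mul, hvs, mul_one] at this
    rw [this, w.valuation_lt_one_iff_mem]
  surj := by
    intro y
    obtain ⟨a, rfl⟩ := hs y
    refine ⟨algebraMap A K a, w.valuation_le_one a, ?_⟩
    rw [dedR_eq hk (a := a) (s := 1) (by rw [← hk]; simp) (by simp)]; simp
  unif := w.valuation_exists_uniformizer K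

theorem dedPlace_r (hk : ∀ a, ρ a = 0 ↔ a ∈ w.asIdeal) (hs : Function.Surjective ρ) (a : A) :
    (dedPlace w ρ K hk hs).r (algebraMap A K a) = ρ a := by
  show dedR w ρ _ = _
  rw [dedR_eq hk (a := a) (s := 1) (by rw [← hk]; simp) (by simp)]; simp

theorem dedPlace_v (hk : ∀ a, ρ a = 0 ↔ a ∈ w.asIdeal) (hs : Function.Surjective ρ) (x : K) :
    (dedPlace w ρ K hk hs).v x = w.valuation K x := rfl

end ded

namespace Place
variable {K k : Type} [Field K] [Field k] (p : Place K k)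

abbrev O : ValuationSubring K := p.v.valuationSubring

theorem mem_O {x : K} : x ∈ p.O ↔ p.v x ≤ 1 := Iff.rfl

def resHom : p.O →+* k where
  toFun x := p.r x
  map_one' := p.r_one
  map_zero' := p.r_zero
  map_add' x y := p.r_add x.2 y.2
  map_mul' x y := p.r_mul x.2 y.2

theorem resHom_surj : Function.Surjective p.resHom := fun y => by
  obtain ⟨x, hx, rfl⟩ := p.surj y
  exact ⟨⟨x, hx⟩, rfl⟩

theorem v_surj : Function.Surjective p.v := by
  intro z
  by_cases hz : z = 0
  · exact ⟨0, by simp [hz]⟩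
  · obtain ⟨x, hx, h⟩ := p.ord_surj (- log z)
    exact ⟨x, by rw [p.v_eq_exp hx, h, neg_neg, exp_log hz]⟩

theorem isDVR : IsDiscreteValuationRing p.O := by
  obtain ⟨x, hx⟩ := p.unif
  have hx1 : p.v x ≤ 1 := by rw [hx, ← exp_zero, exp_le_exp]; norm_num
  have hx0 : x ≠ 0 := by rintro rfl; rw [map_zero] at hx; exact exp_ne_zero hx.symm
  have hun : ∀ y : p.O, IsUnit y ↔ p.v y = 1 := fun y =>
    (Valuation.Integers.isUnit_iff_valuation_eq_one (Valuation.integer.integers p.v))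
  have key : ∀ (y : K), y ≠ 0 → p.v y ≤ 1 → ∃ n : ℕ, p.v y = p.v (x ^ n) := by
    intro y hy hy1
    have h1 := p.v_eq_exp hy
    have h2 : 0 ≤ p.ord y := by
      rw [h1, ← exp_zero, exp_le_exp] at hy1; omega
    refine ⟨(p.ord y).toNat, ?_⟩
    have h3 := p.v_eq_exp (pow_ne_zero (p.ord y).toNat hx0)
    rw [h1, h3, p.ord_pow, p.ord_of_v hx, mul_one, Int.toNat_of_nonneg h2]
  apply IsDiscreteValuationRing.ofHasUnitMulPowIrreducibleFactorization
  refine ⟨⟨x, hx1⟩, ?_, ?_⟩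
  · constructor
    · rw [hun]
      show p.v x ≠ 1
      rw [hx, ← exp_zero, Ne, exp_inj]; norm_num
    · rintro ⟨a, ha⟩ ⟨b, hb⟩ hab
      have hab' : x = a * b := congrArg Subtype.val hab
      have ha0 : a ≠ 0 := by rintro rfl; simp at hab'; exact hx0 hab'
      have hb0 : b ≠ 0 := by rintro rfl; simp at hab'; exact hx0 hab'
      rw [hun, hun]
      show p.v a = 1 ∨ p.v b = 1
      rw [← p.ord_eq_zero ha0, ← p.ord_eq_zero hb0]
      have h1 := p.ord_mul ha0 hb0
      rw [← hab', p.ord_of_v hx] at h1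
      have ha' : p.v a ≤ 1 := ha
      have hb' : p.v b ≤ 1 := hb
      rw [p.v_eq_exp ha0, ← exp_zero, exp_le_exp] at ha'
      rw [p.v_eq_exp hb0, ← exp_zero, exp_le_exp] at hb'
      omega
  · rintro ⟨y, hy⟩ hy0
    have hy0' : y ≠ 0 := fun h => hy0 (Subtype.ext h)
    obtain ⟨n, hn⟩ := key y hy0' hy
    refine ⟨n, ?_⟩
    have hxn : x ^ n ≠ 0 := pow_ne_zero n hx0
    have hu : p.v (y / x ^ n) = 1 := by
      rw [map_div₀, hn, div_self (p.v_ne hxn)]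
    have huu : IsUnit (⟨y / x ^ n, hu.le⟩ : p.O) := (hun _).2 hu
    refine ⟨huu.unit, Subtype.ext ?_⟩
    show x ^ n * (y / x ^ n) = y
    field_simp

end Place
end PlB
end

section
set_option linter.unusedSectionVars false
set_option linter.style.haveILetI false
set_option linter.unusedSimpArgs false

open WithZero IsDedekindDomain
open scoped Pointwise

namespace PlB

/-- decomposition data of a place in a finite Galois extension -/
structure Level {K k : Type} [Field K] [Field k] (p : Place K k) (L : Type) [Field L]
    [Algebra K L] where
  R : Type
  fR : Field R
  aR : Algebra k R
  fin : FiniteDimensional k R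
  normal : Normal k R
  q : Place L R
  e : ℕ
  ov : Over p q e
  Z : Subgroup (L ≃ₐ[K] L)
  π : Z →* (R ≃ₐ[k] R)
  πs : Function.Surjective π
  vZ : ∀ g : Z, ∀ x, q.v (g.1 x) = q.v x
  rZ : ∀ g : Z, ∀ x, q.v x ≤ 1 → q.r (g.1 x) = π g (q.r x)
  card : Nat.card Z = e * Module.finrank k R

section gen
variable {K k L A B R : Type} [Field K] [Field k] [Field L] [CommRing A] [CommRing B] [Field R]
  [IsDedekindDomain A] [IsDedekindDomain B] [Algebra A B] [Algebra K L] [Algebra A K]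
  [IsFractionRing A K] [Algebra A L] [IsScalarTower A K L] [Algebra B L] [IsFractionRing B L]
  [IsScalarTower A B L] [Module.Finite A B] [Module.IsTorsionFree A B]
  (m : HeightOneSpectrum A) (P : HeightOneSpectrum B) [P.asIdeal.LiesOver m.asIdeal]
  [Algebra A k] [Algebra B R] [Algebra k R] [Algebra A R] [IsScalarTower A k R]
  [IsScalarTower A B R]
  (hk : ∀ a, algebraMap A k a = 0 ↔ a ∈ m.asIdeal)
  (hks : Function.Surjective (algebraMap A k))
  (hR : ∀ a, algebraMap B R a = 0 ↔ a ∈ P.asIdeal)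
  (hRs : Function.Surjective (algebraMap B R))

theorem over_gen (K L : Type) [Field K] [Field L] [Algebra K L] [Algebra A K]
  [IsFractionRing A K] [Algebra A L] [IsScalarTower A K L] [Algebra B L] [IsFractionRing B L]
  [IsScalarTower A B L] : Over (dedPlace m (algebraMap A k) K hk hks)
    (dedPlace P (algebraMap B R) L hR hRs) (m.asIdeal.ramificationIdx' P.asIdeal) := by
  refine ⟨Nat.pos_of_ne_zero
    (Ideal.IsDedekindDomain.ramificationIdx'_ne_zero_of_liesOver P.asIdeal m.ne_bot), ?_, ?_⟩
  · intro x
    exact (HeightOneSpectrum.valuation_liesOver L m P x).symm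
  · intro x hx
    obtain ⟨a, s, hs, h⟩ := ded_frac (w := m) hx
    have hs' : algebraMap A B s ∉ P.asIdeal := by
      have h2 := Ideal.over_def P.asIdeal m.asIdeal
      intro h3
      apply hs
      rw [h2, Ideal.mem_comap]; exact h3
    show dedR P (algebraMap B R) (algebraMap K L x) = algebraMap k R (dedR m (algebraMap A k) x)
    rw [dedR_eq hk hs h, dedR_eq hR (a := algebraMap A B a) (s := algebraMap A B s) hs', map_div₀]
    · simp only [← IsScalarTower.algebraMap_apply]
    · rw [← IsScalarTower.algebraMap_apply A B L, ← IsScalarTower.algebraMap_apply A B L,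
        IsScalarTower.algebraMap_apply A K L, IsScalarTower.algebraMap_apply A K L, ← h, map_mul]

theorem fin_gen (A : Type) [CommRing A] [Algebra A B] [Module.Finite A B] [Algebra A k] [Algebra A R]
    [IsScalarTower A k R] [IsScalarTower A B R]
    (hRs : Function.Surjective (algebraMap B R)) : FiniteDimensional k R := by
  have : Module.Finite A R := by
    refine Module.Finite.of_surjective (IsScalarTower.toAlgHom A B R).toLinearMap hRs
  exact Module.Finite.of_restrictScalars_finite A k R

theorem level_gen [FiniteDimensional K L] [IsGalois K L]
    (hR : ∀ a, algebraMap B R a = 0 ↔ a ∈ P.asIdeal)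
    (hRs : Function.Surjective (algebraMap B R)) :
    Nonempty (Level (dedPlace m (algebraMap A k) K hk hks) L) := by
  classical
  have hfin : FiniteDimensional k R := fin_gen (B := B) A hRs
  have : Algebra.IsIntegral A B := inferInstance
  have : IsIntegralClosure B A L := IsIntegralClosure.of_isIntegrallyClosed B A L
  let G := Gal(L/K)
  let act : MulSemiringAction G B := IsIntegralClosure.MulSemiringAction A K L B
  have hact : ∀ (g : G) (b : B), algebraMap B L (g • b) = g (algebraMap B L b) := by
    intro g b
    exact algebraMap_galRestrict_apply A g b
  have : SMulDistribClass G B L := ⟨fun g b l => by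
    rw [Algebra.smul_def, Algebra.smul_def, hact]
    exact map_mul g _ _⟩
  have hGG : IsGaloisGroup G A B := IsGaloisGroup.of_isFractionRing _ _ _ K L
  have := hGG.isInvariant
  have := hGG.commutes
  have hmm : m.asIdeal.IsMaximal := m.isPrime.isMaximal m.ne_bot
  have hPm : P.asIdeal.IsMaximal := P.isPrime.isMaximal P.ne_bot
  have : P.asIdeal.IsPrime := P.isPrime
  have : m.asIdeal.IsPrime := m.isPrime
  letI a1 : Algebra (A ⧸ m.asIdeal) k := (Ideal.Quotient.lift m.asIdeal (algebraMap A k)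
    (fun a ha => (hk a).2 ha)).toAlgebra
  letI a2 : Algebra (B ⧸ P.asIdeal) R := (Ideal.Quotient.lift P.asIdeal (algebraMap B R)
    (fun a ha => (hR a).2 ha)).toAlgebra
  letI f1 : Field (A ⧸ m.asIdeal) := Ideal.Quotient.field _
  letI f2 : Field (B ⧸ P.asIdeal) := Ideal.Quotient.field _
  have b1 : Function.Bijective (algebraMap (A ⧸ m.asIdeal) k) :=
    ⟨RingHom.injective _, fun x => by obtain ⟨a, rfl⟩ := hks x; exact ⟨Ideal.Quotient.mk _ a, rfl⟩⟩
  have b2 : Function.Bijective (algebraMap (B ⧸ P.asIdeal) R) :=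
    ⟨RingHom.injective _, fun x => by obtain ⟨a, rfl⟩ := hRs x; exact ⟨Ideal.Quotient.mk _ a, rfl⟩⟩
  have fr1 : IsFractionRing (A ⧸ m.asIdeal) k := 
    IsLocalization.isLocalization_of_algEquiv (nonZeroDivisors (A ⧸ m.asIdeal))
     (AlgEquiv.ofBijective (Algebra.ofId (A ⧸ m.asIdeal) k) b1)
  have fr2 : IsFractionRing (B ⧸ P.asIdeal) R := 
    IsLocalization.isLocalization_of_algEquiv (nonZeroDivisors (B ⧸ P.asIdeal))
     (AlgEquiv.ofBijective (Algebra.ofId (B ⧸ P.asIdeal) R) b2)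
  have t1 : IsScalarTower A (A ⧸ m.asIdeal) k := IsScalarTower.of_algebraMap_eq fun x => rfl
  have t2 : IsScalarTower B (B ⧸ P.asIdeal) R := IsScalarTower.of_algebraMap_eq fun x => rfl
  letI a3 : Algebra (A ⧸ m.asIdeal) R := ((algebraMap k R).comp (algebraMap (A ⧸ m.asIdeal) k)).toAlgebra
  have t3 : IsScalarTower (A ⧸ m.asIdeal) k R := IsScalarTower.of_algebraMap_eq fun x => rfl
  have t4 : IsScalarTower (A ⧸ m.asIdeal) (B ⧸ P.asIdeal) R := IsScalarTower.of_algebraMap_eq fun x => by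
    obtain ⟨x, rfl⟩ := Ideal.Quotient.mk_surjective x
    show algebraMap k R (algebraMap A k x) = algebraMap B R (algebraMap A B x)
    simp only [← IsScalarTower.algebraMap_apply]
  have hmem : ∀ g ∈ MulAction.stabilizer G P.asIdeal, ∀ (n : ℕ) (b : B), b ∈ P.asIdeal ^ n →
      g • b ∈ P.asIdeal ^ n := by
    intro g hg n b hb
    have h1 : g • (P.asIdeal ^ n) = P.asIdeal ^ n := by
      rw [smul_pow', MulAction.mem_stabilizer_iff.1 hg]
    have h2 := Ideal.smul_mem_pointwise_smul g b _ hb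
    rwa [h1] at h2
  have hle : ∀ g ∈ MulAction.stabilizer G P.asIdeal, ∀ (b : B), 
      P.intValuation (g • b) ≤ P.intValuation b := by
    intro g hg b
    by_cases hb : b = 0
    · simp [hb]
    · rw [P.intValuation_eq_exp_neg_multiplicity hb, P.intValuation_le_pow_iff_mem]
      apply hmem g hg
      rw [← P.intValuation_le_pow_iff_mem, ← P.intValuation_eq_exp_neg_multiplicity hb]
  have heq : ∀ g ∈ MulAction.stabilizer G P.asIdeal, ∀ (b : B), 
      P.intValuation (g • b) = P.intValuation b := by
    intro g hg b
    refine le_antisymm (hle g hg b) ?_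
    have := hle g⁻¹ (inv_mem hg) (g • b)
    rwa [inv_smul_smul] at this
  have hvg : ∀ g ∈ MulAction.stabilizer G P.asIdeal, ∀ x : L, P.valuation L (g x) = P.valuation L x := by
    intro g hg x
    obtain ⟨a, b, hb, rfl⟩ := IsFractionRing.div_surjective (A := B) x
    rw [map_div₀, map_div₀, map_div₀, ← hact, ← hact]
    simp only [HeightOneSpectrum.valuation_of_algebraMap, heq g hg]
  refine ⟨⟨R, inferInstance, inferInstance, hfin,
    Ideal.IsFractionRing.normal G m.asIdeal P.asIdeal k R, dedPlace P (algebraMap B R) L hR hRs,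
    _, over_gen m P hk hks hR hRs K L, MulAction.stabilizer G P.asIdeal,
    IsFractionRing.stabilizerHom G m.asIdeal P.asIdeal k R,
    IsFractionRing.stabilizerHom_surjective G m.asIdeal P.asIdeal k R, ?_, ?_, ?_⟩⟩
  · exact fun g x => hvg g.1 g.2 x
  · intro g x hx
    obtain ⟨a, s, hs, h⟩ := ded_frac (w := P) hx
    have hs' : g.1 • s ∉ P.asIdeal := by
      intro h
      apply hs
      have := hmem g.1⁻¹ (inv_mem g.2) 1 (g.1 • s) (by simpa using h)
      simpa using this
    show dedR P (algebraMap B R) (g.1 x) =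
      IsFractionRing.stabilizerHom G m.asIdeal P.asIdeal k R g (dedR P (algebraMap B R) x)
    rw [dedR_eq hR hs h, dedR_eq hR (a := g.1 • a) (s := g.1 • s) hs', map_div₀]
    · congr 1
      · exact (IsFractionRing.stabilizerHom_apply_apply_mk G m.asIdeal P.asIdeal k R g a).symm
      · exact (IsFractionRing.stabilizerHom_apply_apply_mk G m.asIdeal P.asIdeal k R g s).symm
    · rw [hact, hact, ← h, map_mul]
  · have c1 := Ideal.ncard_primesOver_mul_ramificationIdxIn_mul_inertiaDegIn m.asIdeal B G
    rw [Ideal.ramificationIdxIn_eq_ramificationIdx m.asIdeal P.asIdeal G,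
      Ideal.inertiaDegIn_eq_inertiaDeg m.asIdeal P.asIdeal G,
      Ideal.inertiaDeg_eq_of_isFractionRing m.asIdeal P.asIdeal k R,
      ← Algebra.IsInvariant.orbit_eq_primesOver A B G m.asIdeal P.asIdeal,
      ← MulAction.index_stabilizer, ← Ideal.ramificationIdx'_eq_ramificationIdx m.asIdeal P.asIdeal m.ne_bot,
      ← Subgroup.index_mul_card (MulAction.stabilizer G P.asIdeal)] at c1
    exact (Nat.eq_of_mul_eq_mul_left (Nat.pos_of_ne_zero Subgroup.index_ne_zero_of_finite) c1).symm
end gen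
end PlB
end

section
set_option linter.unusedSectionVars false
set_option linter.style.haveILetI false
set_option linter.unusedSimpArgs false

open WithZero IsDedekindDomain
open scoped Pointwise

namespace PlB
namespace Place
variable {K k : Type} [Field K] [Field k] (p : Place K k)

theorem O_unit (y : p.O) : IsUnit y ↔ p.v y = 1 :=
  (Valuation.Integers.isUnit_iff_valuation_eq_one (Valuation.integer.integers p.v))

noncomputable def mO : @HeightOneSpectrum p.O _ :=
  haveI := p.isDVR
  { asIdeal := IsLocalRing.maximalIdeal p.O
    isPrime := inferInstance
    ne_bot := IsDiscreteValuationRing.not_a_field _ }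

theorem mem_mO (y : p.O) : y ∈ p.mO.asIdeal ↔ p.v y < 1 := by
  show y ∈ IsLocalRing.maximalIdeal p.O ↔ _
  rw [IsLocalRing.mem_maximalIdeal, mem_nonunits_iff, p.O_unit]
  exact ⟨fun h => lt_of_le_of_ne y.2 h, fun h => h.ne⟩

theorem mO_valuation (x : K) : haveI := p.isDVR; p.mO.valuation K x = p.v x := by
  haveI := p.isDVR
  obtain ⟨u, hu⟩ := p.unif
  have hu1 : p.v u < 1 := by rw [hu, ← exp_zero, exp_lt_exp]; norm_num
  have hu0 : u ≠ 0 := by rintro rfl; rw [map_zero] at hu; exact exp_ne_zero hu.symm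
  have h1 : p.mO.valuation K u = exp (-1 : ℤ) := by
    have : u = algebraMap p.O K ⟨u, hu1.le⟩ := rfl
    rw [this, HeightOneSpectrum.valuation_of_algebraMap]
    apply HeightOneSpectrum.intValuation_singleton
    · intro h; exact hu0 (congrArg Subtype.val h)
    · ext y
      rw [p.mem_mO, Ideal.mem_span_singleton]
      constructor
      · intro hy
        have : p.v (y.1 / u) ≤ 1 := by
          by_cases hy0 : y.1 = 0
          · simp [hy0]
          · rw [map_div₀, hu]
            rw [p.v_eq_exp hy0] at hy ⊢
            rw [← exp_zero, exp_lt_exp] at hy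
            rw [← exp_sub, ← exp_zero, exp_le_exp]; omega
        refine ⟨⟨y.1 / u, this⟩, Subtype.ext ?_⟩
        show y.1 = u * (y.1 / u)
        field_simp
      · rintro ⟨z, rfl⟩
        show p.v (u * z.1) < 1
        rw [map_mul]
        exact mul_lt_one_of_lt_of_le hu1 z.2
  by_cases hx : x = 0
  · simp [hx]
  have h2 : p.v (x / u ^ (p.ord x)) = 1 := by
    rw [map_div₀, map_zpow₀, hu, p.v_eq_exp hx, ← exp_zsmul, ← exp_sub, ← exp_zero, exp_inj]
    simp
  have h3 : p.mO.valuation K (x / u ^ (p.ord x)) = 1 := by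
    have : x / u ^ (p.ord x) = algebraMap p.O K ⟨_, h2.le⟩ := rfl
    rw [this, HeightOneSpectrum.valuation_eq_one_iff_notMem, p.mem_mO]
    show ¬ (p.v (x / u ^ (p.ord x)) < 1)
    rw [h2]; exact lt_irrefl _
  rw [map_div₀, map_zpow₀, div_eq_one_iff_eq (zpow_ne_zero _ (by rw [hu]; exact exp_ne_zero))] at h2
  rw [map_div₀, map_zpow₀, div_eq_one_iff_eq (zpow_ne_zero _ (by rw [h1]; exact exp_ne_zero))] at h3
  rw [h2, h3, h1, hu]

theorem Over_congr {L R : Type} [Field L] [Field R] [Algebra K L] [Algebra k R] {p p' : Place K k}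
    (h : ∀ x, p'.v x = p.v x) (h2 : ∀ x, p.v x ≤ 1 → p'.r x = p.r x) {q : Place L R} {e : ℕ}
    (ho : Over p' q e) : Over p q e := 
  ⟨ho.epos, fun x => by rw [ho.v, h], fun x hx => by rw [ho.r x (by rw [h]; exact hx), h2 x hx]⟩

theorem exists_level0 (L : Type) [Field L] [Algebra K L] [FiniteDimensional K L]
    [Algebra.IsSeparable K L] :
    (∃ (R : Type) (_ : Field R) (_ : Algebra k R) (_ : FiniteDimensional k R) (q : Place L R) (e : ℕ),
      Over p q e) ∧ (IsGalois K L → Nonempty (Level p L)) := by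
  haveI := p.isDVR
  letI aL : Algebra p.O L := ((algebraMap K L).comp (algebraMap p.O K)).toAlgebra
  haveI : IsScalarTower p.O K L := IsScalarTower.of_algebraMap_eq fun x => rfl
  let B := integralClosure p.O L
  haveI : IsDedekindDomain B := integralClosure.isDedekindDomain p.O K L
  haveI : IsFractionRing B L := integralClosure.isFractionRing_of_finite_extension K L
  haveI : Module.Finite p.O B := IsIntegralClosure.finite p.O K L B
  haveI : FaithfulSMul p.O L := (faithfulSMul_iff_algebraMap_injective _ _).2
    ((algebraMap K L).injective.comp (Subtype.val_injective))
  haveI : Module.IsTorsionFree p.O B := inferInstance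
  haveI := p.mO.isPrime
  haveI hmm : p.mO.asIdeal.IsMaximal := p.mO.isPrime.isMaximal p.mO.ne_bot
  obtain ⟨P, hP, hPo⟩ := Ideal.exists_maximal_ideal_liesOver_of_isIntegral (S := B) p.mO.asIdeal
  let PP : HeightOneSpectrum B := ⟨P, hP.isPrime, Ideal.ne_bot_of_liesOver_of_ne_bot p.mO.ne_bot P⟩
  haveI : PP.asIdeal.LiesOver p.mO.asIdeal := hPo
  letI ak : Algebra p.O k := p.resHom.toAlgebra
  let R := B ⧸ P
  letI fR : Field R := Ideal.Quotient.field P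
  have hk : ∀ a, algebraMap p.O k a = 0 ↔ a ∈ p.mO.asIdeal := by
    intro a
    rw [p.mem_mO]
    exact p.r_eq_zero a.2
  have hks : Function.Surjective (algebraMap p.O k) := p.resHom_surj
  have hker : RingHom.ker p.resHom ≤ RingHom.ker ((Ideal.Quotient.mk P).comp (algebraMap p.O B)) := by
    intro a ha
    have h1 := (hk a).1 ha
    rw [hPo.over] at h1
    rw [RingHom.mem_ker]
    exact Ideal.Quotient.eq_zero_iff_mem.2 h1
  let φ : k →+* R := RingHom.liftOfSurjective p.resHom p.resHom_surj ⟨_, hker⟩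
  letI akR : Algebra k R := φ.toAlgebra
  haveI : IsScalarTower p.O k R := IsScalarTower.of_algebraMap_eq fun x =>
    (RingHom.liftOfRightInverse_comp_apply p.resHom _ (Function.rightInverse_surjInv p.resHom_surj) ⟨_, hker⟩ x).symm
  have hR : ∀ a, algebraMap B R a = 0 ↔ a ∈ PP.asIdeal := fun a => Ideal.Quotient.eq_zero_iff_mem
  have hRs : Function.Surjective (algebraMap B R) := Ideal.Quotient.mk_surjective
  have hv : ∀ x, (dedPlace p.mO (algebraMap p.O k) K hk hks).v x = p.v x := fun x => p.mO_valuation x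
  have hr : ∀ x, p.v x ≤ 1 → (dedPlace p.mO (algebraMap p.O k) K hk hks).r x = p.r x := by
    intro x hx
    exact dedPlace_r hk hks (⟨x, hx⟩ : p.O)
  refine ⟨⟨R, fR, akR, fin_gen (B := B) p.O hRs, _, _, Over_congr hv hr (over_gen p.mO PP hk hks hR hRs K L)⟩, ?_⟩
  intro hG
  obtain ⟨Λ⟩ := level_gen (K := K) (L := L) p.mO PP hk hks hR hRs
  letI := Λ.fR
  letI := Λ.aR
  exact ⟨⟨Λ.R, Λ.fR, Λ.aR, Λ.fin, Λ.normal, Λ.q, Λ.e, Over_congr hv hr Λ.ov, Λ.Z, Λ.π, Λ.πs, Λ.vZ, Λ.rZ, Λ.card⟩⟩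

end Place
end PlB
end

section
set_option linter.unusedSectionVars false
set_option linter.style.haveILetI false
set_option linter.unusedSimpArgs false

open WithZero

namespace PlB
namespace Level
variable {K k L : Type} [Field K] [Field k] [Field L] [Algebra K L] {p : Place K k} (Λ : Level p L)

instance : Field Λ.R := Λ.fR
instance : Algebra k Λ.R := Λ.aR
instance : FiniteDimensional k Λ.R := Λ.fin
instance : Normal k Λ.R := Λ.normal

/-- inertia subgroup -/
abbrev J : Subgroup Λ.Z := Λ.π.ker

theorem card_J_mul [FiniteDimensional K L] : Nat.card Λ.J * Nat.card (Λ.R ≃ₐ[k] Λ.R) = Nat.card Λ.Z := by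
  have h1 := Subgroup.card_mul_index Λ.J
  rw [Subgroup.index_ker, MonoidHom.range_eq_top.2 Λ.πs, Subgroup.card_top] at h1
  exact h1

theorem card_J [FiniteDimensional K L] : Nat.card Λ.J = Λ.e * Field.finInsepDegree k Λ.R := by
  have h1 := Λ.card_J_mul
  have h2 : Nat.card (Λ.R ≃ₐ[k] Λ.R) = Field.finSepDegree k Λ.R :=
    (Nat.card_congr (Normal.algHomEquivAut k (AlgebraicClosure Λ.R) Λ.R)).symm
  have h3 := Field.finSepDegree_mul_finInsepDegree k Λ.R
  rw [Λ.card, ← h3, h2] at h1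
  have h4 : 0 < Field.finSepDegree k Λ.R := by rw [← h2]; exact Nat.card_pos
  apply Nat.eq_of_mul_eq_mul_right h4
  rw [h1]; ring

theorem galois_of_card [FiniteDimensional K L] (h : (Nat.card Λ.J : k) ≠ 0) :
    IsGalois k Λ.R ∧ Nat.card Λ.J = Λ.e := by
  obtain ⟨q, hq⟩ := ExpChar.exists k
  obtain ⟨n, hn⟩ := finInsepDegree_eq_pow k Λ.R q
  have h1 : Field.finInsepDegree k Λ.R = 1 := by
    rw [hn]
    by_contra hne
    have hn0 : n ≠ 0 := by rintro rfl; simp at hne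
    have hq1 : q ≠ 1 := by rintro rfl; simp at hne
    apply h
    rw [Λ.card_J, hn]
    have : (q : k) = 0 := by
      cases hq with
      | zero => exact absurd rfl hq1
      | prime hp => exact CharP.cast_eq_zero k q
    push_cast
    rw [this, zero_pow hn0, mul_zero]
  refine ⟨?_, by rw [Λ.card_J, h1, mul_one]⟩
  haveI : Algebra.IsSeparable k Λ.R := (isSeparable_iff_finInsepDegree_eq_one k Λ.R).2 h1
  exact {}

theorem galois_of_bot [FiniteDimensional K L] (h : Λ.J = ⊥) : IsGalois k Λ.R ∧ Λ.e = 1 := by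
  have h1 : Nat.card Λ.J = 1 := by rw [h]; simp
  have := Λ.galois_of_card (by rw [h1]; simp)
  exact ⟨this.1, by rw [← this.2, h1]⟩

theorem rJ (g : Λ.J) {x : L} (hx : Λ.q.v x ≤ 1) : Λ.q.r (g.1.1 x) = Λ.q.r x := by
  rw [Λ.rZ g.1 x hx, (MonoidHom.mem_ker).1 g.2]; rfl

theorem ordZ (g : Λ.Z) (x : L) : Λ.q.ord (g.1 x) = Λ.q.ord x := by
  unfold Place.ord; rw [Λ.vZ]

theorem exists_theta [FiniteDimensional K L] (h : (Nat.card Λ.J : k) ≠ 0) :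
    ∃ θ : Λ.J →* Λ.R, Function.Injective θ ∧
      ∀ (g : Λ.J) (x : L), x ≠ 0 → Λ.q.r (g.1.1 x / x) = θ g ^ Λ.q.ord x := by
  obtain ⟨u, hu⟩ := Λ.q.unif
  have hu0 : u ≠ 0 := by rintro rfl; rw [map_zero] at hu; exact exp_ne_zero hu.symm
  have hv1 : ∀ (g : Λ.Z) (x : L), x ≠ 0 → Λ.q.v (g.1 x / x) = 1 := by
    intro g x hx
    rw [map_div₀, Λ.vZ, div_self (Λ.q.v_ne hx)]
  let θ : Λ.J →* Λ.R :=
    { toFun := fun g => Λ.q.r (g.1.1 u / u)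
      map_one' := by
        show Λ.q.r (u / u) = 1
        rw [div_self hu0, Λ.q.r_one]
      map_mul' := by
        intro g g2
        show Λ.q.r (g.1.1 (g2.1.1 u) / u) = Λ.q.r (g.1.1 u / u) * Λ.q.r (g2.1.1 u / u)
        rw [← Λ.rJ g (hv1 g2.1 u hu0).le, ← Λ.q.r_mul (hv1 g.1 u hu0).le
          (by rw [Λ.vZ g.1]; exact (hv1 g2.1 u hu0).le)]
        congr 1
        rw [map_div₀]
        have : g.1.1 u ≠ 0 := by simpa using hu0
        field_simp }
  have hθ : ∀ (g : Λ.J) (x : L), x ≠ 0 → Λ.q.r (g.1.1 x / x) = θ g ^ Λ.q.ord x := by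
    intro g x hx
    set n := Λ.q.ord x
    have hgu : g.1.1 u ≠ 0 := by simpa using hu0
    have hun : u ^ n ≠ 0 := zpow_ne_zero _ hu0
    have hw : Λ.q.v (x / u ^ n) = 1 := by
      rw [map_div₀, map_zpow₀, hu, Λ.q.v_eq_exp hx, ← exp_zsmul, ← exp_sub, ← exp_zero, exp_inj]
      simp [n]
    have hx2 : g.1.1 x / x = (g.1.1 (x / u ^ n) / (x / u ^ n)) * (g.1.1 u / u) ^ n := by
      rw [map_div₀, map_zpow₀, div_zpow]
      have := zpow_ne_zero n hgu
      field_simp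
    have hgw : Λ.q.v (g.1.1 (x / u ^ n)) = 1 := by rw [Λ.vZ g.1, hw]
    have hth : ∀ m : ℤ, Λ.q.r ((g.1.1 u / u) ^ m) = θ g ^ m := by
      intro m
      cases m with
      | ofNat m => 
        rw [Int.ofNat_eq_natCast, zpow_natCast, zpow_natCast, Λ.q.r_pow (hv1 g.1 u hu0).le]; rfl
      | negSucc m =>
        rw [zpow_negSucc, zpow_negSucc, Λ.q.r_inv, Λ.q.r_pow (hv1 g.1 u hu0).le]; · rfl
        rw [map_pow, hv1 g.1 u hu0, one_pow]
    rw [hx2, Λ.q.r_mul, hth, Λ.q.r_div hgw.le hw, Λ.rJ g hw.le, div_self (Λ.q.r_ne_zero hw), one_mul]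
    · rw [map_div₀, hgw, hw, div_one]
    · rw [map_zpow₀, hv1 g.1 u hu0, one_zpow]
  refine ⟨θ, ?_, hθ⟩
  rw [injective_iff_map_eq_one]
  intro g hg
  by_contra hne
  have hne' : ∃ x, g.1.1 x ≠ x := by
    by_contra hcon
    push Not at hcon
    apply hne
    apply Subtype.ext; apply Subtype.ext
    ext x; exact hcon x
  obtain ⟨x, hx⟩ := hne'
  set y := g.1.1 x - x
  have hy : y ≠ 0 := sub_ne_zero.2 hx
  set N := Nat.card Λ.J
  have hgN : g ^ N = 1 := pow_card_eq_one'
  have hco : ∀ i : ℕ, (g ^ i).1.1 = g.1.1 ^ i := fun i => by simp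
  have hs : ∑ i ∈ Finset.range N, (g ^ i).1.1 y = 0 := by
    have : ∀ i, (g ^ i).1.1 y = (g ^ (i + 1)).1.1 x - (g ^ i).1.1 x := by
      intro i
      rw [map_sub, pow_succ]; rfl
    simp_rw [this]
    rw [Finset.sum_range_sub (fun i => (g ^ i).1.1 x), hgN]
    simp
  have hs2 : ∑ i ∈ Finset.range N, ((g ^ i).1.1 y / y) = 0 := by
    rw [← Finset.sum_div, hs, zero_div]
  have hr : ∀ s : Finset ℕ, Λ.q.v (∑ i ∈ s, ((g ^ i).1.1 y / y)) ≤ 1 ∧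
      Λ.q.r (∑ i ∈ s, ((g ^ i).1.1 y / y)) = s.card := by
    intro s
    induction s using Finset.induction_on with
    | empty => simp [Λ.q.r_zero]
    | insert a s ha ih =>
      have h1 := (hv1 (g ^ a).1 y hy).le
      rw [Finset.sum_insert ha, Finset.card_insert_of_notMem ha]
      refine ⟨Λ.q.v_add_le h1 ih.1, ?_⟩
      rw [Λ.q.r_add h1 ih.1, ih.2, hθ (g ^ a) y hy, map_pow, hg, one_pow, one_zpow]
      push_cast; ring
  have h5 := (hr (Finset.range N)).2
  rw [hs2, Λ.q.r_zero, Finset.card_range] at h5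
  apply h
  have h6 : algebraMap k Λ.R (N : k) = 0 := by rw [map_natCast]; exact h5.symm
  exact (map_eq_zero _).1 h6

theorem J_cyclic [FiniteDimensional K L] (h : (Nat.card Λ.J : k) ≠ 0) : IsCyclic Λ.J := by
  obtain ⟨θ, hθ, -⟩ := Λ.exists_theta h
  exact isCyclic_of_injective_ringHom θ hθ

/-- tame relation -/
theorem J_conj [FiniteDimensional K L] (h : (Nat.card Λ.J : k) ≠ 0) (z : Λ.Z) (Q : ℕ)
    (hz : ∀ x, Λ.π z x = x ^ Q) (g : Λ.J) : z * g.1 * z⁻¹ = g.1 ^ Q := by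
  obtain ⟨θ, hθ, hx⟩ := Λ.exists_theta h
  have hm : z * g.1 * z⁻¹ ∈ Λ.J := (inferInstance : Λ.J.Normal).conj_mem _ g.2 z
  have key : (⟨z * g.1 * z⁻¹, hm⟩ : Λ.J) = g ^ Q := by
    apply hθ
    obtain ⟨u, hu0, hu⟩ := Λ.q.ord_surj 1
    have h1 := hx ⟨z * g.1 * z⁻¹, hm⟩ u hu0
    rw [hu, zpow_one] at h1
    rw [← h1, map_pow]
    have hu' : (z⁻¹).1 u ≠ 0 := by simpa using hu0
    have h2 := hx g ((z⁻¹).1 u) hu'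
    rw [Λ.ordZ z⁻¹, hu, zpow_one] at h2
    rw [← h2, ← hz, ← Λ.rZ]
    · congr 1
      rw [map_div₀]
      congr 1
      show u = (z * z⁻¹).1 u
      simp
    · rw [map_div₀, Λ.vZ g.1, div_self (Λ.q.v_ne hu')]
  have := congrArg Subtype.val key
  simpa using this

end Level
end PlB
end

section
set_option linter.unusedSectionVars false
set_option linter.style.haveILetI false
set_option linter.unusedSimpArgs false

namespace PlB

theorem group_bound {Q A : Type*} [Group Q] [Finite Q] [CommGroup A] (χ : Q →* A) (l d : ℕ)
    (hl : l.Prime) (hA : ∀ a : A, a ^ l = 1) (hQ : Nat.card Q = l ^ d) (s t z τ : Q) (q1 q2 : ℕ)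
    (hq1 : 1 < q1) (hq2 : 1 < q2) (hgen : ∀ x : Q, ∃ u w : ℕ, x = s ^ u * t ^ w)
    (hst : s * t * s⁻¹ = t ^ q2) (hz : z * τ * z⁻¹ = τ ^ q1) (ht : χ t = 1) (hτ : χ τ ≠ 1) :
    l ^ d ≤ (q1 - 1) * q2 ^ (q1 - 1) := by
  classical
  set m := q1 - 1 with hm
  set N := Subgroup.zpowers t with hN
  have htN : t ∈ N := Subgroup.mem_zpowers t
  -- conjugation by powers of s
  have hconj : ∀ u : ℕ, s ^ u * t * (s ^ u)⁻¹ = t ^ (q2 ^ u) := by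
    intro u
    induction u with
    | zero => simp
    | succ u ih =>
      have : s ^ (u + 1) * t * (s ^ (u + 1))⁻¹ = s * (s ^ u * t * (s ^ u)⁻¹) * s⁻¹ := by
        rw [pow_succ']; group
      rw [this, ih, ← conj_pow, hst, ← pow_mul, pow_succ']
  have hNn : N.Normal := by
    constructor
    intro n hn g
    obtain ⟨j, rfl⟩ := Subgroup.mem_zpowers_iff.1 hn
    obtain ⟨u, w, rfl⟩ := hgen g
    have : s ^ u * t ^ w * t ^ j * (s ^ u * t ^ w)⁻¹ = (s ^ u * t * (s ^ u)⁻¹) ^ j := by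
      rw [conj_zpow]; group
    rw [this, hconj]
    exact Subgroup.zpow_mem _ (Subgroup.pow_mem _ htN _) _
  let f := QuotientGroup.mk' N
  have hft : f t = 1 := (QuotientGroup.eq_one_iff t).2 htN
  have hfx : ∀ x : Q, ∃ u : ℕ, f x = f s ^ u := by
    intro x
    obtain ⟨u, w, rfl⟩ := hgen x
    exact ⟨u, by rw [map_mul, map_pow, map_pow, hft, one_pow, mul_one]⟩
  have hcomm : ∀ x y : Q, f x * f y = f y * f x := by
    intro x y
    obtain ⟨u, hu⟩ := hfx x
    obtain ⟨w, hw⟩ := hfx y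
    rw [hu, hw, ← pow_add, ← pow_add, add_comm]
  have h1 : f τ ^ m = 1 := by
    have h2 := congrArg f hz
    rw [map_mul, map_mul, hcomm, map_pow] at h2
    rw [mul_assoc, ← map_mul, mul_inv_cancel, map_one, mul_one] at h2
    have h3 : q1 = m + 1 := by omega
    rw [h3, pow_succ] at h2
    exact (mul_eq_right.1 h2.symm)
  obtain ⟨u, w, huw⟩ := hgen τ
  have hu : ¬ l ∣ u := by
    rintro ⟨c, rfl⟩
    apply hτ
    rw [huw, map_mul, map_pow, map_pow, ht, one_pow, mul_one, pow_mul, hA, one_pow]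
  have h4 : f s ^ (u * m) = 1 := by
    rw [huw, map_mul, map_pow, map_pow, hft, one_pow, mul_one, ← pow_mul] at h1
    exact h1
  have h5 : orderOf (f s) ∣ l ^ d := by
    rw [← hQ]
    exact (orderOf_map_dvd f s).trans (orderOf_dvd_natCard s)
  have h6 : orderOf (f s) ∣ m := by
    refine Nat.Coprime.dvd_of_dvd_mul_left ?_ (orderOf_dvd_of_pow_eq_one h4)
    exact Nat.Coprime.coprime_dvd_left h5 (Nat.Coprime.pow_left d ((Nat.Prime.coprime_iff_not_dvd hl).2 hu))
  have hm0 : 0 < m := by omega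
  have h7 : Nat.card (Q ⧸ N) ≤ m := by
    have : Nat.card (Q ⧸ N) = orderOf (f s) := by
      rw [orderOf_eq_card_of_forall_mem_zpowers]
      intro x
      obtain ⟨x, rfl⟩ := QuotientGroup.mk'_surjective N x
      obtain ⟨u, hu⟩ := hfx x
      exact Subgroup.mem_zpowers_iff.2 ⟨u, by rw [zpow_natCast]; exact hu.symm⟩
    rw [this]
    exact Nat.le_of_dvd hm0 h6
  have h8 : s ^ m ∈ N := by
    rw [← QuotientGroup.eq_one_iff]
    show f (s ^ m) = 1
    rw [map_pow]; exact orderOf_dvd_iff_pow_eq_one.1 h6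
  have h9 : t ^ (q2 ^ m) = t := by
    rw [← hconj m]
    obtain ⟨j, hj⟩ := Subgroup.mem_zpowers_iff.1 h8
    rw [← hj]; group
  have hq : 1 < q2 ^ m := Nat.one_lt_pow hm0.ne' hq2
  have h10 : orderOf t ≤ q2 ^ m - 1 := by
    apply Nat.le_of_dvd (by omega)
    apply orderOf_dvd_of_pow_eq_one
    have h3 : q2 ^ m = (q2 ^ m - 1) + 1 := by omega
    rw [h3, pow_succ] at h9
    exact mul_eq_right.1 h9
  have h11 : Nat.card N = orderOf t := Nat.card_zpowers t
  rw [← hQ, ← Subgroup.index_mul_card N, h11]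
  exact Nat.mul_le_mul h7 (h10.trans (Nat.sub_le _ _))

end PlB
end

section
set_option linter.unusedSectionVars false
set_option linter.style.haveILetI false
set_option linter.unusedSimpArgs false

open WithZero

namespace NCBi
variable {F T : Type} [Field F] [Field T] [Algebra F T] (S : NCBi F T)

theorem commS : Commute S.sg S.ta := S.comm

theorem exists_pow [FiniteDimensional F T] [IsGalois F T] (g : T ≃ₐ[F] T) :
    ∃ i j : ℕ, g = S.sg ^ i * S.ta ^ j := by
  let H : Subgroup (T ≃ₐ[F] T) :=
    { carrier := {g | ∃ i j : ℕ, g = S.sg ^ i * S.ta ^ j}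
      one_mem' := ⟨0, 0, by simp⟩
      mul_mem' := by
        rintro _ _ ⟨i, j, rfl⟩ ⟨i2, j2, rfl⟩
        refine ⟨i + i2, j + j2, ?_⟩
        rw [pow_add, pow_add, mul_assoc, mul_assoc, ← mul_assoc (S.ta ^ j),
          ((S.commS.pow_pow i2 j).eq).symm, mul_assoc]
      inv_mem' := by
        rintro _ ⟨i, j, rfl⟩
        refine ⟨(S.n - 1) * i, (S.l - 1) * j, ?_⟩
        rw [mul_inv_rev, ((S.commS.pow_pow _ _).eq)]
        have h1 : (S.sg ^ i)⁻¹ = S.sg ^ ((S.n - 1) * i) := by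
          rw [inv_eq_iff_mul_eq_one, ← pow_add]
          have : i + (S.n - 1) * i = S.n * i := by
            obtain ⟨m, hm⟩ : ∃ m, S.n = m + 1 := ⟨S.n - 1, by have := S.hn; omega⟩
            rw [hm]; simp; ring
          rw [this, pow_mul, S.sgn, one_pow]
        have h2 : (S.ta ^ j)⁻¹ = S.ta ^ ((S.l - 1) * j) := by
          rw [inv_eq_iff_mul_eq_one, ← pow_add]
          have : j + (S.l - 1) * j = S.l * j := by
            obtain ⟨m, hm⟩ : ∃ m, S.l = m + 1 := ⟨S.l - 1, by have := S.hl; omega⟩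
            rw [hm]; simp; ring
          rw [this, pow_mul, S.tal, one_pow]
        rw [h1, h2] }
  have hH : IntermediateField.fixedField H = ⊥ := by
    rw [eq_bot_iff]
    intro x hx
    rw [IntermediateField.mem_bot]
    exact S.fix x (hx ⟨S.sg, 1, 0, by simp⟩) (hx ⟨S.ta, 0, 1, by simp⟩)
  have hT : H = ⊤ := by
    rw [← IntermediateField.fixingSubgroup_fixedField H, hH, IntermediateField.fixingSubgroup_bot]
  have : g ∈ H := by rw [hT]; trivial
  exact this

theorem mod_eq {i j i2 j2 : ℕ} (h : S.sg ^ i * S.ta ^ j = S.sg ^ i2 * S.ta ^ j2) :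
    j % S.l = j2 % S.l := by
  have e1 : ∀ i, S.sg ^ i = S.sg ^ (i % S.n) := fun i => by
    conv_lhs => rw [← Nat.div_add_mod i S.n, pow_add, pow_mul, S.sgn, one_pow, one_mul]
  have e2 : ∀ i, S.ta ^ i = S.ta ^ (i % S.l) := fun i => by
    conv_lhs => rw [← Nat.div_add_mod i S.l, pow_add, pow_mul, S.tal, one_pow, one_mul]
  rw [e1 i, e1 i2, e2 j, e2 j2] at h
  have := @S.inj (⟨i % S.n, Nat.mod_lt _ S.hn⟩, ⟨j % S.l, Nat.mod_lt _ S.hl⟩)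
    (⟨i2 % S.n, Nat.mod_lt _ S.hn⟩, ⟨j2 % S.l, Nat.mod_lt _ S.hl⟩) h
  simpa using congrArg (fun z => (z.2 : ℕ)) this

/-- the projection to the `ta`-exponent -/
theorem exists_chi0 [FiniteDimensional F T] [IsGalois F T] :
    ∃ χ : (T ≃ₐ[F] T) →* Multiplicative (ZMod S.l), ∀ i j : ℕ,
      χ (S.sg ^ i * S.ta ^ j) = Multiplicative.ofAdd (j : ZMod S.l) := by
  choose a b hab using S.exists_pow
  have key : ∀ i j : ℕ, ((b (S.sg ^ i * S.ta ^ j) : ℕ) : ZMod S.l) = j := by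
    intro i j
    have := S.mod_eq (hab (S.sg ^ i * S.ta ^ j))
    exact (ZMod.natCast_eq_natCast_iff' _ _ _).2 this.symm
  refine ⟨MonoidHom.mk' (fun g => Multiplicative.ofAdd (b g : ZMod S.l)) ?_, ?_⟩
  · intro g h
    rw [← ofAdd_add]
    congr 1
    have : g * h = S.sg ^ (a g + a h) * S.ta ^ (b g + b h) := by
      conv_lhs => rw [hab g, hab h]
      rw [pow_add, pow_add, mul_assoc, mul_assoc, ← mul_assoc (S.ta ^ _),
          ((S.commS.pow_pow _ _).eq).symm, mul_assoc]
    conv_lhs => rw [this, key]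
    push_cast; rfl
  · intro i j
    show Multiplicative.ofAdd _ = _
    rw [key]
end NCBi

namespace PlB

theorem Place.root_inj {K k : Type} [Field K] [Field k] (p : Place K k) {C : K} {N : ℕ}
    (hN : (N : k) ≠ 0) (h : IsPrimitiveRoot C N) {x y : K} (hx : x ^ N = 1) (hy : y ^ N = 1)
    (hr : p.r x = p.r y) : x = y := by
  haveI : NeZero (N : k) := ⟨hN⟩
  have hN0 : N ≠ 0 := by rintro rfl; simp at hN
  haveI : NeZero N := ⟨hN0⟩
  have hv := p.v_root hN0 h.pow_eq_one
  obtain ⟨i, hi, rfl⟩ := h.eq_pow_of_pow_eq_one hx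
  obtain ⟨j, hj, rfl⟩ := h.eq_pow_of_pow_eq_one hy
  rw [p.r_pow hv.le, p.r_pow hv.le] at hr
  rw [(p.prim_root h).pow_inj hi hj hr]

namespace Level
variable {K k L : Type} [Field K] [Field k] [Field L] [Algebra K L] {p : Place K k} (Λ : Level p L)

theorem primR {C : L} {N : ℕ} (hN : (N : k) ≠ 0) (h : IsPrimitiveRoot C N) :
    IsPrimitiveRoot (Λ.q.r C) N := by
  have : ((N : ℕ) : Λ.R) ≠ 0 := by
    rw [← map_natCast (algebraMap k Λ.R)]; exact (map_ne_zero _).2 hN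
  haveI : NeZero (N : Λ.R) := ⟨this⟩
  exact Λ.q.prim_root h

/-- action on roots of unity lifts -/
theorem lift_root {C : L} {N : ℕ} (hN : (N : k) ≠ 0) (h : IsPrimitiveRoot C N) (g : Λ.Z) (m : ℕ)
    (hg : Λ.π g (Λ.q.r C) = Λ.q.r C ^ m) : g.1 C = C ^ m := by
  have : ((N : ℕ) : Λ.R) ≠ 0 := by
    rw [← map_natCast (algebraMap k Λ.R)]; exact (map_ne_zero _).2 hN
  have hN0 : N ≠ 0 := by rintro rfl; simp at hN
  have hv := Λ.q.v_root hN0 h.pow_eq_one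
  refine Λ.q.root_inj this h ?_ ?_ ?_
  · rw [← map_pow, h.pow_eq_one, map_one]
  · rw [← pow_mul, mul_comm, pow_mul, h.pow_eq_one, one_pow]
  · rw [Λ.rZ g C hv.le, hg, Λ.q.r_pow hv.le]

theorem ord_prodZ (g : Λ.Z) {β : L} {c : K} {N : ℕ} (hc : c ≠ 0)
    (h : ∏ k ∈ Finset.range N, (g.1 ^ k) β = algebraMap K L c) :
    (N : ℤ) * Λ.q.ord β = Λ.e * p.ord c := by
  have hne : algebraMap K L c ≠ 0 := by simpa using hc
  have h1 : ∀ k ∈ Finset.range N, (g.1 ^ k) β ≠ 0 := by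
    rw [← h] at hne; exact Finset.prod_ne_zero_iff.1 hne
  have h2 := congrArg Λ.q.ord h
  rw [Λ.q.ord_prod _ _ h1, Λ.ov.ord] at h2
  rw [← h2]
  have : ∀ k, Λ.q.ord ((g.1 ^ k) β) = Λ.q.ord β := fun k => Λ.ordZ (g ^ k) β
  rw [Finset.sum_congr rfl fun k _ => this k]
  simp

theorem red_prod (g : Λ.Z) {β : L} {c : K} {N : ℕ} (hN : N ≠ 0) (hc : p.v c = 1)
    (h : ∏ k ∈ Finset.range N, (g.1 ^ k) β = algebraMap K L c) :
    ∏ k ∈ Finset.range N, (Λ.π g ^ k) (Λ.q.r β) = algebraMap k Λ.R (p.r c) := by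
  have hc0 : c ≠ 0 := by rintro rfl; simp at hc
  have h1 := Λ.ord_prodZ g hc0 h
  rw [p.ord_one_of hc, mul_zero, mul_eq_zero] at h1
  have h2 : Λ.q.ord β = 0 := h1.resolve_left (by exact_mod_cast hN)
  have hb0 : β ≠ 0 := by
    rintro rfl
    simp [Finset.prod_const, hN] at h
    exact hc0 ((map_eq_zero _).1 h.symm)
  have hv := (Λ.q.ord_eq_zero hb0).1 h2
  have hk : ∀ k, Λ.q.v ((g.1 ^ k) β) ≤ 1 := fun k => by
    rw [show (g.1 ^ k) β = (g ^ k).1 β from rfl, Λ.vZ, hv]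
  rw [← Λ.ov.r c hc.le, ← h, Λ.q.r_prod _ _ (fun k _ => hk k)]
  refine Finset.prod_congr rfl fun k _ => ?_
  rw [show (g.1 ^ k) β = (g ^ k).1 β from rfl, Λ.rZ _ _ hv.le, map_pow]

end Level
end PlB
end

section
set_option linter.unusedSectionVars false
set_option linter.style.haveILetI false
set_option linter.unusedSimpArgs false

open WithZero

namespace PlB

/-- The arithmetic hypotheses used for the lower bound and the noncrossed product property. -/
structure Arith {F T κ k1 k2 : Type} [Field F] [Field T] [Field κ] [Field k1] [Field k2] [Algebra F T]
    (S : NCBi F T) (v : Place F κ) (w1 : Place κ k1) (w2 : Place κ k2) (s d : ℕ) (f t : F)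
    (C Y : T) : Prop where
  hl : S.l.Prime
  hM : 0 < s + d
  lκ : (S.l : κ) ≠ 0
  l1 : (S.l : k1) ≠ 0
  l2 : (S.l : k2) ≠ 0
  fin1 : Finite k1
  fin2 : Finite k2
  prim : IsPrimitiveRoot C (S.l ^ (s + d))
  faith : ∀ i : ℕ, (S.sg ^ i) C = C → S.n ∣ i
  taC : S.ta C = C
  taY : S.ta Y = C ^ (S.l ^ (s + d - 1)) * Y
  vf : v.v f = 1
  wf : w2.v (v.r f) = exp (-1 : ℤ)
  vt : v.v t = exp (-1 : ℤ)
  Yv : ∀ (T' : Type) [Field T'] [Algebra F T'] [Algebra T T'] [IsScalarTower F T T'] (R : Type)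
    [Field R] [Algebra κ R] (q : Place T' R) (e : ℕ), Over v q e → q.v (algebraMap T T' Y) = 1
  Y2 : ∀ (T' : Type) [Field T'] [Algebra F T'] [Algebra T T'] [IsScalarTower F T T'] (R : Type)
    [Field R] [Algebra κ R] (q : Place T' R) (e : ℕ), Over v q e → ∀ (R2 : Type) [Field R2]
    [Algebra k2 R2] (W : Place R R2) (e2 : ℕ), Over w2 W e2 → W.v (q.r (algebraMap T T' Y)) = 1
  Y1 : ∀ (T' : Type) [Field T'] [Algebra F T'] [Algebra T T'] [IsScalarTower F T T'] (R : Type)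
    [Field R] [Algebra κ R] (q : Place T' R) (e : ℕ), Over v q e → ∀ (R1 : Type) [Field R1]
    [Algebra k1 R1] (W : Place R R1) (e1 : ℕ), Over w1 W e1 →
    ∃ m : ℤ, ¬ (S.l : ℤ) ∣ m ∧ W.ord (q.r (algebraMap T T' Y)) * S.l = e1 * m
  hord : ∀ m : ℕ, S.l ^ (s + d) ∣ Nat.card k2 ^ m - 1 → S.l ^ d ∣ m
  bound : (Nat.card k1 - 1) * Nat.card k2 ^ (Nat.card k1 - 1) < S.l ^ d

theorem cast_pow_ne {k : Type} [Field k] {l : ℕ} (h : (l : k) ≠ 0) (m : ℕ) : ((l ^ m : ℕ) : k) ≠ 0 := by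
  push_cast; exact pow_ne_zero _ h

namespace Arith
variable {F T κ k1 k2 : Type} [Field F] [Field T] [Field κ] [Field k1] [Field k2] [Algebra F T]
    {S : NCBi F T} {v : Place F κ} {w1 : Place κ k1} {w2 : Place κ k2} {s d : ℕ} {f t : F}
    {C Y : T}
    {T' : Type} [Field T'] [Algebra F T'] [Algebra T T'] [IsScalarTower F T T']

theorem primT (h : Arith S v w1 w2 s d f t C Y) : IsPrimitiveRoot (algebraMap T T' C) (S.l ^ (s + d)) :=
  h.prim.map_of_injective (algebraMap T T').injective

theorem zprim (h : Arith S v w1 w2 s d f t C Y) : IsPrimitiveRoot (algebraMap T T' C ^ (S.l ^ (s + d - 1))) S.l := by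
  refine (h.primT (T' := T')).pow (pow_pos h.hl.pos _) ?_
  rw [← pow_succ]; congr 1; have := h.hM; omega

theorem sgtaC (h : Arith S v w1 w2 s d f t C Y) (i j : ℕ) : (S.sg ^ i * S.ta ^ j) C = (S.sg ^ i) C := by
  rw [AlgEquiv.mul_apply]
  congr 1
  induction j with
  | zero => simp
  | succ j ih => rw [pow_succ, AlgEquiv.mul_apply, h.taC, ih]

theorem tapY (h : Arith S v w1 w2 s d f t C Y) (j : ℕ) : (S.ta ^ j) Y = (C ^ (S.l ^ (s + d - 1))) ^ j * Y := by
  induction j with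
  | zero => simp
  | succ j ih =>
    rw [pow_succ, AlgEquiv.mul_apply, h.taY, map_mul, ih, map_pow]
    have := h.sgtaC 0 j
    simp only [pow_zero, one_mul] at this
    rw [this]
    simp only [AlgEquiv.one_apply]; ring

theorem actC (h : Arith S v w1 w2 s d f t C Y) (g : T' ≃ₐ[F] T') {i j : ℕ}
    (hij : ∀ x : T, g (algebraMap T T' x) = algebraMap T T' ((S.sg ^ i * S.ta ^ j : T ≃ₐ[F] T) x))
    (hg : g (algebraMap T T' C) = algebraMap T T' C) :
    g (algebraMap T T' Y) = (algebraMap T T' C ^ (S.l ^ (s + d - 1))) ^ j * algebraMap T T' Y ∧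
    (S.l ∣ j → ∀ x : T, g (algebraMap T T' x) = algebraMap T T' x) := by
  have h1 := hij C
  rw [hg, h.sgtaC] at h1
  have h2 := h.faith i ((algebraMap T T').injective h1).symm
  obtain ⟨c, rfl⟩ := h2
  have h3 : S.sg ^ (S.n * c) = 1 := by rw [pow_mul, S.sgn, one_pow]
  simp only [h3, one_mul] at hij
  refine ⟨?_, ?_⟩
  · rw [hij, h.tapY]; simp
  · rintro ⟨c2, rfl⟩ x
    rw [hij, pow_mul, S.tal, one_pow]; rfl

theorem act (h : Arith S v w1 w2 s d f t C Y) [FiniteDimensional F T] [IsGalois F T] (g : T' ≃ₐ[F] T') : ∃ i j : ℕ,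
    ∀ x : T, g (algebraMap T T' x) = algebraMap T T' ((S.sg ^ i * S.ta ^ j : T ≃ₐ[F] T) x) := by
  obtain ⟨i, j, hij⟩ := S.exists_pow (g.restrictNormal T)
  exact ⟨i, j, fun x => by rw [← hij, AlgEquiv.restrictNormal_commutes]⟩

theorem exists_chi (h : Arith S v w1 w2 s d f t C Y) [FiniteDimensional F T] [IsGalois F T] :
    ∃ χ : (T' ≃ₐ[F] T') →* Multiplicative (ZMod S.l), ∀ (g : T' ≃ₐ[F] T') (i j : ℕ),
      (∀ x : T, g (algebraMap T T' x) = algebraMap T T' ((S.sg ^ i * S.ta ^ j : T ≃ₐ[F] T) x)) →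
      χ g = Multiplicative.ofAdd (j : ZMod S.l) := by
  obtain ⟨χ, hχ⟩ := S.exists_chi0
  refine ⟨χ.comp (AlgEquiv.restrictNormalHom T), fun g i j hij => ?_⟩
  rw [← hχ i j]
  show χ (g.restrictNormal T) = _
  congr 1
  ext x
  apply (algebraMap T T').injective
  rw [AlgEquiv.restrictNormal_commutes, hij]

/-- inertia over `v` acts trivially on `T` -/
theorem J_fix (h : Arith S v w1 w2 s d f t C Y) [FiniteDimensional F T] [IsGalois F T] (Λ : Level v T') (g : Λ.J) (x : T) :
    g.1.1 (algebraMap T T' x) = algebraMap T T' x := by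
  have hN := cast_pow_ne h.lκ (s + d)
  have hC : g.1.1 (algebraMap T T' C) = algebraMap T T' C := by
    have := Λ.lift_root hN h.primT g.1 1 (by rw [(MonoidHom.mem_ker).1 g.2]; simp)
    simpa using this
  obtain ⟨i, j, hij⟩ := h.act g.1.1
  obtain ⟨hY, hfix⟩ := h.actC g.1.1 hij hC
  refine hfix ?_ x
  have hYv := h.Yv T' Λ.R Λ.q Λ.e Λ.ov
  have hr := Λ.rJ g hYv.le
  have hz := Λ.primR h.lκ (h.zprim (T' := T'))
  have hzv := Λ.q.v_root h.hl.ne_zero (h.zprim (T' := T')).pow_eq_one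
  rw [hY, Λ.q.r_mul (Λ.q.v_pow_le hzv.le j) hYv.le, Λ.q.r_pow hzv.le] at hr
  have h0 := Λ.q.r_ne_zero hYv
  exact (hz.pow_eq_one_iff_dvd j).1 (mul_right_cancel₀ h0 (hr.trans (one_mul _).symm))

/-- chain: element of `Z` whose reduction lies in the inertia group of a further place fixes `C` -/
theorem J2_C (h : Arith S v w1 w2 s d f t C Y) {k : Type} [Field k] {w : Place κ k} (hl : (S.l : k) ≠ 0)
    (Λ : Level v T') (Λ2 : Level w Λ.R) (g : Λ.Z)
    (m : ℕ) (u : Λ2.Z) (hu : Λ2.π u (Λ2.q.r (Λ.q.r (algebraMap T T' C))) = Λ2.q.r (Λ.q.r (algebraMap T T' C)) ^ m)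
    (hg : Λ.π g = u.1) :
    g.1 (algebraMap T T' C) = algebraMap T T' C ^ m := by
  have hN := cast_pow_ne h.lκ (s + d)
  have hN2 := cast_pow_ne hl (s + d)
  refine Λ.lift_root hN h.primT g m ?_
  rw [hg]
  exact Λ2.lift_root hN2 (Λ.primR hN h.primT) u m hu

theorem J2_C1 (h : Arith S v w1 w2 s d f t C Y) {k : Type} [Field k] {w : Place κ k} (hl : (S.l : k) ≠ 0)
    (Λ : Level v T') (Λ2 : Level w Λ.R) (g : Λ.Z) (u : Λ2.J) (hg : Λ.π g = u.1.1) :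
    g.1 (algebraMap T T' C) = algebraMap T T' C := by
  have := h.J2_C hl Λ Λ2 g 1 u.1 (by rw [(MonoidHom.mem_ker).1 u.2]; simp) hg
  simpa using this

theorem J2_fix (h : Arith S v w1 w2 s d f t C Y) [FiniteDimensional F T] [IsGalois F T] (Λ : Level v T') (Λ2 : Level w2 Λ.R) (g : Λ.Z) (u : Λ2.J)
    (hg : Λ.π g = u.1.1) (x : T) : g.1 (algebraMap T T' x) = algebraMap T T' x := by
  have hC := h.J2_C1 h.l2 Λ Λ2 g u hg
  obtain ⟨i, j, hij⟩ := h.act g.1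
  obtain ⟨hY, hfix⟩ := h.actC g.1 hij hC
  refine hfix ?_ x
  have hYv := h.Yv T' Λ.R Λ.q Λ.e Λ.ov
  have hY2 := h.Y2 T' Λ.R Λ.q Λ.e Λ.ov Λ2.R Λ2.q Λ2.e Λ2.ov
  have hz0 := Λ.primR h.lκ (h.zprim (T' := T'))
  have hz := Λ2.primR h.l2 hz0
  have hzv := Λ.q.v_root h.hl.ne_zero (h.zprim (T' := T')).pow_eq_one
  have hzv2 := Λ2.q.v_root h.hl.ne_zero hz0.pow_eq_one
  have hr := Λ.rZ g _ hYv.le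
  rw [hY, Λ.q.r_mul (Λ.q.v_pow_le hzv.le j) hYv.le, Λ.q.r_pow hzv.le, hg] at hr
  have hr2 := Λ2.rJ u hY2.le
  rw [← hr, Λ2.q.r_mul (Λ2.q.v_pow_le hzv2.le j) hY2.le, Λ2.q.r_pow hzv2.le] at hr2
  have h0 := Λ2.q.r_ne_zero hY2
  exact (hz.pow_eq_one_iff_dvd j).1 (mul_right_cancel₀ h0 (hr2.trans (one_mul _).symm))

/-- the Frobenius at a further place -/
theorem exists_frob (h : Arith S v w1 w2 s d f t C Y) {k : Type} [Field k] [Finite k] {w : Place κ k} {R : Type} [Field R] [Algebra κ R]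
    (Λ2 : Level w R) : ∃ z : Λ2.Z, (∀ x, Λ2.π z x = x ^ Nat.card k) ∧
      ∀ u : Λ2.Z, ∃ i : ℕ, Λ2.π u = Λ2.π z ^ i := by
  haveI := Fintype.ofFinite k
  haveI : Finite Λ2.R := Module.finite_of_finite k
  obtain ⟨z, hz⟩ := Λ2.πs (FiniteField.frobeniusAlgEquivOfAlgebraic k Λ2.R)
  refine ⟨z, fun x => ?_, fun u => ?_⟩
  · rw [hz]; simp [Nat.card_eq_fintype_card]
  · obtain ⟨i, hi⟩ := (FiniteField.bijective_frobeniusAlgEquivOfAlgebraic_pow k Λ2.R).2 (Λ2.π u)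
    exact ⟨i, by rw [hz, ← hi]⟩

theorem fr_C (h : Arith S v w1 w2 s d f t C Y) (Λ : Level v T') (Λ2 : Level w2 Λ.R) (z : Λ2.Z) (hz : ∀ x, Λ2.π z x = x ^ Nat.card k2)
    (g : Λ.Z) (hg : Λ.π g = z.1) : g.1 (algebraMap T T' C) = algebraMap T T' C ^ Nat.card k2 :=
  h.J2_C h.l2 Λ Λ2 g _ z (hz _) hg

theorem f_ne (h : Arith S v w1 w2 s d f t C Y) : f ≠ 0 := by rintro rfl; have := h.vf; simp at this
theorem t_ne (h : Arith S v w1 w2 s d f t C Y) : t ≠ 0 := by rintro rfl; have := h.vt; rw [map_zero] at this; exact exp_ne_zero this.symm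

theorem det_unit (c : T) : (c • (1 : Matrix Unit Unit T)).det = c := by simp

theorem LB (h : Arith S v w1 w2 s d f t C Y) [FiniteDimensional F T] [IsGalois F T] (r : ℕ) (b b' : T) (hsc : S.Sc (f ^ r) (t ^ r) b b') :
    S.l ^ d ∣ r := by
  haveI := h.fin2
  obtain ⟨Λ⟩ := (v.exists_level0 T).2 inferInstance
  have hJ : Λ.J = ⊥ := by
    rw [eq_bot_iff]
    intro g hg
    rw [Subgroup.mem_bot]
    apply Subtype.ext
    ext x
    exact h.J_fix Λ ⟨g, hg⟩ x
  obtain ⟨hG, he⟩ := Λ.galois_of_bot hJ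
  obtain ⟨Λ2⟩ := (w2.exists_level0 Λ.R).2 inferInstance
  have hJ2 : Λ2.J = ⊥ := by
    rw [eq_bot_iff]
    intro u hu
    rw [Subgroup.mem_bot]
    obtain ⟨g, hg⟩ := Λ.πs u.1
    have : g = 1 := by
      apply Subtype.ext
      ext x
      exact h.J2_fix Λ Λ2 g ⟨u, hu⟩ hg x
    apply Subtype.ext
    rw [← hg, this, map_one]; rfl
  obtain ⟨hG2, he2⟩ := Λ2.galois_of_bot hJ2
  obtain ⟨z, hz, -⟩ := h.exists_frob Λ2
  obtain ⟨g, hg⟩ := Λ.πs z.1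
  have hgC : g.1 C = C ^ Nat.card k2 := h.fr_C Λ Λ2 z hz g hg
  obtain ⟨i, j, hij⟩ := S.exists_pow g.1
  -- the element beta
  have hTw : S.Tw (f ^ r) (t ^ r) (b • (1 : Matrix Unit Unit T)) (b' • (1 : Matrix Unit Unit T)) := by
    refine ⟨?_, ?_, ?_⟩
    · rw [NCBi.nrm_smul_one, hsc.1]
    · rw [NCBi.nrm_smul_one, hsc.2.1]
    · ext x y
      have := hsc.2.2
      simpa [Matrix.mul_apply] using this
  have hM := congrArg Matrix.det (NCBi.nrm_Mij hTw i j)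
  rw [NCBi.det_nrm, det_unit, ← hij] at hM
  set β := (S.Mij (b • (1 : Matrix Unit Unit T)) (b' • (1 : Matrix Unit Unit T)) i j).det
  have hf0 := h.f_ne
  have ht0 := h.t_ne
  have h1 := Λ.ord_prodZ g (mul_ne_zero (pow_ne_zero _ (pow_ne_zero _ hf0)) (pow_ne_zero _ (pow_ne_zero _ ht0))) hM
  rw [v.ord_mul (pow_ne_zero _ (pow_ne_zero _ hf0)) (pow_ne_zero _ (pow_ne_zero _ ht0)), v.ord_pow, v.ord_pow,
    v.ord_pow, v.ord_pow, v.ord_one_of h.vf, v.ord_of_v h.vt, he] at h1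
  push_cast at h1
  have hn0 : (S.n : ℤ) ≠ 0 := by exact_mod_cast S.hn.ne'
  have h2 : (S.l : ℤ) * Λ.q.ord β = r * j := by
    apply mul_left_cancel₀ hn0; linarith
  set o := Λ.q.ord β with ho
  set β2 := β / algebraMap F T t ^ o with hβ2
  have h3 : ∏ k ∈ Finset.range (S.n * S.l), (g.1 ^ k) β2 = algebraMap F T ((f ^ r) ^ (i * S.l)) := by
    have : ∀ k, (g.1 ^ k) β2 = (g.1 ^ k) β / algebraMap F T t ^ o := fun k => by
      rw [hβ2, map_div₀, map_zpow₀, AlgEquiv.commutes]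
    rw [Finset.prod_congr rfl fun k _ => this k, Finset.prod_div_distrib, hM, Finset.prod_const,
      Finset.card_range, map_mul]
    have h0 : algebraMap F T t ≠ 0 := by simpa using ht0
    have h4 : (algebraMap F T t ^ o) ^ (S.n * S.l) = algebraMap F T ((t ^ r) ^ (j * S.n)) := by
      rw [map_pow, map_pow, ← zpow_natCast, ← zpow_mul, ← pow_mul, ← zpow_natCast]
      congr 1
      push_cast
      linear_combination (S.n : ℤ) * h2
    rw [h4, mul_div_assoc, div_self, mul_one]
    rw [← h4]; exact pow_ne_zero _ (zpow_ne_zero _ h0)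
  have hNl : S.n * S.l ≠ 0 := mul_ne_zero S.hn.ne' S.hl.ne'
  have hv1 : v.v ((f ^ r) ^ (i * S.l)) = 1 := by rw [map_pow, map_pow, h.vf, one_pow, one_pow]
  have h5 := Λ.red_prod g hNl hv1 h3
  rw [hg] at h5
  have hr : v.r ((f ^ r) ^ (i * S.l)) = v.r f ^ (r * (i * S.l)) := by
    rw [← pow_mul, v.r_pow h.vf.le]
  rw [hr] at h5
  have hrf : v.r f ≠ 0 := v.r_ne_zero h.vf
  have h6 := Λ2.ord_prodZ z (pow_ne_zero _ hrf) h5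
  rw [w2.ord_pow, w2.ord_of_v h.wf, he2] at h6
  have h7 : (S.n : ℤ) ∣ r * i := by
    refine ⟨Λ2.q.ord (Λ.q.r β2), ?_⟩
    have hl0 : (S.l : ℤ) ≠ 0 := by exact_mod_cast S.hl.ne'
    apply mul_left_cancel₀ hl0
    push_cast at h6
    linarith
  have h8 : S.n ∣ r * i := by exact_mod_cast h7
  apply h.hord
  have h9 : ∀ m : ℕ, (g.1 ^ m) C = C ^ (Nat.card k2 ^ m) := by
    intro m
    induction m with
    | zero => simp
    | succ m ih => rw [pow_succ', AlgEquiv.mul_apply, ih, map_pow, hgC, ← pow_mul, pow_succ']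
  have h10 : (g.1 ^ r) C = C := by
    rw [hij, (S.commS.pow_pow i j).mul_pow, ← pow_mul, ← pow_mul, h.sgtaC]
    obtain ⟨c, hc⟩ := h8
    rw [mul_comm i r, hc, pow_mul, S.sgn, one_pow]; rfl
  rw [h9] at h10
  have hpos : 1 ≤ Nat.card k2 ^ r := Nat.one_le_pow _ _ Nat.card_pos
  rw [← h.prim.pow_eq_one_iff_dvd]
  have hC0 : C ≠ 0 := h.prim.ne_zero (pow_ne_zero _ h.hl.ne_zero)
  apply mul_right_cancel₀ hC0
  rw [← pow_succ, Nat.sub_add_cancel hpos, h10, one_mul]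

end Arith
end PlB
end

section
set_option linter.unusedSectionVars false
set_option linter.style.haveILetI false
set_option linter.unusedSimpArgs false

open WithZero

namespace PlB

theorem grp_index_sup {Z : Type*} [Group Z] (X I : Subgroup Z) [X.Normal] (h : X ⊓ I = ⊥) :
    (X ⊔ I).index * Nat.card I = X.index := by
  rw [← Subgroup.relIndex_mul_index (le_sup_left : X ≤ X ⊔ I), Subgroup.relIndex_sup_left,
    ← Subgroup.inf_relIndex_right, h, Subgroup.relIndex_bot_left, mul_comm]

theorem grp_card_dvd_quot {G J : Type*} [Group G] [Group J] (X : Subgroup G) [X.Normal] (φ : J →* G)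
    (h : ∀ j, φ j ∈ X → j = 1) : Nat.card J ∣ X.index := by
  refine Subgroup.card_dvd_of_injective ((QuotientGroup.mk' X).comp φ) ?_
  rw [injective_iff_map_eq_one]
  intro j hj
  exact h j ((QuotientGroup.eq_one_iff _).1 hj)

namespace Arith
variable {F T κ k1 k2 : Type} [Field F] [Field T] [Field κ] [Field k1] [Field k2] [Algebra F T]
    {S : NCBi F T} {v : Place F κ} {w1 : Place κ k1} {w2 : Place κ k2} {s d : ℕ} {f t : F}
    {C Y : T}

theorem fdeg (h : Arith S v w1 w2 s d f t C Y) {T' : Type} [Field T'] [Algebra F T'] [Algebra T T']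
    [IsScalarTower F T T'] (Λ : Level v T') (Λ2 : Level w2 Λ.R) : S.l ^ d ∣ Module.finrank k2 Λ2.R := by
  haveI := h.fin2
  haveI := Fintype.ofFinite k2
  haveI : Finite Λ2.R := Module.finite_of_finite k2
  apply h.hord
  have hp := Λ2.primR (cast_pow_ne h.l2 (s + d)) (Λ.primR (cast_pow_ne h.lκ (s + d)) (h.primT (T' := T')))
  have hc : Nat.card Λ2.R = Nat.card k2 ^ Module.finrank k2 Λ2.R := Module.natCard_eq_pow_finrank
  rw [← hc, ← hp.pow_eq_one_iff_dvd]
  haveI := Fintype.ofFinite Λ2.R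
  rw [Nat.card_eq_fintype_card]
  apply FiniteField.pow_card_sub_one_eq_one
  exact hp.ne_zero (pow_ne_zero _ h.hl.ne_zero)

set_option maxHeartbeats 1000000 in
theorem NC (h : Arith S v w1 w2 s d f t C Y) [FiniteDimensional F T] [IsGalois F T] :
    S.NCcond f t (S.l ^ d) := by
  intro T' _ _ _ _ _ _ K' _ hdim hfaith hβ
  haveI := h.fin1
  haveI := h.fin2
  have hlp := h.hl
  haveI : Fact S.l.Prime := ⟨hlp⟩
  obtain ⟨χ, hχ⟩ := h.exists_chi (T' := T')
  set H := K'.fixingSubgroup with hH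
  have hHi : H.index = S.l ^ d := by rw [← hdim, IntermediateField.finrank_eq_fixingSubgroup_index]
  have hHm : ∀ g ∈ H, ∀ x ∈ K', g x = x := fun g hg x hx => (IntermediateField.mem_fixingSubgroup_iff _ _).1 hg x hx
  -- fixing T
  have hfix : ∀ g ∈ H, (∀ x : T, g (algebraMap T T' x) = algebraMap T T' x) → g = 1 := fun g hg hx =>
    hfaith g (hHm g hg) hx
  have hchi1 : ∀ g : T' ≃ₐ[F] T', (∀ x : T, g (algebraMap T T' x) = algebraMap T T' x) → χ g = 1 := by
    intro g hg
    rw [hχ g 0 0 (by simpa using hg)]; simp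
  have hCfix : ∀ g : T' ≃ₐ[F] T', g (algebraMap T T' C) = algebraMap T T' C → χ g = 1 →
      ∀ x : T, g (algebraMap T T' x) = algebraMap T T' x := by
    intro g hg hc
    obtain ⟨i, j, hij⟩ := h.act g
    refine (h.actC g hij hg).2 ?_
    rw [hχ g i j hij, ofAdd_eq_one, ZMod.natCast_eq_zero_iff] at hc
    exact hc
  have hsg : ∀ g : T' ≃ₐ[F] T', χ g = 1 → ∃ i : ℕ, ∀ x : T, g (algebraMap T T' x) =
      algebraMap T T' ((S.sg ^ i * S.ta ^ 0 : T ≃ₐ[F] T) x) := by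
    intro g hc
    obtain ⟨i, j, hij⟩ := h.act g
    rw [hχ g i j hij, ofAdd_eq_one, ZMod.natCast_eq_zero_iff] at hc
    obtain ⟨c, rfl⟩ := hc
    exact ⟨i, by simpa [pow_mul, S.tal] using hij⟩
  set X0 := H ⊓ χ.ker with hX0
  obtain ⟨Λ⟩ := (v.exists_level0 T').2 inferInstance
  -- step 1
  have hIH : ∀ g : Λ.J, g.1.1 ∈ H → g = 1 := fun g hg => by
    apply Subtype.ext; apply Subtype.ext
    exact hfix _ hg (h.J_fix Λ g)
  have hIcard : Nat.card Λ.J ∣ S.l ^ d := by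
    rw [← hHi]
    exact grp_card_dvd_quot H (Λ.Z.subtype.comp Λ.J.subtype) hIH
  have hne_of : ∀ {k : Type} [Field k] (_ : (S.l : k) ≠ 0) (m : ℕ), m ∣ S.l ^ d → (m : k) ≠ 0 := by
    intro k _ hk m hm h0
    obtain ⟨c, hc⟩ := hm
    apply cast_pow_ne hk d
    rw [hc, Nat.cast_mul, h0, zero_mul]
  obtain ⟨hG, hIe⟩ := Λ.galois_of_card (hne_of h.lκ _ hIcard)
  have hf0 := h.f_ne
  have ht0 := h.t_ne
  have hn0 : (S.n : ℤ) ≠ 0 := by exact_mod_cast S.hn.ne'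
  have hl0 : (S.l : ℤ) ≠ 0 := by exact_mod_cast S.hl.ne'
  have hNl : S.n * S.l ≠ 0 := mul_ne_zero S.hn.ne' S.hl.ne'
  -- step 2
  have hstep2 : Λ.e = 1 → ∀ g : Λ.Z, g.1 ∈ H → χ g.1 = 1 := by
    intro he g hg
    obtain ⟨i, j, hij⟩ := h.act g.1
    obtain ⟨β, hb⟩ := hβ g.1 (hHm _ hg) i j hij
    have h1 := Λ.ord_prodZ g (mul_ne_zero (pow_ne_zero _ hf0) (pow_ne_zero _ ht0)) hb
    rw [v.ord_mul (pow_ne_zero _ hf0) (pow_ne_zero _ ht0), v.ord_pow, v.ord_pow,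
      v.ord_one_of h.vf, v.ord_of_v h.vt, he] at h1
    push_cast at h1
    have h2 : (S.l : ℤ) ∣ j := by
      refine ⟨Λ.q.ord β, ?_⟩
      apply mul_left_cancel₀ hn0; linarith
    rw [hχ g.1 i j hij, ofAdd_eq_one, ZMod.natCast_eq_zero_iff]
    exact_mod_cast h2
  set XZ := X0.subgroupOf Λ.Z with hXZ
  have hXI : XZ ⊓ Λ.J = ⊥ := by
    rw [eq_bot_iff]
    rintro g ⟨h1, h2⟩
    rw [Subgroup.mem_bot]
    have := hIH ⟨g, h2⟩ (Subgroup.mem_subgroupOf.1 h1).1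
    exact congrArg Subtype.val this
  set X := XZ.map Λ.π with hX
  haveI hXn : X.Normal := Subgroup.Normal.map inferInstance _ Λ.πs
  have hXi : X.index * Λ.e = XZ.index := by
    rw [hX, Subgroup.index_map, MonoidHom.range_eq_top.2 Λ.πs, Subgroup.index_top, mul_one, ← hIe]
    exact grp_index_sup XZ Λ.J hXI
  have hXd : X.index ∣ S.l ^ d := by
    by_cases he : Λ.e = 1
    · rw [he, mul_one] at hXi
      rw [hXi]
      have : XZ = H.subgroupOf Λ.Z := by
        ext g
        rw [Subgroup.mem_subgroupOf, Subgroup.mem_subgroupOf]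
        exact ⟨fun hg => hg.1, fun hg => ⟨hg, hstep2 he g hg⟩⟩
      rw [this, ← hHi]
      exact Subgroup.relIndex_dvd_index_of_normal H Λ.Z
    · have hle : S.l ∣ Λ.e := by
        rw [hIe] at hIcard
        obtain ⟨m, -, hm⟩ := (Nat.dvd_prime_pow hlp).1 hIcard
        rw [hm]
        refine dvd_pow_self _ ?_
        rintro rfl
        exact he (by rw [hm, pow_zero])
      have h1 : X0.index ∣ S.l ^ (d + 1) := by
        rw [← Subgroup.relIndex_mul_index (inf_le_left : X0 ≤ H), hHi, pow_succ, mul_comm]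
        refine mul_dvd_mul_left _ ?_
        rw [inf_comm, Subgroup.inf_relIndex_right, Subgroup.relIndex_ker]
        refine (Subgroup.card_subgroup_dvd_card _).trans ?_
        show Nat.card (ZMod S.l) ∣ _
        rw [Nat.card_zmod]
      have h2 : XZ.index ∣ S.l ^ (d + 1) := (Subgroup.relIndex_dvd_index_of_normal X0 Λ.Z).trans h1
      have h3 : X.index * S.l ∣ S.l ^ d * S.l := by
        rw [← pow_succ]
        refine dvd_trans ?_ h2
        rw [← hXi]
        exact mul_dvd_mul_left _ hle
      exact (Nat.mul_dvd_mul_iff_right hlp.pos).1 h3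
  -- lifting elements of X
  have hXl : ∀ u ∈ X, ∃ g : Λ.Z, g.1 ∈ H ∧ χ g.1 = 1 ∧ Λ.π g = u := by
    rintro u ⟨g, hg, rfl⟩
    exact ⟨g, (Subgroup.mem_subgroupOf.1 hg).1, (Subgroup.mem_subgroupOf.1 hg).2, rfl⟩
  -- step 3
  obtain ⟨Λ2⟩ := (w2.exists_level0 Λ.R).2 inferInstance
  have hcycXZ : IsCyclic XZ := by
    let φ : XZ →* (Subgroup.zpowers S.sg) :=
      MonoidHom.codRestrict ((AlgEquiv.restrictNormalHom T).comp (Λ.Z.subtype.comp XZ.subtype)) _ (by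
        intro g
        obtain ⟨i, hi⟩ := hsg g.1.1 (Subgroup.mem_subgroupOf.1 g.2).2
        refine ⟨i, ?_⟩
        show S.sg ^ (i : ℤ) = g.1.1.restrictNormal T
        ext x
        apply (algebraMap T T').injective
        rw [AlgEquiv.restrictNormal_commutes, hi]; simp)
    refine isCyclic_of_injective φ ?_
    rw [injective_iff_map_eq_one]
    intro g hg
    apply Subtype.ext; apply Subtype.ext
    refine hfix _ (Subgroup.mem_subgroupOf.1 g.2).1 fun x => ?_
    have h1 : g.1.1.restrictNormal T = 1 := congrArg Subtype.val hg
    rw [← AlgEquiv.restrictNormal_commutes, h1]; rfl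
  have hcycX : IsCyclic X := by
    refine isCyclic_of_surjective (Λ.π.subgroupMap XZ) (Λ.π.subgroupMap_surjective XZ)
  set X2 := X.subgroupOf Λ2.Z with hX2
  have hcyc2 : IsCyclic X2 := by
    refine isCyclic_of_injective (G' := X) (MonoidHom.codRestrict (Λ2.Z.subtype.comp X2.subtype) X
      (fun g => Subgroup.mem_subgroupOf.1 g.2)) ?_
    intro a b hab
    apply Subtype.ext; apply Subtype.ext
    exact congrArg (fun z : X => z.1) hab
  have hX2e : ∀ u : X2, u ^ Λ2.e = 1 := by
    intro u
    obtain ⟨g, hgH, hgχ, hgu⟩ := hXl u.1.1 (Subgroup.mem_subgroupOf.1 u.2)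
    obtain ⟨i, hi⟩ := hsg _ hgχ
    obtain ⟨β, hb⟩ := hβ g.1 (hHm _ hgH) i 0 hi
    rw [zero_mul, pow_zero, mul_one] at hb
    have hv1 : v.v (f ^ (i * S.l)) = 1 := by rw [map_pow, h.vf, one_pow]
    have h5 := Λ.red_prod g hNl hv1 hb
    rw [hgu, v.r_pow h.vf.le] at h5
    have h6 := Λ2.ord_prodZ u.1 (pow_ne_zero _ (v.r_ne_zero h.vf)) h5
    rw [w2.ord_pow, w2.ord_of_v h.wf] at h6
    have h7 : (S.n : ℤ) ∣ i * Λ2.e := by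
      refine ⟨Λ2.q.ord (Λ.q.r β), ?_⟩
      apply mul_left_cancel₀ hl0
      push_cast at h6
      linarith
    have h8 : S.n ∣ i * Λ2.e := by exact_mod_cast h7
    have h9 : g ^ Λ2.e = 1 := by
      apply Subtype.ext
      refine hfix _ (H.pow_mem hgH _) ?_
      have h10 : ∀ m : ℕ, ∀ x : T, (g.1 ^ m) (algebraMap T T' x) = algebraMap T T' ((S.sg ^ (i * m)) x) := by
        intro m
        induction m with
        | zero => simp
        | succ m ih =>
          intro x
          rw [pow_succ, AlgEquiv.mul_apply, hi, ih, pow_zero, mul_one, ← AlgEquiv.mul_apply, ← pow_add,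
            Nat.mul_succ]
      intro x
      show (g.1 ^ Λ2.e) _ = _
      rw [h10]
      obtain ⟨c, hc⟩ := h8
      rw [hc, pow_mul, S.sgn, one_pow]; rfl
    apply Subtype.ext; apply Subtype.ext
    show u.1.1 ^ Λ2.e = 1
    rw [← hgu, ← map_pow, h9, map_one]
  have hX2c : Nat.card X2 ∣ Λ2.e := by
    rw [← IsCyclic.exponent_eq_card, Monoid.exponent_dvd_iff_forall_pow_eq_one]
    exact hX2e
  have hX2i : S.l ^ d ≤ X2.index := by
    have h1 := X2.card_mul_index
    rw [Λ2.card] at h1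
    have h2 : Nat.card X2 ≤ Λ2.e := Nat.le_of_dvd Λ2.ov.epos hX2c
    have h3 : S.l ^ d ≤ Module.finrank k2 Λ2.R := Nat.le_of_dvd Module.finrank_pos (h.fdeg Λ Λ2)
    by_contra hcon
    push Not at hcon
    have h4 : Nat.card X2 * X2.index ≤ Λ2.e * X2.index := Nat.mul_le_mul_right _ h2
    have h5 : Λ2.e * X2.index < Λ2.e * Module.finrank k2 Λ2.R :=
      Nat.mul_lt_mul_of_pos_left (by omega) Λ2.ov.epos
    omega
  have hX2d : X2.index ∣ X.index := Subgroup.relIndex_dvd_index_of_normal X Λ2.Z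
  have hXdpos : X.index ≠ 0 := by
    intro h0
    rw [h0] at hXd
    exact (pow_pos hlp.pos d).ne' (Nat.eq_zero_of_zero_dvd hXd)
  have hXle : X.index ≤ S.l ^ d := Nat.le_of_dvd (pow_pos hlp.pos d) hXd
  have hX2le : X2.index ≤ X.index := Nat.le_of_dvd (Nat.pos_of_ne_zero hXdpos) hX2d
  have hXeq : X.index = S.l ^ d := by omega
  -- surjectivity of Z2 onto the quotient
  let ρ : Λ2.Z →* ((Λ.R ≃ₐ[κ] Λ.R) ⧸ X) := (QuotientGroup.mk' X).comp Λ2.Z.subtype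
  have hρk : ρ.ker = X2 := by
    ext u
    rw [MonoidHom.mem_ker, Subgroup.mem_subgroupOf]
    exact QuotientGroup.eq_one_iff _
  have hρs : Function.Surjective ρ := by
    rw [← MonoidHom.range_eq_top]
    apply Subgroup.eq_top_of_card_eq
    rw [← Subgroup.index_ker, hρk]
    show _ = X.index
    omega
  -- step 4
  have hJX : ∀ {k : Type} [Field k] (w : Place κ k) (Λk : Level w Λ.R), (S.l : k) ≠ 0 →
      ∀ u : Λk.J, u.1.1 ∈ X → u = 1 := by
    intro k _ w Λk hk u hu
    obtain ⟨g, hgH, hgχ, hgu⟩ := hXl _ hu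
    have h1 := h.J2_C1 hk Λ Λk g u hgu
    have h2 := hfix _ hgH (hCfix _ h1 hgχ)
    have h3 : g = 1 := Subtype.ext h2
    apply Subtype.ext; apply Subtype.ext
    rw [← hgu, h3, map_one]; rfl
  have hJc : ∀ {k : Type} [Field k] (w : Place κ k) (Λk : Level w Λ.R), (S.l : k) ≠ 0 →
      (Nat.card Λk.J : k) ≠ 0 := by
    intro k _ w Λk hk
    refine hne_of hk _ ?_
    rw [← hXeq]
    exact grp_card_dvd_quot X (Λk.Z.subtype.comp Λk.J.subtype) (hJX w Λk hk)
  have hc2 := hJc w2 Λ2 h.l2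
  obtain ⟨Λ1⟩ := (w1.exists_level0 Λ.R).2 inferInstance
  have hc1 := hJc w1 Λ1 h.l1
  -- chi on the quotient
  have hker : Λ.π.ker ≤ (χ.comp Λ.Z.subtype).ker := by
    intro g hg
    exact hchi1 _ (h.J_fix Λ ⟨g, hg⟩)
  let χQ : (Λ.R ≃ₐ[κ] Λ.R) →* Multiplicative (ZMod S.l) :=
    MonoidHom.liftOfSurjective Λ.π Λ.πs ⟨χ.comp Λ.Z.subtype, hker⟩
  have hχQ : ∀ g : Λ.Z, χQ (Λ.π g) = χ g.1 := fun g =>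
    MonoidHom.liftOfRightInverse_comp_apply Λ.π _ (Function.rightInverse_surjInv Λ.πs)
      ⟨χ.comp Λ.Z.subtype, hker⟩ g
  have hXχ : X ≤ χQ.ker := by
    intro u hu
    obtain ⟨g, -, hgχ, hgu⟩ := hXl u hu
    rw [MonoidHom.mem_ker, ← hgu, hχQ, hgχ]
  let χq : ((Λ.R ≃ₐ[κ] Λ.R) ⧸ X) →* Multiplicative (ZMod S.l) := QuotientGroup.lift X χQ hXχ
  -- elements
  obtain ⟨z2, hz2, hz2g⟩ := h.exists_frob Λ2
  obtain ⟨z1, hz1, -⟩ := h.exists_frob Λ1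
  haveI := Λ2.J_cyclic hc2
  obtain ⟨t2, ht2⟩ := IsCyclic.exists_generator (α := Λ2.J)
  have hgen : ∀ x : ((Λ.R ≃ₐ[κ] Λ.R) ⧸ X), ∃ u w : ℕ, x = ρ z2 ^ u * ρ t2.1 ^ w := by
    intro x
    obtain ⟨y, rfl⟩ := hρs x
    obtain ⟨i, hi⟩ := hz2g y
    have hmem : (z2 ^ i)⁻¹ * y ∈ Λ2.J := by
      rw [MonoidHom.mem_ker, map_mul, map_inv, map_pow, ← hi, inv_mul_cancel]
    obtain ⟨w, hw⟩ := mem_powers_iff_mem_zpowers.2 (ht2 ⟨_, hmem⟩)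
    have hw2 : t2.1 ^ w = (z2 ^ i)⁻¹ * y := by simpa using congrArg Subtype.val hw
    refine ⟨i, w, ?_⟩
    rw [← map_pow, ← map_pow, hw2, ← map_mul, mul_inv_cancel_left]
  have hconj2 := congrArg ρ (Λ2.J_conj hc2 z2 _ hz2 t2)
  have hχt2 : χq (ρ t2.1) = 1 := by
    obtain ⟨g, hg⟩ := Λ.πs t2.1.1
    show χQ t2.1.1 = 1
    rw [← hg, hχQ]
    exact hchi1 _ (h.J2_fix Λ Λ2 g t2 hg)
  -- ramified element at w1
  have hτ : ∃ τ : Λ1.J, χQ τ.1.1 ≠ 1 := by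
    by_contra hcon
    push Not at hcon
    obtain ⟨m, hm, hme⟩ := h.Y1 T' Λ.R Λ.q Λ.e Λ.ov Λ1.R Λ1.q Λ1.e Λ1.ov
    obtain ⟨θ, hθi, hθ⟩ := Λ1.exists_theta hc1
    haveI := Λ1.J_cyclic hc1
    obtain ⟨u, hu⟩ := IsCyclic.exists_generator (α := Λ1.J)
    have hYv := h.Yv T' Λ.R Λ.q Λ.e Λ.ov
    have hY0 := Λ.q.r_ne_zero hYv
    have h1 : u.1.1 (Λ.q.r (algebraMap T T' Y)) = Λ.q.r (algebraMap T T' Y) := by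
      obtain ⟨g, hg⟩ := Λ.πs u.1.1
      have h2 := h.J2_C1 h.l1 Λ Λ1 g u hg
      have h3 : χ g.1 = 1 := by rw [← hχQ, hg]; exact hcon u
      rw [← hg, ← Λ.rZ g _ hYv.le, hCfix _ h2 h3]
    have h2 := hθ u _ hY0
    rw [h1, div_self hY0, Λ1.q.r_one] at h2
    have h3 : orderOf (θ u) = Λ1.e := by
      rw [orderOf_injective θ hθi, orderOf_eq_card_of_forall_mem_zpowers hu]
      exact (Λ1.galois_of_card hc1).2
    have hθ0 : θ u ≠ 0 := by
      intro h0
      have := congrArg θ (pow_card_eq_one' (x := u))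
      rw [map_pow, h0, map_one, zero_pow Nat.card_pos.ne'] at this
      exact zero_ne_one this
    have h4 : ((Λ1.e : ℕ) : ℤ) ∣ Λ1.q.ord (Λ.q.r (algebraMap T T' Y)) := by
      rw [← h3]
      have h5 : orderOf (Units.mk0 (θ u) hθ0) = orderOf (θ u) := by
        rw [← orderOf_units]; rfl
      rw [← h5, orderOf_dvd_iff_zpow_eq_one]
      ext
      simpa using h2.symm
    obtain ⟨c, hc⟩ := h4
    rw [hc] at hme
    apply hm
    refine ⟨c, ?_⟩
    have he0 : (Λ1.e : ℤ) ≠ 0 := by exact_mod_cast Λ1.ov.epos.ne'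
    apply mul_left_cancel₀ he0
    linarith
  obtain ⟨τ, hτ⟩ := hτ
  let ρ1 : Λ1.Z →* ((Λ.R ≃ₐ[κ] Λ.R) ⧸ X) := (QuotientGroup.mk' X).comp Λ1.Z.subtype
  have hconj1 := congrArg ρ1 (Λ1.J_conj hc1 z1 _ hz1 τ)
  have hfinal := group_bound χq S.l d hlp (fun a => by
      show Multiplicative.ofAdd (S.l • a.toAdd) = 1
      rw [nsmul_eq_mul]; simp) hXeq (ρ z2) (ρ t2.1) (ρ1 z1) (ρ1 τ.1)
    (Nat.card k1) (Nat.card k2) Finite.one_lt_card Finite.one_lt_card hgen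
    (by rw [map_mul, map_mul, map_inv, map_pow] at hconj2; exact hconj2)
    (by rw [map_mul, map_mul, map_inv, map_pow] at hconj1; exact hconj1) hχt2 hτ
  exact absurd h.bound (not_lt.2 hfinal)

end Arith
end PlB
end

section
set_option linter.unusedSectionVars false
set_option linter.style.haveILetI false
set_option linter.unusedSimpArgs false

namespace PlB

theorem pow_cong {l s : ℕ} (hs : 0 < s) {u : ℤ} (hu : (l : ℤ) ^ s ∣ u - 1) (d : ℕ) :
    (l : ℤ) ^ (s + d) ∣ u ^ (l ^ d) - 1 := by
  induction d with
  | zero => simpa using hu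
  | succ d ih =>
    have h1 : u ^ (l ^ (d + 1)) - 1 = (∑ i ∈ Finset.range l, (u ^ l ^ d) ^ i) * (u ^ (l ^ d) - 1) := by
      rw [geom_sum_mul, ← pow_mul, pow_succ]
    have h2 : (l : ℤ) ∣ ∑ i ∈ Finset.range l, (u ^ l ^ d) ^ i := by
      have h3 : (l : ℤ) ∣ u ^ l ^ d - 1 := (dvd_pow_self _ (by omega)).trans ih
      have h4 : u ^ l ^ d ≡ 1 [ZMOD l] := (Int.modEq_iff_dvd.2 h3).symm
      have h5 : ∑ i ∈ Finset.range l, (u ^ l ^ d) ^ i ≡ ∑ i ∈ Finset.range l, 1 [ZMOD l] := by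
        apply Int.ModEq.sum
        intro i _
        simpa using h4.pow i
      have h6 : ∑ i ∈ Finset.range l, (1 : ℤ) = l := by simp
      rw [h6] at h5
      exact (Int.modEq_zero_iff_dvd).1 (h5.trans (Int.modEq_zero_iff_dvd.2 dvd_rfl))
    rw [h1, ← add_assoc, pow_succ, mul_comm]
    exact mul_dvd_mul h2 ih

theorem hord_of {l s q : ℕ} (hl : l.Prime) (hs : 0 < s) (h2 : l = 2 → 2 ≤ s) (hq : 0 < q) (h1 : l ^ s ∣ q - 1)
    (hn : ¬ l ^ (s + 1) ∣ q - 1) (d m : ℕ) (hm : l ^ (s + d) ∣ q ^ m - 1) : l ^ d ∣ m := by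
  have h1' : (l : ℤ) ^ s ∣ (q : ℤ) - 1 := by
    have := Int.natCast_dvd_natCast.2 h1
    rw [Nat.cast_sub hq] at this; exact_mod_cast this
  have hn' : ¬ (l : ℤ) ^ (s + 1) ∣ (q : ℤ) - 1 := by
    intro h
    apply hn
    rw [← Int.natCast_dvd_natCast, Nat.cast_sub hq]; exact_mod_cast h
  have hm' : (l : ℤ) ^ (s + d) ∣ (q : ℤ) ^ m - 1 ^ m := by
    have := Int.natCast_dvd_natCast.2 hm
    rw [Nat.cast_sub (Nat.one_le_pow _ _ hq)] at this
    rw [one_pow]; exact_mod_cast this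
  have he : emultiplicity (l : ℤ) ((q : ℤ) - 1) = s := emultiplicity_eq_coe.2 ⟨h1', hn'⟩
  have hl1 : (l : ℤ) ∣ (q : ℤ) - 1 := (dvd_pow_self _ hs.ne').trans h1'
  have hlq : ¬ (l : ℤ) ∣ q := by
    intro h
    have h3 : (l : ℤ) ∣ 1 := by
      have := dvd_sub h hl1
      simpa using this
    have := Int.natAbs_dvd_natAbs.2 h3
    simp at this
    exact hl.one_lt.ne' this
  have key : emultiplicity (l : ℤ) ((q : ℤ) ^ m - 1 ^ m) = emultiplicity (l : ℤ) ((q : ℤ) - 1) + emultiplicity (l : ℤ) (m : ℤ) := by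
    rcases hl.eq_two_or_odd' with rfl | hodd
    · have h4 : (4 : ℤ) ∣ (q : ℤ) - 1 := by
        refine dvd_trans ?_ h1'
        have := pow_dvd_pow (2 : ℤ) (h2 rfl)
        simpa using this
      exact Int.two_pow_sub_pow' m h4 (by exact_mod_cast hlq)
    · rw [Int.emultiplicity_pow_sub_pow hl hodd hl1 hlq m]
      congr 1
      exact (Int.natCast_emultiplicity l m).symm
  have h5 := le_emultiplicity_of_pow_dvd hm'
  rw [key, he] at h5
  have h6 : (d : ℕ∞) ≤ emultiplicity (l : ℤ) (m : ℤ) := by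
    push_cast at h5
    exact (ENat.add_le_add_iff_left (ENat.coe_ne_top s)).1 h5
  have h7 := pow_dvd_of_le_emultiplicity h6
  exact_mod_cast h7

end PlB
end

section
set_option linter.unusedSectionVars false
set_option linter.style.haveILetI false
set_option linter.unusedSimpArgs false

open WithZero

namespace PlB

/-- cyclic cyclotomic data -/
structure Cyc {F Ψ : Type} [Field F] [Field Ψ] [Algebra F Ψ] (σ : Ψ ≃ₐ[F] Ψ) (l s d a : ℕ) (C' : Ψ) : Prop where
  hl : l.Prime
  hs : 0 < s
  gen : ∀ g : Ψ ≃ₐ[F] Ψ, ∃ i : ℕ, g = σ ^ i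
  prim : IsPrimitiveRoot C' (l ^ (s + d))
  faith : ∀ g : Ψ ≃ₐ[F] Ψ, g C' = C' → g = 1
  act : σ C' = C' ^ a

theorem exists_frob' {κ k : Type} [Field κ] [Field k] [Finite k] {w : Place κ k} {R : Type} [Field R] [Algebra κ R]
    (Λ2 : Level w R) : ∃ z : Λ2.Z, (∀ x, Λ2.π z x = x ^ Nat.card k) := by
  haveI := Fintype.ofFinite k
  haveI : Finite Λ2.R := Module.finite_of_finite k
  obtain ⟨z, hz⟩ := Λ2.πs (FiniteField.frobeniusAlgEquivOfAlgebraic k Λ2.R)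
  refine ⟨z, fun x => ?_⟩
  rw [hz]; simp [Nat.card_eq_fintype_card]

namespace Cyc
variable {F Ψ : Type} [Field F] [Field Ψ] [Algebra F Ψ] {σ : Ψ ≃ₐ[F] Ψ} {l s d a : ℕ} {C' : Ψ}
  {κ k : Type} [Field κ] [Field k]

theorem exists_chain (h : Cyc σ l s d a C') [FiniteDimensional F Ψ] [IsGalois F Ψ] (v : Place F κ) (w : Place κ k)
    (lκ : (l : κ) ≠ 0) (lk : (l : k) ≠ 0) :
    ∃ Λ : Level v Ψ, ∃ Λ2 : Level w Λ.R, IsGalois κ Λ.R ∧ Λ.e = 1 ∧ Λ2.e = 1 := by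
  have hN := cast_pow_ne lκ (s + d)
  have hN2 := cast_pow_ne lk (s + d)
  obtain ⟨Λ⟩ := (v.exists_level0 Ψ).2 inferInstance
  have hJ : Λ.J = ⊥ := by
    rw [eq_bot_iff]
    intro g hg
    rw [Subgroup.mem_bot]
    apply Subtype.ext
    apply h.faith
    have := Λ.lift_root hN h.prim g 1 (by rw [(MonoidHom.mem_ker).1 hg]; simp)
    simpa using this
  obtain ⟨hG, he⟩ := Λ.galois_of_bot hJ
  obtain ⟨Λ2⟩ := (w.exists_level0 Λ.R).2 hG
  have hJ2 : Λ2.J = ⊥ := by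
    rw [eq_bot_iff]
    intro u hu
    rw [Subgroup.mem_bot]
    obtain ⟨g, hg⟩ := Λ.πs u.1
    have h1 := Λ2.lift_root hN2 (Λ.primR hN h.prim) u 1 (by rw [(MonoidHom.mem_ker).1 hu]; simp)
    rw [← hg] at h1
    have h2 := Λ.lift_root hN h.prim g 1 h1
    rw [pow_one] at h2
    have : g = 1 := Subtype.ext (h.faith _ h2)
    apply Subtype.ext
    rw [← hg, this, map_one]; rfl
  exact ⟨Λ, Λ2, hG, he, (Λ2.galois_of_bot hJ2).2⟩

theorem frob (h : Cyc σ l s d a C') [FiniteDimensional F Ψ] [IsGalois F Ψ] [Finite k] (v : Place F κ) (w : Place κ k)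
    (lκ : (l : κ) ≠ 0) (lk : (l : k) ≠ 0) : ∃ g : Ψ ≃ₐ[F] Ψ, g C' = C' ^ Nat.card k := by
  have hN := cast_pow_ne lκ (s + d)
  have hN2 := cast_pow_ne lk (s + d)
  obtain ⟨Λ, Λ2, -⟩ := h.exists_chain v w lκ lk
  obtain ⟨z, hz⟩ := exists_frob' Λ2
  obtain ⟨g, hg⟩ := Λ.πs z.1
  refine ⟨g.1, Λ.lift_root hN h.prim g _ ?_⟩
  rw [hg]
  exact Λ2.lift_root hN2 (Λ.primR hN h.prim) z _ (hz _)

theorem actp (h : Cyc σ l s d a C') (i : ℕ) : (σ ^ i) C' = C' ^ (a ^ i) := by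
  induction i with
  | zero => simp
  | succ i ih => rw [pow_succ', AlgEquiv.mul_apply, ih, map_pow, h.act, ← pow_mul, pow_succ a, mul_comm]

theorem actC (h : Cyc σ l s d a C') (i : ℕ) : (σ ^ i) (C' ^ (l ^ d)) = (C' ^ (l ^ d)) ^ (a ^ i) := by
  rw [map_pow, h.actp, ← pow_mul, ← pow_mul, mul_comm]

theorem primC (h : Cyc σ l s d a C') : IsPrimitiveRoot (C' ^ (l ^ d)) (l ^ s) :=
  h.prim.pow (pow_pos h.hl.pos _) (by rw [pow_add, mul_comm])

/-- degree of `C` -/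
noncomputable def ns (_ : Cyc σ l s d a C') : ℕ := Function.minimalPeriod σ (C' ^ (l ^ d))

theorem iter (_ : Cyc σ l s d a C') (i : ℕ) (x : Ψ) : (σ^[i]) x = (σ ^ i) x := by
  induction i with
  | zero => simp
  | succ i ih => rw [Function.iterate_succ_apply', ih, pow_succ', AlgEquiv.mul_apply]

theorem fixC (h : Cyc σ l s d a C') (i : ℕ) : (σ ^ i) (C' ^ (l ^ d)) = C' ^ (l ^ d) ↔ h.ns ∣ i := by
  rw [← h.iter]
  exact Function.isPeriodicPt_iff_minimalPeriod_dvd (f := σ) (x := C' ^ (l ^ d)) (n := i)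

theorem ord_pos (_ : Cyc σ l s d a C') [FiniteDimensional F Ψ] : 0 < orderOf σ := orderOf_pos σ

theorem ns_pos (h : Cyc σ l s d a C') [FiniteDimensional F Ψ] : 0 < h.ns :=
  Nat.pos_of_dvd_of_pos ((h.fixC (orderOf σ)).1 (by rw [pow_orderOf_eq_one]; simp)) h.ord_pos

theorem pow_root {x : Ψ} {N : ℕ} (h : IsPrimitiveRoot x N) {u : ℕ} (hx : x ^ u = x) (hN : 0 < N) :
    (N : ℤ) ∣ (u : ℤ) - 1 := by
  have h0 : x ≠ 0 := h.ne_zero hN.ne'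
  rw [← h.zpow_eq_one_iff_dvd, zpow_sub₀ h0, zpow_natCast, hx, zpow_one, div_self h0]

theorem root_pow {x : Ψ} {N : ℕ} (h : IsPrimitiveRoot x N) {u : ℕ} (hN : 0 < N) (hu : (N : ℤ) ∣ (u : ℤ) - 1) :
    x ^ u = x := by
  have h0 : x ≠ 0 := h.ne_zero hN.ne'
  have := (h.zpow_eq_one_iff_dvd _).2 hu
  rw [zpow_sub₀ h0, zpow_natCast, zpow_one, div_eq_one_iff_eq h0] at this
  exact this

/-- `A0 ^ ns ≡ 1` -/
theorem A0_ns (h : Cyc σ l s d a C') : ((l ^ (s + d) : ℕ) : ℤ) ∣ (((a ^ l ^ d) ^ h.ns : ℕ) : ℤ) - 1 := by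
  have h1 := (h.fixC h.ns).2 dvd_rfl
  rw [h.actC] at h1
  have h2 := pow_root h.primC h1 (pow_pos h.hl.pos _)
  have h3 := pow_cong (l := l) h.hs (u := ((a ^ h.ns : ℕ) : ℤ)) (by exact_mod_cast h2) d
  rw [← pow_mul, mul_comm, pow_mul]
  exact_mod_cast h3

theorem order_eq (h : Cyc σ l s d a C') [FiniteDimensional F Ψ] [IsGalois F Ψ] [Finite k] (v : Place F κ) (w : Place κ k)
    (lκ : (l : κ) ≠ 0) (lk : (l : k) ≠ 0) (h2 : l = 2 → 2 ≤ s) (h1 : l ^ s ∣ Nat.card k - 1)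
    (hn : ¬ l ^ (s + 1) ∣ Nat.card k - 1) : orderOf σ = h.ns * l ^ d := by
  have hq : 0 < Nat.card k := Nat.card_pos
  apply Nat.dvd_antisymm
  · apply orderOf_dvd_of_pow_eq_one
    apply h.faith
    rw [h.actp]
    apply root_pow h.prim (pow_pos h.hl.pos _)
    have := h.A0_ns
    rwa [← pow_mul, mul_comm] at this
  · obtain ⟨g, hg⟩ := h.frob v w lκ lk
    obtain ⟨i, rfl⟩ := h.gen g
    have hi : h.ns ∣ i := by
      rw [← h.fixC, map_pow, hg, ← pow_mul, mul_comm, pow_mul]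
      apply root_pow h.primC (pow_pos h.hl.pos _)
      have := Int.natCast_dvd_natCast.2 h1
      rwa [Nat.cast_sub hq] at this
    obtain ⟨j, rfl⟩ := hi
    have hd : l ^ d ∣ orderOf (σ ^ (h.ns * j)) := by
      apply hord_of h.hl h.hs h2 hq h1 hn
      have hp : ∀ m : ℕ, ((σ ^ (h.ns * j)) ^ m) C' = C' ^ (Nat.card k ^ m) := by
        intro m
        induction m with
        | zero => simp
        | succ m ih => rw [pow_succ', AlgEquiv.mul_apply, ih, map_pow, hg, ← pow_mul, pow_succ (Nat.card k), mul_comm]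
      have h3 := hp (orderOf (σ ^ (h.ns * j)))
      rw [pow_orderOf_eq_one] at h3
      have h4 := pow_root h.prim h3.symm (pow_pos h.hl.pos _)
      rw [← Int.natCast_dvd_natCast, Nat.cast_sub (Nat.one_le_pow _ _ hq)]
      exact_mod_cast h4
    have hns : h.ns ∣ orderOf σ := (h.fixC (orderOf σ)).1 (by rw [pow_orderOf_eq_one]; simp)
    have h5 : orderOf (σ ^ (h.ns * j)) ∣ orderOf (σ ^ h.ns) := by
      rw [pow_mul]; exact orderOf_pow_dvd j
    rw [orderOf_pow_of_dvd h.ns_pos.ne' hns] at h5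
    obtain ⟨c, hc⟩ := hns
    rw [hc, Nat.mul_div_cancel_left _ h.ns_pos] at h5
    rw [hc]
    exact mul_dvd_mul_left _ (hd.trans h5)

theorem a_coprime (h : Cyc σ l s d a C') : ¬ l ∣ a := by
  rintro ⟨b, rfl⟩
  have h1 : σ (C' ^ (l ^ (s + d - 1))) = 1 := by
    rw [map_pow, h.act, ← pow_mul, mul_right_comm, ← pow_succ', Nat.sub_add_cancel (by have := h.hs; omega), pow_mul,
      h.prim.pow_eq_one, one_pow]
  have h2 : C' ^ (l ^ (s + d - 1)) = 1 := σ.injective (by rw [h1, map_one])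
  have h3 := (h.prim.pow_eq_one_iff_dvd _).1 h2
  have := (Nat.pow_dvd_pow_iff_le_right h.hl.one_lt).1 h3
  have := h.hs
  omega

end Cyc
end PlB
end

section
set_option linter.unusedSectionVars false
set_option linter.style.haveILetI false
set_option linter.unusedSimpArgs false

open WithZero

namespace PlB

/-- congruence data: integral elements `O` and an ideal `I` -/
structure Cg (Ψ : Type) [Field Ψ] where
  O : Subring Ψ
  I : AddSubgroup Ψ
  le : ∀ {z}, z ∈ I → z ∈ O
  mul : ∀ {z u}, z ∈ O → u ∈ I → z * u ∈ I

namespace Cg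
variable {Ψ : Type} [Field Ψ] (G : Cg Ψ)

/-- congruence of integral elements -/
def E (z u : Ψ) : Prop := z ∈ G.O ∧ u ∈ G.O ∧ z - u ∈ G.I

variable {G}

theorem E.refl {z : Ψ} (h : z ∈ G.O) : G.E z z := ⟨h, h, by rw [sub_self]; exact G.I.zero_mem⟩

theorem E.add {z u z' u' : Ψ} (h : G.E z u) (h' : G.E z' u') : G.E (z + z') (u + u') :=
  ⟨G.O.add_mem h.1 h'.1, G.O.add_mem h.2.1 h'.2.1, by
    rw [add_sub_add_comm]; exact G.I.add_mem h.2.2 h'.2.2⟩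

theorem E.sub {z u z' u' : Ψ} (h : G.E z u) (h' : G.E z' u') : G.E (z - z') (u - u') :=
  ⟨G.O.sub_mem h.1 h'.1, G.O.sub_mem h.2.1 h'.2.1, by
    rw [sub_sub_sub_comm]; exact G.I.sub_mem h.2.2 h'.2.2⟩

theorem E.mul {z u z' u' : Ψ} (h : G.E z u) (h' : G.E z' u') : G.E (z * z') (u * u') :=
  ⟨G.O.mul_mem h.1 h'.1, G.O.mul_mem h.2.1 h'.2.1, by
    have : z * z' - u * u' = z * (z' - u') + u' * (z - u) := by ring
    rw [this]; exact G.I.add_mem (G.mul h.1 h'.2.2) (G.mul h'.2.1 h.2.2)⟩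

theorem E.pow {z u : Ψ} (h : G.E z u) (n : ℕ) : G.E (z ^ n) (u ^ n) := by
  induction n with
  | zero => simpa using E.refl G.O.one_mem
  | succ n ih => rw [pow_succ, pow_succ]; exact ih.mul h

theorem E.prod {ι : Type*} {s : Finset ι} {f g : ι → Ψ} (h : ∀ i ∈ s, G.E (f i) (g i)) :
    G.E (∏ i ∈ s, f i) (∏ i ∈ s, g i) := by
  classical
  induction s using Finset.induction_on with
  | empty => simpa using E.refl G.O.one_mem
  | insert a s ha ih =>
    rw [Finset.prod_insert ha, Finset.prod_insert ha]
    exact (h _ (Finset.mem_insert_self _ _)).mul (ih fun i hi => h i (Finset.mem_insert_of_mem hi))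

end Cg

section defs
variable {F Ψ : Type} [Field F] [Field Ψ] [Algebra F Ψ] (σ : Ψ ≃ₐ[F] Ψ) (C : Ψ) (N A δ : ℕ) (x μ θ : F)

noncomputable def eps : Ψ := ∏ i ∈ Finset.Ico 1 N, (algebraMap F Ψ x - (σ ^ i) C) / (C - (σ ^ i) C)
noncomputable def bb : Ψ := 1 + (algebraMap F Ψ μ - 1) * eps σ C N x
noncomputable def yy : Ψ := ∏ i ∈ Finset.range N, ((σ ^ (N - i)) (bb σ C N x μ)) ^ (A ^ i)
noncomputable def tt : Ψ := (algebraMap F Ψ θ * eps σ C N x) ^ δ * yy σ C N A x μ - C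
noncomputable def ff : Ψ := ∏ j ∈ Finset.range N, (σ ^ j) (tt σ C N A δ x μ θ)

theorem spow (i j : ℕ) (z : Ψ) : (σ ^ i) ((σ ^ j) z) = (σ ^ (i + j)) z := by
  rw [pow_add, AlgEquiv.mul_apply]

theorem eps_map (j : ℕ) : (σ ^ j) (eps σ C N x) =
    ∏ i ∈ Finset.Ico 1 N, (algebraMap F Ψ x - (σ ^ (j + i)) C) / ((σ ^ j) C - (σ ^ (j + i)) C) := by
  rw [eps, map_prod]
  refine Finset.prod_congr rfl fun i _ => ?_
  rw [map_div₀, map_sub, map_sub, AlgEquiv.commutes, spow]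

end defs

namespace Cyc
variable {F Ψ : Type} [Field F] [Field Ψ] [Algebra F Ψ] {σ : Ψ ≃ₐ[F] Ψ} {l s d a : ℕ} {C' : Ψ}

/-- the base root of unity -/
def C (_ : Cyc σ l s d a C') : Ψ := C' ^ (l ^ d)

theorem cj_eq (h : Cyc σ l s d a C') (i j : ℕ) : (σ ^ i) h.C = (σ ^ j) h.C ↔ i ≡ j [MOD h.ns] := by
  wlog hij : i ≤ j generalizing i j
  · rw [eq_comm, this j i (le_of_not_ge hij)]; exact ⟨Nat.ModEq.symm, Nat.ModEq.symm⟩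
  obtain ⟨m, rfl⟩ := Nat.exists_eq_add_of_le hij
  rw [← spow, (σ ^ i).injective.eq_iff, eq_comm, Cyc.C, h.fixC, Nat.modEq_iff_dvd' hij, Nat.add_sub_cancel_left]

variable {G : Cg Ψ} {x μ θ : F} {i0 : ℕ}

/-- hypotheses of the core congruence computation -/
structure Loc (h : Cyc σ l s d a C') (G : Cg Ψ) (x μ : F) (i0 : ℕ) : Prop where
  hC : ∀ j, (σ ^ j) h.C ∈ G.O
  hinv : ∀ i j, (σ ^ i) h.C ≠ (σ ^ j) h.C → ((σ ^ i) h.C - (σ ^ j) h.C)⁻¹ ∈ G.O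
  hx : G.E (algebraMap F Ψ x) ((σ ^ i0) h.C)
  hμ : algebraMap F Ψ μ ∈ G.O

open Classical in
theorem Loc.eps {h : Cyc σ l s d a C'} [FiniteDimensional F Ψ] (H : h.Loc G x μ i0) (j : ℕ) :
    G.E ((σ ^ j) (eps σ h.C h.ns x)) (if j ≡ i0 [MOD h.ns] then 1 else 0) := by
  have key : ∀ i ∈ Finset.Ico 1 h.ns, (σ ^ j) h.C ≠ (σ ^ (j + i)) h.C := by
    intro i hi hc
    rw [Finset.mem_Ico] at hi
    rw [h.cj_eq, Nat.modEq_iff_dvd' (by omega), Nat.add_sub_cancel_left] at hc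
    exact absurd (Nat.le_of_dvd (by omega) hc) (by omega)
  have h1 : G.E ((σ ^ j) (PlB.eps σ h.C h.ns x)) (∏ i ∈ Finset.Ico 1 h.ns,
      ((σ ^ i0) h.C - (σ ^ (j + i)) h.C) / ((σ ^ j) h.C - (σ ^ (j + i)) h.C)) := by
    rw [eps_map]
    refine Cg.E.prod fun i hi => ?_
    rw [div_eq_mul_inv, div_eq_mul_inv]
    exact (H.hx.sub (Cg.E.refl (H.hC _))).mul (Cg.E.refl (H.hinv _ _ (key i hi)))
  convert h1 using 1
  split_ifs with hj
  · symm
    apply Finset.prod_eq_one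
    intro i hi
    rw [(h.cj_eq i0 j).2 hj.symm, div_self (sub_ne_zero.2 (key i hi))]
  · have hn := h.ns_pos
    have hm : j + (i0 + (h.ns - 1) * j) % h.ns ≡ i0 [MOD h.ns] := by
      have e1 : j + (i0 + (h.ns - 1) * j) = i0 + h.ns * j := by
        obtain ⟨m, hm⟩ := Nat.exists_eq_succ_of_ne_zero hn.ne'
        rw [hm]; simp; ring
      calc j + (i0 + (h.ns - 1) * j) % h.ns ≡ j + (i0 + (h.ns - 1) * j) [MOD h.ns] :=
            Nat.ModEq.add_left _ (Nat.mod_modEq _ _)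
        _ ≡ i0 [MOD h.ns] := by rw [e1]; simp [Nat.ModEq]
    symm
    refine Finset.prod_eq_zero (i := (i0 + (h.ns - 1) * j) % h.ns) ?_ ?_
    · rw [Finset.mem_Ico]
      refine ⟨?_, Nat.mod_lt _ hn⟩
      rw [Nat.one_le_iff_ne_zero]
      intro h0
      rw [h0] at hm
      exact hj hm
    · rw [(h.cj_eq _ _).2 hm, sub_self, zero_div]

open Classical in
theorem Loc.bb {h : Cyc σ l s d a C'} [FiniteDimensional F Ψ] (H : h.Loc G x μ i0) (j : ℕ) :
    G.E ((σ ^ j) (bb σ h.C h.ns x μ)) (if j ≡ i0 [MOD h.ns] then algebraMap F Ψ μ else 1) := by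
  have h1 := (Cg.E.refl G.O.one_mem).add ((((Cg.E.refl H.hμ).sub (Cg.E.refl G.O.one_mem))).mul (H.eps j))
  rw [PlB.bb, map_add, map_one, map_mul, map_sub, map_one, AlgEquiv.commutes]
  convert h1 using 1
  split_ifs <;> simp

theorem yy_map (h : Cyc σ l s d a C') (A j : ℕ) : (σ ^ j) (yy σ h.C h.ns A x μ) =
    ∏ i ∈ Finset.range h.ns, ((σ ^ (j + (h.ns - i))) (PlB.bb σ h.C h.ns x μ)) ^ (A ^ i) := by
  rw [PlB.yy, map_prod]
  refine Finset.prod_congr rfl fun i _ => ?_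
  rw [map_pow, spow]

theorem Loc.yyO {h : Cyc σ l s d a C'} [FiniteDimensional F Ψ] (H : h.Loc G x μ i0) (A j : ℕ) :
    (σ ^ j) (yy σ h.C h.ns A x μ) ∈ G.O := by
  rw [h.yy_map]
  exact G.O.prod_mem fun i _ => G.O.pow_mem (H.bb _).1 _

theorem Loc.yy0 {h : Cyc σ l s d a C'} [FiniteDimensional F Ψ] (H : h.Loc G x μ i0) (A j : ℕ) (hj : j ≡ i0 [MOD h.ns]) :
    G.E ((σ ^ j) (yy σ h.C h.ns A x μ)) (algebraMap F Ψ μ) := by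
  have h1 : G.E ((σ ^ j) (yy σ h.C h.ns A x μ)) (∏ i ∈ Finset.range h.ns, if i = 0 then algebraMap F Ψ μ else 1) := by
    rw [h.yy_map]
    refine Cg.E.prod fun i hi => ?_
    rw [Finset.mem_range] at hi
    have h2 := (H.bb (j + (h.ns - i))).pow (A ^ i)
    convert h2 using 1
    by_cases h0 : i = 0
    · subst h0
      have : j + (h.ns - 0) ≡ i0 [MOD h.ns] := by simpa using hj
      rw [if_pos rfl, if_pos this]; simp
    · rw [if_neg h0, if_neg, one_pow]
      intro hc
      have h3 := hc.trans hj.symm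
      rw [Nat.ModEq.comm, Nat.modEq_iff_dvd' (by omega), Nat.add_sub_cancel_left] at h3
      exact absurd (Nat.le_of_dvd (by omega) h3) (by omega)
  rwa [Finset.prod_ite_eq' , if_pos (Finset.mem_range.2 h.ns_pos)] at h1

open Classical in
theorem Loc.tt {h : Cyc σ l s d a C'} [FiniteDimensional F Ψ] (H : h.Loc G x μ i0) (hθ : algebraMap F Ψ θ ∈ G.O)
    (A j : ℕ) {δ : ℕ} (hδ : δ ≠ 0) :
    G.E ((σ ^ j) (tt σ h.C h.ns A δ x μ θ))
      (if j ≡ i0 [MOD h.ns] then algebraMap F Ψ θ ^ δ * algebraMap F Ψ μ - (σ ^ j) h.C else - (σ ^ j) h.C) := by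
  rw [PlB.tt, map_sub, map_mul, map_pow, map_mul, AlgEquiv.commutes]
  split_ifs with hj
  · have h1 := H.eps j
    rw [if_pos hj] at h1
    have := ((((Cg.E.refl hθ).mul h1).pow δ).mul (H.yy0 A j hj)).sub (Cg.E.refl (H.hC j))
    rwa [mul_one] at this
  · have h1 := H.eps j
    rw [if_neg hj] at h1
    have := ((((Cg.E.refl hθ).mul h1).pow δ).mul (Cg.E.refl (H.yyO A j))).sub (Cg.E.refl (H.hC j))
    rwa [mul_zero, zero_pow hδ, zero_mul, zero_sub] at this

end Cyc
end PlB
end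

section
set_option linter.unusedSectionVars false
set_option linter.style.haveILetI false
set_option linter.unusedSimpArgs false

open WithZero

namespace PlB

namespace Cg
variable {Ψ : Type} [Field Ψ] {G : Cg Ψ}

theorem E.symm {z u : Ψ} (h : G.E z u) : G.E u z :=
  ⟨h.2.1, h.1, by rw [← neg_sub]; exact G.I.neg_mem h.2.2⟩

theorem E.trans {z u t : Ψ} (h : G.E z u) (h' : G.E u t) : G.E z t :=
  ⟨h.1, h'.2.1, by rw [← sub_add_sub_cancel]; exact G.I.add_mem h.2.2 h'.2.2⟩

end Cg

theorem Place.root_sub {K k : Type} [Field K] [Field k] (p : Place K k) {C : K} {N : ℕ}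
    (hN : (N : k) ≠ 0) (h : IsPrimitiveRoot C N) {x y : K} (hx : x ^ N = 1) (hy : y ^ N = 1) (hxy : x ≠ y) :
    p.v (x - y) = 1 := by
  have hN0 : N ≠ 0 := by rintro rfl; simp at hN
  have h1 := p.v_root hN0 hx
  have h2 := p.v_root hN0 hy
  by_contra h3
  exact hxy (p.root_inj hN h hx hy ((p.r_eq_iff h1.le h2.le).2 (lt_of_le_of_ne (p.v_sub_le h1.le h2.le) h3)))

section chain
variable {F Ψ κ k T' R R2 : Type} [Field F] [Field Ψ] [Field κ] [Field k] [Field T'] [Field R] [Field R2]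
  [Algebra F Ψ] [Algebra F T'] [Algebra κ R] [Algebra k R2]

/-- congruences at a chain of places -/
def chCg (ι : Ψ →ₐ[F] T') (q : Place T' R) (W : Place R R2) (N : ℤᵐ⁰) (hN : N ≤ 1) : Cg Ψ where
  O :=
    { carrier := {z | q.v (ι z) ≤ 1 ∧ W.v (q.r (ι z)) ≤ 1}
      mul_mem' := fun {a b} ha hb => by
        refine ⟨by rw [map_mul]; exact q.v_mul_le ha.1 hb.1, ?_⟩
        rw [map_mul, q.r_mul ha.1 hb.1]; exact W.v_mul_le ha.2 hb.2
      one_mem' := by simp [q.r_one]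
      add_mem' := fun {a b} ha hb => by
        refine ⟨by rw [map_add]; exact q.v_add_le ha.1 hb.1, ?_⟩
        rw [map_add, q.r_add ha.1 hb.1]; exact W.v_add_le ha.2 hb.2
      zero_mem' := by simp [q.r_zero]
      neg_mem' := fun {a} ha => by
        refine ⟨by rw [map_neg, Valuation.map_neg]; exact ha.1, ?_⟩
        rw [map_neg, q.r_neg ha.1, Valuation.map_neg]; exact ha.2 }
  I :=
    { carrier := {z | q.v (ι z) ≤ 1 ∧ W.v (q.r (ι z)) ≤ N}
      add_mem' := fun {a b} ha hb => by
        refine ⟨by rw [map_add]; exact q.v_add_le ha.1 hb.1, ?_⟩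
        rw [map_add, q.r_add ha.1 hb.1]; exact (W.v.map_add _ _).trans (max_le ha.2 hb.2)
      zero_mem' := by simp [q.r_zero]
      neg_mem' := fun {a} ha => by
        refine ⟨by rw [map_neg, Valuation.map_neg]; exact ha.1, ?_⟩
        rw [map_neg, q.r_neg ha.1, Valuation.map_neg]; exact ha.2 }
  le := fun {z} hz => ⟨hz.1, hz.2.trans hN⟩
  mul := fun {z u} hz hu => by
    refine ⟨by rw [map_mul]; exact q.v_mul_le hz.1 hu.1, ?_⟩
    rw [map_mul, q.r_mul hz.1 hu.1, map_mul]; exact (mul_le_mul' hz.2 hu.2).trans (one_mul _).le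

/-- trivial congruences: integrality at a place -/
def trCg (ι : Ψ →ₐ[F] T') (q : Place T' R) : Cg Ψ where
  O :=
    { carrier := {z | q.v (ι z) ≤ 1}
      mul_mem' := fun {a b} ha hb => by
        change q.v (ι _) ≤ 1; rw [map_mul]; exact q.v_mul_le ha hb
      one_mem' := by simp
      add_mem' := fun {a b} ha hb => by
        change q.v (ι _) ≤ 1; rw [map_add]; exact q.v_add_le ha hb
      zero_mem' := by simp
      neg_mem' := fun {a} ha => by
        change q.v (ι _) ≤ 1; rw [map_neg, Valuation.map_neg]; exact ha }
  I :=
    { carrier := {z | q.v (ι z) ≤ 1}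
      add_mem' := fun {a b} ha hb => by
        change q.v (ι _) ≤ 1; rw [map_add]; exact q.v_add_le ha hb
      zero_mem' := by simp
      neg_mem' := fun {a} ha => by
        change q.v (ι _) ≤ 1; rw [map_neg, Valuation.map_neg]; exact ha }
  le := fun {z} hz => hz
  mul := fun {z u} hz hu => by
    change q.v (ι _) ≤ 1; rw [map_mul]; exact q.v_mul_le hz hu

theorem chCg_val {ι : Ψ →ₐ[F] T'} {q : Place T' R} {W : Place R R2} {N : ℤᵐ⁰} {hN : N ≤ 1} {z u : Ψ}
    (h : (chCg ι q W N hN).E z u) (hu : N < W.v (q.r (ι u))) : W.v (q.r (ι z)) = W.v (q.r (ι u)) := by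
  obtain ⟨h1, h2, h3⟩ := h
  have h4 : q.r (ι z) = q.r (ι (z - u)) + q.r (ι u) := by
    rw [← q.r_add h3.1 h2.1, ← map_add, sub_add_cancel]
  rw [h4]
  exact Valuation.map_add_eq_of_lt_right _ (lt_of_le_of_lt h3.2 hu)

namespace Cyc
variable {σ : Ψ ≃ₐ[F] Ψ} {l s d a : ℕ} {C' : Ψ} {v : Place F κ} {w : Place κ k} {x μ θ : F}

/-- good `x` at `w` -/
structure Xd (h : Cyc σ l s d a C') (v : Place F κ) (w : Place κ k) (x : F) : Prop where
  vx : v.v x ≤ 1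
  root : w.v ((v.r x) ^ (l ^ s) - 1) ≤ exp (-2 : ℤ)
  g : ∃ g : F, algebraMap F Ψ g = ∏ i ∈ Finset.range h.ns, (algebraMap F Ψ x - (σ ^ i) h.C) ∧ v.v g ≤ 1 ∧ w.v (v.r g) < 1

theorem cj_root (h : Cyc σ l s d a C') (i : ℕ) : ((σ ^ i) h.C) ^ (l ^ s) = 1 := by
  rw [← map_pow, Cyc.C, h.primC.pow_eq_one, map_one]

theorem Xd.vx1 {h : Cyc σ l s d a C'} (X : h.Xd v w x) : w.v (v.r x) = 1 := by
  have h1 : w.v ((v.r x) ^ (l ^ s) - 1) < 1 := lt_of_le_of_lt X.root (by rw [← exp_zero]; exact exp_lt_exp.2 (by norm_num))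
  have h2 : w.v ((v.r x) ^ (l ^ s)) = 1 := by
    have := Valuation.map_add_eq_of_lt_right w.v (x := (v.r x) ^ (l ^ s) - 1) (y := 1) (by rwa [map_one])
    rwa [sub_add_cancel, map_one] at this
  rw [map_pow] at h2
  have hp : l ^ s ≠ 0 := (pow_pos h.hl.pos _).ne'
  refine le_antisymm ?_ ?_
  · exact (pow_le_one_iff hp).1 h2.le
  · exact (one_le_pow_iff hp).1 h2.ge

theorem v_cj (h : Cyc σ l s d a C') (ι : Ψ →ₐ[F] T') (q : Place T' R) (i : ℕ) : q.v (ι ((σ ^ i) h.C)) = 1 :=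
  q.v_root (pow_pos h.hl.pos s).ne' (by rw [← map_pow, h.cj_root, map_one])

theorem rr_cj (h : Cyc σ l s d a C') (ι : Ψ →ₐ[F] T') (q : Place T' R) (i : ℕ) : (q.r (ι ((σ ^ i) h.C))) ^ (l ^ s) = 1 := by
  rw [← q.r_pow (h.v_cj ι q i).le, ← map_pow, h.cj_root, map_one, q.r_one]

theorem Xd.i0 {h : Cyc σ l s d a C'} (X : h.Xd v w x) (lκ : (l : κ) ≠ 0) (lk : (l : k) ≠ 0)
    (ι : Ψ →ₐ[F] T') {q : Place T' R} {W : Place R R2} {e e' : ℕ} (hq : Over v q e) (hW : Over w W e') :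
    ∃ i0, W.v (q.r (ι (algebraMap F Ψ x)) - q.r (ι ((σ ^ i0) h.C))) ≤ exp (-2 : ℤ) ^ e' := by
  classical
  have hX : q.r (ι (algebraMap F Ψ x)) = algebraMap κ R (v.r x) := by rw [AlgHom.commutes, hq.r _ X.vx]
  have hXv : q.v (ι (algebraMap F Ψ x)) ≤ 1 := by rw [AlgHom.commutes, hq.v_le]; exact X.vx
  have hNR : ((l ^ s : ℕ) : R) ≠ 0 := by
    rw [← map_natCast (algebraMap κ R)]; exact (map_ne_zero _).2 (cast_pow_ne lκ s)
  have hNR2 : ((l ^ s : ℕ) : R2) ≠ 0 := by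
    rw [← map_natCast (algebraMap k R2)]; exact (map_ne_zero _).2 (cast_pow_ne lk s)
  have hprimR : IsPrimitiveRoot (q.r (ι h.C)) (l ^ s) := by
    haveI : NeZero ((l ^ s : ℕ) : R) := ⟨hNR⟩
    exact q.prim_root (h.primC.map_of_injective ι.injective)
  have hξ : W.v (algebraMap κ R (v.r x)) ≤ 1 := by rw [hW.v_le]; exact X.vx1.le
  obtain ⟨g, hg, hgv, hgw⟩ := X.g
  have h1 : algebraMap κ R (v.r g) = ∏ i ∈ Finset.range h.ns, (algebraMap κ R (v.r x) - q.r (ι ((σ ^ i) h.C))) := by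
    rw [← hq.r _ hgv, ← ι.commutes, hg, map_prod, q.r_prod]
    · refine Finset.prod_congr rfl fun i _ => ?_
      rw [map_sub, q.r_sub hXv (h.v_cj ι q i).le, hX]
    · intro i _
      rw [map_sub]; exact q.v_sub_le hXv (h.v_cj ι q i).le
  have h2 : ∃ i0, W.v (algebraMap κ R (v.r x) - q.r (ι ((σ ^ i0) h.C))) < 1 := by
    by_contra hc
    push Not at hc
    have h3 : W.v (algebraMap κ R (v.r g)) < 1 := by
      rw [hW.v]; exact pow_lt_one₀ zero_le' hgw hW.epos.ne'
    rw [h1, map_prod] at h3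
    exact absurd h3 (not_lt.2 (Finset.one_le_prod' fun i _ => hc i))
  obtain ⟨i0, hi0⟩ := h2
  refine ⟨i0, ?_⟩
  rw [hX]
  set ζ0 := q.r (ι ((σ ^ i0) h.C)) with hζ0
  have hpos : 0 < l ^ s := pow_pos h.hl.pos s
  have h4 : algebraMap κ R (v.r x) ^ (l ^ s) - 1 = ∏ ζ ∈ Polynomial.nthRootsFinset (l ^ s) (1 : R), (algebraMap κ R (v.r x) - ζ) := by
    have := congrArg (Polynomial.eval (algebraMap κ R (v.r x))) (Polynomial.X_pow_sub_one_eq_prod hpos hprimR)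
    simpa [Polynomial.eval_prod] using this
  have hmem : ζ0 ∈ Polynomial.nthRootsFinset (l ^ s) (1 : R) :=
    (Polynomial.mem_nthRootsFinset hpos 1).2 (h.rr_cj ι q i0)
  have h5 : W.v (algebraMap κ R (v.r x) ^ (l ^ s) - 1) = W.v (algebraMap κ R (v.r x) - ζ0) := by
    rw [h4, ← Finset.mul_prod_erase _ _ hmem, map_mul, map_prod, Finset.prod_eq_one, mul_one]
    intro ζ hζ
    rw [Finset.mem_erase, Polynomial.mem_nthRootsFinset hpos] at hζ
    have h6 := W.root_sub hNR2 hprimR (h.rr_cj ι q i0) hζ.2 hζ.1.symm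
    rw [← sub_add_sub_cancel _ ζ0, Valuation.map_add_eq_of_lt_right _ (by rwa [h6]), h6]
  rw [← h5, ← map_pow, ← map_one (algebraMap κ R), ← map_sub, hW.v]
  exact pow_le_pow_left₀ zero_le' X.root _

theorem e2 (e' : ℕ) : exp (-2 : ℤ) ^ e' ≤ 1 := pow_le_one' (by rw [← exp_zero]; exact exp_le_exp.2 (by norm_num)) _

theorem Xd.loc {h : Cyc σ l s d a C'} (X : h.Xd v w x) (lκ : (l : κ) ≠ 0) (lk : (l : k) ≠ 0)
    (ι : Ψ →ₐ[F] T') {q : Place T' R} {W : Place R R2} {e e' : ℕ} (hq : Over v q e) (hW : Over w W e')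
    (hμ : v.v μ ≤ 1) (hμw : w.v (v.r μ) ≤ 1) :
    ∃ i0, h.Loc (chCg ι q W (exp (-2 : ℤ) ^ e') (e2 e')) x μ i0 := by
  obtain ⟨i0, hi0⟩ := X.i0 lκ lk ι hq hW
  have hNR : ((l ^ s : ℕ) : R) ≠ 0 := by
    rw [← map_natCast (algebraMap κ R)]; exact (map_ne_zero _).2 (cast_pow_ne lκ s)
  have hNR2 : ((l ^ s : ℕ) : R2) ≠ 0 := by
    rw [← map_natCast (algebraMap k R2)]; exact (map_ne_zero _).2 (cast_pow_ne lk s)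
  have hprim : IsPrimitiveRoot (ι h.C) (l ^ s) := h.primC.map_of_injective ι.injective
  have hprimR : IsPrimitiveRoot (q.r (ι h.C)) (l ^ s) := by
    haveI : NeZero ((l ^ s : ℕ) : R) := ⟨hNR⟩
    exact q.prim_root hprim
  have hXv : q.v (ι (algebraMap F Ψ x)) ≤ 1 := by rw [AlgHom.commutes, hq.v_le]; exact X.vx
  have hN0 : l ^ s ≠ 0 := (pow_pos h.hl.pos s).ne'
  have hC : ∀ j, (σ ^ j) h.C ∈ (chCg ι q W (exp (-2 : ℤ) ^ e') (e2 e')).O := fun j =>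
    ⟨(h.v_cj ι q j).le, (W.v_root hN0 (h.rr_cj ι q j)).le⟩
  refine ⟨i0, hC, fun i j hij => ?_, ⟨⟨hXv, ?_⟩, hC i0, ?_, ?_⟩, ?_, ?_⟩
  · have hne : ι ((σ ^ i) h.C) ≠ ι ((σ ^ j) h.C) := fun hc => hij (ι.injective hc)
    have h1 : q.v (ι ((σ ^ i) h.C - (σ ^ j) h.C)) = 1 := by
      rw [map_sub]
      exact q.root_sub hNR hprim (by rw [← map_pow, h.cj_root, map_one]) (by rw [← map_pow, h.cj_root, map_one]) hne
    have hv1 := (h.v_cj ι q i).le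
    have hv2 := (h.v_cj ι q j).le
    have h2 : W.v (q.r (ι ((σ ^ i) h.C - (σ ^ j) h.C))) = 1 := by
      rw [map_sub, q.r_sub hv1 hv2]
      refine W.root_sub hNR2 hprimR (h.rr_cj ι q i) (h.rr_cj ι q j) ?_
      rw [map_sub] at h1
      intro hc
      rw [q.r_eq_iff hv1 hv2, h1] at hc
      exact lt_irrefl _ hc
    refine ⟨?_, ?_⟩
    · rw [map_inv₀, map_inv₀, h1, inv_one]
    · rw [map_inv₀, q.r_inv h1, map_inv₀, h2, inv_one]
  · rw [AlgHom.commutes, hq.r _ X.vx, hW.v_le]; exact X.vx1.le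
  · rw [map_sub]; exact q.v_sub_le hXv (h.v_cj ι q i0).le
  · rw [map_sub, q.r_sub hXv (h.v_cj ι q i0).le]; exact hi0
  · rw [AlgHom.commutes, hq.v_le]; exact hμ
  · rw [AlgHom.commutes, hq.r _ hμ, hW.v_le]; exact hμw

theorem tr_loc (h : Cyc σ l s d a C') (lκ : (l : κ) ≠ 0)
    (ι : Ψ →ₐ[F] T') {q : Place T' R} {e : ℕ} (hq : Over v q e) (hx : v.v x ≤ 1) (hμ : v.v μ ≤ 1) :
    h.Loc (trCg ι q) x μ 0 := by
  have hNR : ((l ^ s : ℕ) : R) ≠ 0 := by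
    rw [← map_natCast (algebraMap κ R)]; exact (map_ne_zero _).2 (cast_pow_ne lκ s)
  have hprim : IsPrimitiveRoot (ι h.C) (l ^ s) := h.primC.map_of_injective ι.injective
  have hXv : q.v (ι (algebraMap F Ψ x)) ≤ 1 := by rw [AlgHom.commutes, hq.v_le]; exact hx
  have hC : ∀ j, (σ ^ j) h.C ∈ (trCg ι q).O := fun j => (h.v_cj ι q j).le
  refine ⟨hC, fun i j hij => ?_, ⟨hXv, hC 0, ?_⟩, ?_⟩
  · have hne : ι ((σ ^ i) h.C) ≠ ι ((σ ^ j) h.C) := fun hc => hij (ι.injective hc)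
    have h1 : q.v (ι ((σ ^ i) h.C - (σ ^ j) h.C)) = 1 := by
      rw [map_sub]
      exact q.root_sub hNR hprim (by rw [← map_pow, h.cj_root, map_one]) (by rw [← map_pow, h.cj_root, map_one]) hne
    change q.v (ι _) ≤ 1
    rw [map_inv₀, map_inv₀, h1, inv_one]
  · change q.v (ι _) ≤ 1
    rw [map_sub]; exact q.v_sub_le hXv (h.v_cj ι q 0).le
  · change q.v (ι _) ≤ 1
    rw [AlgHom.commutes, hq.v_le]; exact hμ

end Cyc
end chain
end PlB
end

section
set_option linter.unusedSectionVars false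
set_option linter.style.haveILetI false
set_option linter.unusedSimpArgs false

open WithZero

namespace PlB
namespace Cyc
variable {F Ψ κ k k1 k2 T' R R2 : Type} [Field F] [Field Ψ] [Field κ] [Field k] [Field k1] [Field k2] [Field T'] [Field R] [Field R2]
  [Algebra F Ψ] [Algebra F T'] [Algebra κ R]
variable {σ : Ψ ≃ₐ[F] Ψ} {l s d a : ℕ} {C' : Ψ} {v : Place F κ} {w1 : Place κ k1} {w2 : Place κ k2} {x μ θ : F}

/-- all the data needed for the construction -/
structure Dat (h : Cyc σ l s d a C') (v : Place F κ) (w1 : Place κ k1) (w2 : Place κ k2) (x μ θ : F) : Prop where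
  lκ : (l : κ) ≠ 0
  l1 : (l : k1) ≠ 0
  l2 : (l : k2) ≠ 0
  X1 : h.Xd v w1 x
  X2 : h.Xd v w2 x
  hμ : v.v μ ≤ 1
  μ1 : w1.v (v.r μ) = exp (-1 : ℤ)
  μ2 : w2.v (v.r μ - v.r x) ≤ exp (-2 : ℤ)
  hθ : v.v θ ≤ 1
  θ2 : w2.v ((v.r θ) ^ (l ^ d) - 1) = exp (-1 : ℤ)

theorem e21 {e' : ℕ} (h : 0 < e') : exp (-2 : ℤ) ^ e' < exp (-1 : ℤ) ^ e' :=
  pow_lt_pow_left₀ (exp_lt_exp.2 (by norm_num)) zero_le' h.ne'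

theorem e2lt {e' : ℕ} (h : 0 < e') : exp (-2 : ℤ) ^ e' < 1 :=
  pow_lt_one₀ zero_le' (by rw [← exp_zero]; exact exp_lt_exp.2 (by norm_num)) h.ne'

theorem m2lt : exp (-2 : ℤ) < (1 : ℤᵐ⁰) := by rw [← exp_zero]; exact exp_lt_exp.2 (by norm_num)
theorem m1lt : exp (-1 : ℤ) < (1 : ℤᵐ⁰) := by rw [← exp_zero]; exact exp_lt_exp.2 (by norm_num)

namespace Dat
variable {h : Cyc σ l s d a C'}

theorem μ2v (D : h.Dat v w1 w2 x μ θ) : w2.v (v.r μ) = 1 := by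
  have := Valuation.map_add_eq_of_lt_right w2.v (x := v.r μ - v.r x) (y := v.r x)
    (by rw [D.X2.vx1]; exact D.μ2.trans_lt m2lt)
  rwa [sub_add_cancel, D.X2.vx1] at this

theorem θv (D : h.Dat v w1 w2 x μ θ) : w2.v (v.r θ) = 1 := by
  have h1 : w2.v ((v.r θ) ^ (l ^ d) - 1) < 1 := by rw [D.θ2]; exact m1lt
  have h2 : w2.v ((v.r θ) ^ (l ^ d)) = 1 := by
    have := Valuation.map_add_eq_of_lt_right w2.v (x := (v.r θ) ^ (l ^ d) - 1) (y := 1) (by rwa [map_one])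
    rwa [sub_add_cancel, map_one] at this
  rw [map_pow] at h2
  have hp : l ^ d ≠ 0 := (pow_pos h.hl.pos _).ne'
  exact le_antisymm ((pow_le_one_iff hp).1 h2.le) ((one_le_pow_iff hp).1 h2.ge)

open Classical in
theorem b1 [Algebra k1 R2] [FiniteDimensional F Ψ] (D : h.Dat v w1 w2 x μ θ) (ι : Ψ →ₐ[F] T') {q : Place T' R} {W : Place R R2} {e e' : ℕ}
    (hq : Over v q e) (hW : Over w1 W e') : ∃ i0, ∀ j, q.v (ι ((σ ^ j) (bb σ h.C h.ns x μ))) = 1 ∧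
      W.v (q.r (ι ((σ ^ j) (bb σ h.C h.ns x μ)))) = if j ≡ i0 [MOD h.ns] then exp (-1 : ℤ) ^ e' else 1 := by
  obtain ⟨i0, H⟩ := D.X1.loc D.lκ D.l1 ι hq hW D.hμ (D.μ1.trans_le m1lt.le)
  refine ⟨i0, fun j => ?_⟩
  have h1 := H.bb j
  have h3 : W.v (q.r (ι (if j ≡ i0 [MOD h.ns] then algebraMap F Ψ μ else 1))) =
      if j ≡ i0 [MOD h.ns] then exp (-1 : ℤ) ^ e' else 1 := by
    split_ifs
    · rw [AlgHom.commutes, hq.r _ D.hμ, hW.v, D.μ1]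
    · rw [map_one, q.r_one, map_one]
  have h2 := chCg_val h1 (by rw [h3]; split_ifs; exacts [e21 hW.epos, e2lt hW.epos])
  rw [h3] at h2
  refine ⟨q.v_eq_one_of_r_ne h1.1.1 ?_, h2⟩
  intro h0
  rw [h0, map_zero] at h2
  split_ifs at h2
  · exact pow_ne_zero _ exp_ne_zero h2.symm
  · exact zero_ne_one h2

theorem b2 [Algebra k2 R2] [FiniteDimensional F Ψ] (D : h.Dat v w1 w2 x μ θ) (ι : Ψ →ₐ[F] T') {q : Place T' R} {W : Place R R2} {e e' : ℕ}
    (hq : Over v q e) (hW : Over w2 W e') (j : ℕ) : q.v (ι ((σ ^ j) (bb σ h.C h.ns x μ))) = 1 ∧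
      W.v (q.r (ι ((σ ^ j) (bb σ h.C h.ns x μ)))) = 1 := by
  classical
  obtain ⟨i0, H⟩ := D.X2.loc D.lκ D.l2 ι hq hW D.hμ D.μ2v.le
  have h1 := H.bb j
  have h3 : W.v (q.r (ι (if j ≡ i0 [MOD h.ns] then algebraMap F Ψ μ else 1))) = 1 := by
    split_ifs
    · rw [AlgHom.commutes, hq.r _ D.hμ, hW.v, D.μ2v, one_pow]
    · rw [map_one, q.r_one, map_one]
  have h2 := chCg_val h1 (by rw [h3]; exact e2lt hW.epos)
  rw [h3] at h2
  refine ⟨q.v_eq_one_of_r_ne h1.1.1 ?_, h2⟩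
  intro h0
  rw [h0, map_zero] at h2
  exact zero_ne_one h2

theorem y1 [Algebra k1 R2] [FiniteDimensional F Ψ] (D : h.Dat v w1 w2 x μ θ) (A : ℕ) (ι : Ψ →ₐ[F] T') {q : Place T' R} {W : Place R R2} {e e' : ℕ}
    (hq : Over v q e) (hW : Over w1 W e') :
    ∃ i, W.ord (q.r (ι (yy σ h.C h.ns A x μ))) = e' * (A ^ i : ℕ) := by
  classical
  obtain ⟨i0, hb⟩ := D.b1 ι hq hW
  have hn := h.ns_pos
  have h0 : yy σ h.C h.ns A x μ = ∏ i ∈ Finset.range h.ns, ((σ ^ (h.ns - i)) (bb σ h.C h.ns x μ)) ^ (A ^ i) := rfl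
  have h1 : q.r (ι (yy σ h.C h.ns A x μ)) =
      ∏ i ∈ Finset.range h.ns, q.r (ι ((σ ^ (h.ns - i)) (bb σ h.C h.ns x μ))) ^ (A ^ i) := by
    rw [h0, map_prod, q.r_prod]
    · refine Finset.prod_congr rfl fun i _ => ?_
      rw [map_pow, q.r_pow (hb _).1.le]
    · intro i _
      rw [map_pow]; exact q.v_pow_le (hb _).1.le _
  have h2 : ∀ j, W.ord (q.r (ι ((σ ^ j) (bb σ h.C h.ns x μ)))) = if j ≡ i0 [MOD h.ns] then (e' : ℤ) else 0 := by
    intro j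
    apply W.ord_of_v
    rw [(hb j).2]
    split_ifs
    · rw [← exp_nsmul]; simp
    · simp
  rw [h1, W.ord_prod]
  · refine ⟨(i0 * (h.ns - 1)) % h.ns, ?_⟩
    rw [Finset.sum_eq_single_of_mem ((i0 * (h.ns - 1)) % h.ns) (Finset.mem_range.2 (Nat.mod_lt _ hn))]
    · rw [W.ord_pow, h2, if_pos, mul_comm]
      rw [← Nat.ModEq.add_iff_right (Nat.mod_modEq (i0 * (h.ns - 1)) h.ns), Nat.sub_add_cancel (Nat.mod_lt _ hn).le]
      obtain ⟨m, hm⟩ := Nat.exists_eq_succ_of_ne_zero hn.ne'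
      have : i0 + i0 * (h.ns - 1) = h.ns * i0 := by rw [hm]; simp; ring
      rw [this]; simp [Nat.ModEq]
    · intro i hi hne
      rw [W.ord_pow, h2, if_neg, mul_zero]
      intro hc
      apply hne
      rw [Finset.mem_range] at hi
      have h3 : (h.ns - i) + (i + i0 * (h.ns - 1)) ≡ i0 + (i + i0 * (h.ns - 1)) [MOD h.ns] := hc.add_right _
      have h4 : i0 * (h.ns - 1) ≡ i [MOD h.ns] := by
        have e1 : (h.ns - i) + (i + i0 * (h.ns - 1)) = i0 * (h.ns - 1) + h.ns := by omega
        have e2 : i0 + (i + i0 * (h.ns - 1)) = i + h.ns * i0 := by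
          obtain ⟨m, hm⟩ := Nat.exists_eq_succ_of_ne_zero hn.ne'
          rw [hm]; simp; ring
        rw [e1, e2] at h3
        simpa [Nat.ModEq] using h3
      rw [h4, Nat.mod_eq_of_lt hi]
  · intro i _ hc
    have h3 := (hb (h.ns - i)).2
    rw [eq_zero_of_pow_eq_zero hc, map_zero] at h3
    split_ifs at h3
    · exact pow_ne_zero _ exp_ne_zero h3.symm
    · exact zero_ne_one h3

theorem y2 [Algebra k2 R2] [FiniteDimensional F Ψ] (D : h.Dat v w1 w2 x μ θ) (A : ℕ) (ι : Ψ →ₐ[F] T') {q : Place T' R} {W : Place R R2} {e e' : ℕ}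
    (hq : Over v q e) (hW : Over w2 W e') (j : ℕ) : q.v (ι ((σ ^ j) (yy σ h.C h.ns A x μ))) = 1 ∧
      W.v (q.r (ι ((σ ^ j) (yy σ h.C h.ns A x μ)))) = 1 := by
  have hb := D.b2 ι hq hW
  rw [h.yy_map, map_prod]
  constructor
  · rw [map_prod]
    apply Finset.prod_eq_one
    intro i _
    rw [map_pow, map_pow, (hb _).1, one_pow]
  · rw [q.r_prod, map_prod]
    · apply Finset.prod_eq_one
      intro i _
      rw [map_pow, q.r_pow (hb _).1.le, map_pow, (hb _).2, one_pow]
    · intro i _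
      rw [map_pow]; exact q.v_pow_le (hb _).1.le _

end Dat

theorem mem_F (h : Cyc σ l s d a C') [FiniteDimensional F Ψ] [IsGalois F Ψ] {z : Ψ} (hz : σ z = z) :
    ∃ c : F, algebraMap F Ψ c = z := by
  have : z ∈ Set.range (algebraMap F Ψ) := by
    rw [IsGalois.mem_range_algebraMap_iff_fixed]
    intro g
    obtain ⟨i, rfl⟩ := h.gen g
    induction i with
    | zero => simp
    | succ i ih => rw [pow_succ, AlgEquiv.mul_apply, hz, ih]
  exact this

theorem prod_fix {z : Ψ} {N : ℕ} (hz : (σ ^ N) z = z) :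
    σ (∏ j ∈ Finset.range N, (σ ^ j) z) = ∏ j ∈ Finset.range N, (σ ^ j) z := by
  rw [map_prod]
  have h1 : ∀ j ∈ Finset.range N, σ ((σ ^ j) z) = (σ ^ (j + 1)) z := fun j _ => by rw [pow_succ', AlgEquiv.mul_apply]
  rw [Finset.prod_congr rfl h1]
  cases N with
  | zero => simp
  | succ N =>
    rw [Finset.prod_range_succ, Finset.prod_range_succ', hz]; simp

theorem eps_per (h : Cyc σ l s d a C') : (σ ^ h.ns) (eps σ h.C h.ns x) = eps σ h.C h.ns x := by
  rw [eps_map]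
  refine Finset.prod_congr rfl fun i _ => ?_
  have h1 : (σ ^ (h.ns + i)) h.C = (σ ^ i) h.C := (h.cj_eq _ _).2 (by simp [Nat.ModEq])
  have h2 : (σ ^ h.ns) h.C = h.C := (h.fixC _).2 dvd_rfl
  rw [h1, h2]

theorem bb_per (h : Cyc σ l s d a C') : (σ ^ h.ns) (bb σ h.C h.ns x μ) = bb σ h.C h.ns x μ := by
  rw [bb, map_add, map_mul, map_sub, AlgEquiv.commutes, map_one, h.eps_per]

theorem yy_per (h : Cyc σ l s d a C') (A : ℕ) : (σ ^ h.ns) (yy σ h.C h.ns A x μ) = yy σ h.C h.ns A x μ := by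
  rw [h.yy_map, yy]
  refine Finset.prod_congr rfl fun i _ => ?_
  rw [add_comm, ← spow, h.bb_per]

theorem tt_per (h : Cyc σ l s d a C') (A δ : ℕ) : (σ ^ h.ns) (tt σ h.C h.ns A δ x μ θ) = tt σ h.C h.ns A δ x μ θ := by
  have h2 : (σ ^ h.ns) h.C = h.C := (h.fixC _).2 dvd_rfl
  rw [tt, map_sub, map_mul, map_pow, map_mul, AlgEquiv.commutes, h.eps_per, h.yy_per, h2]

namespace Dat
variable {h : Cyc σ l s d a C'}

theorem yv [FiniteDimensional F Ψ] [IsGalois F Ψ] (D : h.Dat v w1 w2 x μ θ) (A : ℕ) (ι : Ψ →ₐ[F] T') {q : Place T' R} {e : ℕ}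
    (hq : Over v q e) : q.v (ι (yy σ h.C h.ns A x μ)) = 1 := by
  obtain ⟨c, hc⟩ := h.mem_F (prod_fix (h.yy_per (x := x) (μ := μ) A))
  have hv : v.v c = 1 := by
    obtain ⟨Λ, Λ2, -, he, -⟩ := h.exists_chain v w2 D.lκ D.l2
    have h1 := Λ.ov.v c
    rw [he, pow_one, hc, map_prod] at h1
    rw [← h1]
    exact Finset.prod_eq_one fun j _ => (D.y2 A (AlgHom.id F Ψ) Λ.ov Λ2.ov j).1
  have h1 := hq.v_one hv
  rw [← ι.commutes, hc, map_prod, map_prod] at h1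
  have h2 := (h.tr_loc D.lκ ι hq D.X1.vx D.hμ).yyO A
  refine le_antisymm (h2 0) ?_
  rw [← h1, ← Finset.mul_prod_erase _ _ (Finset.mem_range.2 h.ns_pos)]
  calc _ ≤ q.v (ι ((σ ^ 0) (yy σ h.C h.ns A x μ))) * 1 :=
        mul_le_mul_right (Finset.prod_le_one' fun j _ => h2 j) _
    _ = _ := by simp

theorem f [FiniteDimensional F Ψ] [IsGalois F Ψ] (D : h.Dat v w1 w2 x μ θ) (A : ℕ) :
    ∃ f : F, algebraMap F Ψ f = ff σ h.C h.ns A (l ^ d) x μ θ ∧ v.v f = 1 ∧ w2.v (v.r f) = exp (-1 : ℤ) := by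
  classical
  obtain ⟨c, hc⟩ := h.mem_F (prod_fix (h.tt_per (x := x) (μ := μ) (θ := θ) A (l ^ d)))
  refine ⟨c, hc, ?_⟩
  obtain ⟨Λ, Λ2, -, he, he2⟩ := h.exists_chain v w2 D.lκ D.l2
  have hl0 : l ^ d ≠ 0 := (pow_pos h.hl.pos _).ne'
  obtain ⟨i0, H⟩ := D.X2.loc D.lκ D.l2 (AlgHom.id F Ψ) Λ.ov Λ2.ov D.hμ D.μ2v.le
  have hO : ∀ u : F, v.v u ≤ 1 → w2.v (v.r u) ≤ 1 →
      algebraMap F Ψ u ∈ (chCg (AlgHom.id F Ψ) Λ.q Λ2.q (exp (-2 : ℤ) ^ Λ2.e) (e2 Λ2.e)).O := fun u hu hu2 => by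
    refine ⟨?_, ?_⟩
    · rw [AlgHom.commutes, Λ.ov.v_le]; exact hu
    · rw [AlgHom.commutes, Λ.ov.r _ hu, Λ2.ov.v_le]; exact hu2
  have hθO := hO θ D.hθ D.θv.le
  have hvs : ∀ j, Λ.q.v ((σ ^ j) (tt σ h.C h.ns A (l ^ d) x μ θ)) ≤ 1 := fun j => (H.tt hθO A j hl0).1.1
  have key : ∀ j, Λ2.q.v (Λ.q.r ((σ ^ j) (tt σ h.C h.ns A (l ^ d) x μ θ))) = if j ≡ i0 [MOD h.ns] then exp (-1 : ℤ) else 1 := by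
    intro j
    have h1 := H.tt hθO A j hl0
    split_ifs with hj
    · rw [if_pos hj] at h1
      have hx' : (chCg (AlgHom.id F Ψ) Λ.q Λ2.q (exp (-2 : ℤ) ^ Λ2.e) (e2 Λ2.e)).E (algebraMap F Ψ μ) (algebraMap F Ψ x) := by
        refine ⟨H.hμ, H.hx.1, ?_, ?_⟩
        · rw [← map_sub, AlgHom.commutes, Λ.ov.v_le]; exact v.v_sub_le D.hμ D.X2.vx
        · rw [← map_sub, AlgHom.commutes, Λ.ov.r _ (v.v_sub_le D.hμ D.X2.vx), Λ2.ov.v, v.r_sub D.hμ D.X2.vx]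
          exact pow_le_pow_left₀ zero_le' D.μ2 _
      have h2 := H.hx.symm
      rw [(h.cj_eq i0 j).2 hj.symm] at h2
      have h3 := h1.trans (((Cg.E.refl hθO).pow (l ^ d)).mul hx' |>.sub h2)
      have e1 : algebraMap F Ψ θ ^ l ^ d * algebraMap F Ψ x - algebraMap F Ψ x = algebraMap F Ψ ((θ ^ l ^ d - 1) * x) := by
        simp; ring
      rw [e1] at h3
      have hv1 := v.v_sub_le (v.v_pow_le D.hθ (l ^ d)) (map_one v.v).le
      have hval : Λ2.q.v (Λ.q.r (AlgHom.id F Ψ (algebraMap F Ψ ((θ ^ l ^ d - 1) * x)))) = exp (-1 : ℤ) := by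
        rw [AlgHom.commutes, Λ.ov.r _ (v.v_mul_le hv1 D.X2.vx), Λ2.ov.v, he2, pow_one, v.r_mul hv1 D.X2.vx,
          v.r_sub (v.v_pow_le D.hθ (l ^ d)) (map_one v.v).le, v.r_one, v.r_pow D.hθ, map_mul, D.θ2, D.X2.vx1, mul_one]
      have h4 := chCg_val h3 (by rw [hval, he2, pow_one]; exact exp_lt_exp.2 (by norm_num))
      rw [hval] at h4
      exact h4
    · rw [if_neg hj] at h1
      have hval : Λ2.q.v (Λ.q.r (AlgHom.id F Ψ (-(σ ^ j) h.C))) = 1 := by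
        rw [map_neg, Λ.q.r_neg (h.v_cj (AlgHom.id F Ψ) Λ.q j).le, Valuation.map_neg]
        exact Λ2.q.v_root (pow_pos h.hl.pos s).ne' (h.rr_cj (AlgHom.id F Ψ) Λ.q j)
      have h4 := chCg_val h1 (by rw [hval]; exact e2lt Λ2.ov.epos)
      rw [hval] at h4
      exact h4
  have hvc : v.v c ≤ 1 := by
    rw [← Λ.ov.v_le, hc]
    exact Λ.q.v_prod_le _ _ fun j _ => hvs j
  have h5 : w2.v (v.r c) = exp (-1 : ℤ) := by
    have h6 := Λ2.ov.v (v.r c)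
    rw [he2, pow_one] at h6
    rw [← h6, ← Λ.ov.r _ hvc, hc, Λ.q.r_prod _ _ fun j _ => hvs j, map_prod, Finset.prod_congr rfl fun j _ => key j]
    rw [Finset.prod_eq_single_of_mem (i0 % h.ns) (Finset.mem_range.2 (Nat.mod_lt _ h.ns_pos)), if_pos (Nat.mod_modEq _ _)]
    intro j hj hne
    rw [if_neg]
    intro hc
    apply hne
    rw [← Nat.mod_eq_of_lt (Finset.mem_range.1 hj)]
    exact hc
  refine ⟨v.v_eq_one_of_r_ne hvc ?_, h5⟩
  intro h0
  rw [h0, map_zero] at h5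
  exact exp_ne_zero h5.symm

end Dat
end Cyc
end PlB
end

section
set_option linter.unusedSectionVars false
set_option linter.style.haveILetI false
set_option linter.unusedSimpArgs false

open WithZero

namespace PlB

theorem fin_range {k R : Type} [Field k] [Finite k] [Field R] [Algebra k R] {c : R} (hc : c ^ Nat.card k = c) :
    ∃ c0 : k, algebraMap k R c0 = c := by
  classical
  haveI := Fintype.ofFinite k
  by_contra hcon
  push Not at hcon
  have h1 : 1 < Fintype.card k := Fintype.one_lt_card
  have hne := FiniteField.X_pow_card_sub_X_ne_zero R h1
  have h2 : insert c (Finset.univ.image (algebraMap k R)) ⊆ (Polynomial.X ^ Fintype.card k - Polynomial.X : Polynomial R).roots.toFinset := by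
    intro z hz
    rw [Multiset.mem_toFinset, Polynomial.mem_roots hne]
    rw [Finset.mem_insert, Finset.mem_image] at hz
    rcases hz with rfl | ⟨b, -, rfl⟩
    · rw [Nat.card_eq_fintype_card] at hc
      simp [Polynomial.IsRoot, hc]
    · simp [Polynomial.IsRoot, ← map_pow, FiniteField.pow_card]
  have h3 := Finset.card_le_card h2
  rw [Finset.card_insert_of_notMem (by simpa using hcon), Finset.card_image_of_injective _ (algebraMap k R).injective,
    Finset.card_univ] at h3
  have h4 := (Multiset.toFinset_card_le _).trans (Polynomial.card_roots' (Polynomial.X ^ Fintype.card k - Polynomial.X : Polynomial R))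
  rw [FiniteField.X_pow_card_sub_X_natDegree_eq R h1] at h4
  omega

namespace Cyc
variable {F Ψ κ k k1 k2 : Type} [Field F] [Field Ψ] [Field κ] [Field k] [Field k1] [Field k2] [Algebra F Ψ]
variable {σ : Ψ ≃ₐ[F] Ψ} {l s d a : ℕ} {C' : Ψ}

theorem lt_one_le {y : ℤᵐ⁰} (h : y < 1) : y ≤ exp (-1 : ℤ) := by
  by_cases h0 : y = 0
  · rw [h0]; exact zero_le
  · rw [← exp_log h0] at h ⊢
    rw [← exp_zero, exp_lt_exp] at h
    rw [exp_le_exp]; omega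

theorem exists_alpha (h : Cyc σ l s d a C') [FiniteDimensional F Ψ] [IsGalois F Ψ] [Finite k] (p : ℕ) [Fact p.Prime] [CharP κ p]
    (v : Place F κ) (w : Place κ k) (lκ : (l : κ) ≠ 0) (lk : (l : k) ≠ 0) (hq : l ^ s ∣ Nat.card k - 1) :
    ∃ α : κ, ∀ x : F, v.v x ≤ 1 → w.v (v.r x - α) ≤ exp (-2 : ℤ) → h.Xd v w x := by
  have hq0 : 1 < Nat.card k := Finite.one_lt_card
  obtain ⟨Λ, Λ2, -, he, he2⟩ := h.exists_chain v w lκ lk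
  have hCv := h.v_cj (AlgHom.id F Ψ) Λ.q 0
  have hCr := h.rr_cj (AlgHom.id F Ψ) Λ.q 0
  have hls : l ^ s ≠ 0 := (pow_pos h.hl.pos s).ne'
  simp only [pow_zero, AlgHom.id_apply, AlgEquiv.one_apply] at hCv hCr
  have hCv2 := Λ2.q.v_root hls hCr
  have hCr2 : (Λ2.q.r (Λ.q.r h.C)) ^ (l ^ s) = 1 := by rw [← Λ2.q.r_pow hCv2.le, hCr, Λ2.q.r_one]
  obtain ⟨c0, hc0⟩ := fin_range (k := k) (c := Λ2.q.r (Λ.q.r h.C)) (by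
    obtain ⟨m, hm⟩ := hq
    have : Nat.card k = l ^ s * m + 1 := by omega
    rw [this, pow_succ, pow_mul, hCr2, one_pow, one_mul])
  have hc0s : c0 ^ (l ^ s) = 1 := (algebraMap k Λ2.R).injective (by rw [map_pow, hc0, hCr2, map_one])
  obtain ⟨γ, hγ, hγr⟩ := w.surj c0
  -- cardinality is a power of p
  have hcp : ∃ n, Nat.card k = p ^ n := by
    haveI := Fintype.ofFinite k
    haveI : CharP k p := by
      rw [CharP.charP_iff_prime_eq_zero (Fact.out)]
      have := (w.r_natCast p).2
      rw [← this, CharP.cast_eq_zero, w.r_zero]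
    obtain ⟨n, -, hn⟩ := FiniteField.card k p
    exact ⟨n, by rw [Nat.card_eq_fintype_card, hn]⟩
  obtain ⟨n, hn⟩ := hcp
  have hα1 : w.v ((γ ^ Nat.card k) ^ (l ^ s) - 1) ≤ exp (-2 : ℤ) := by
    have e1 : (γ ^ Nat.card k) ^ (l ^ s) - 1 = (γ ^ (l ^ s) - 1) ^ (Nat.card k) := by
      rw [hn, sub_pow_expChar_pow, one_pow, ← pow_mul, ← pow_mul, mul_comm]
    rw [e1, map_pow]
    have h1 : w.v (γ ^ (l ^ s) - 1) < 1 := by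
      rw [← w.r_eq_iff (w.v_pow_le hγ _) (map_one w.v).le, w.r_pow hγ, hγr, hc0s, w.r_one]
    have h2 := lt_one_le h1
    calc w.v (γ ^ (l ^ s) - 1) ^ (Nat.card k) ≤ w.v (γ ^ (l ^ s) - 1) ^ 2 := pow_le_pow_right_of_le_one' h1.le hq0
      _ ≤ exp (-1 : ℤ) ^ 2 := pow_le_pow_left₀ zero_le h2 2
      _ = exp (-2 : ℤ) := by rw [← exp_nsmul]; simp
  have hαv := w.v_pow_le hγ (Nat.card k)
  have hαr : w.r (γ ^ Nat.card k) = c0 := by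
    rw [w.r_pow hγ, hγr]
    haveI := Fintype.ofFinite k
    rw [Nat.card_eq_fintype_card, FiniteField.pow_card]
  refine ⟨γ ^ Nat.card k, fun x hx hxα => ⟨hx, ?_, ?_⟩⟩
  · have hxv : w.v (v.r x) ≤ 1 := by
      rw [← sub_add_cancel (v.r x) (γ ^ Nat.card k)]
      exact w.v_add_le (hxα.trans m2lt.le) hαv
    rw [← sub_add_sub_cancel _ ((γ ^ Nat.card k) ^ (l ^ s))]
    refine (w.v.map_add _ _).trans (max_le ?_ hα1)
    rw [← geom_sum₂_mul, mul_comm, map_mul]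
    refine (mul_le_mul' hxα ?_).trans (mul_one _).le
    refine w.v.map_sum_le fun i _ => ?_
    exact w.v_mul_le (w.v_pow_le hxv _) (w.v_pow_le hαv _)
  · have hper : (σ ^ h.ns) (algebraMap F Ψ x - h.C) = algebraMap F Ψ x - h.C := by
      have h2 : (σ ^ h.ns) h.C = h.C := (h.fixC _).2 dvd_rfl
      rw [map_sub, AlgEquiv.commutes, h2]
    obtain ⟨g, hg⟩ := h.mem_F (prod_fix hper)
    have hg' : algebraMap F Ψ g = ∏ i ∈ Finset.range h.ns, (algebraMap F Ψ x - (σ ^ i) h.C) := by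
      rw [hg]; refine Finset.prod_congr rfl fun i _ => ?_
      rw [map_sub, AlgEquiv.commutes]
    have hxv : w.v (v.r x) ≤ 1 := by
      rw [← sub_add_cancel (v.r x) (γ ^ Nat.card k)]
      exact w.v_add_le (hxα.trans m2lt.le) hαv
    have hxr : w.r (v.r x) = c0 := by
      rw [← hαr, w.r_eq_iff hxv hαv]; exact hxα.trans_lt m2lt
    have hX : Λ.q.v (algebraMap F Ψ x) ≤ 1 := Λ.ov.v_le.2 hx
    have hcj : ∀ i, Λ.q.v ((σ ^ i) h.C) ≤ 1 := fun i => (h.v_cj (AlgHom.id F Ψ) Λ.q i).le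
    have hf1 : ∀ i ∈ Finset.range h.ns, Λ.q.v (algebraMap F Ψ x - (σ ^ i) h.C) ≤ 1 := fun i _ => Λ.q.v_sub_le hX (hcj i)
    have hgv : v.v g ≤ 1 := by
      rw [← Λ.ov.v_le, hg']; exact Λ.q.v_prod_le _ _ hf1
    refine ⟨g, hg', hgv, ?_⟩
    have h3 := Λ2.ov.v (v.r g)
    rw [he2, pow_one] at h3
    rw [← h3, ← Λ.ov.r _ hgv, hg', Λ.q.r_prod _ _ hf1, map_prod]
    rw [← Finset.mul_prod_erase _ _ (Finset.mem_range.2 h.ns_pos)]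
    have hx2 : Λ2.q.v (algebraMap κ Λ.R (v.r x)) ≤ 1 := Λ2.ov.v_le.2 hxv
    have h4 : ∀ i, Λ2.q.v (Λ.q.r ((σ ^ i) h.C)) ≤ 1 := fun i => (Λ2.q.v_root hls (h.rr_cj (AlgHom.id F Ψ) Λ.q i)).le
    refine mul_lt_one_of_lt_of_le ?_ (Finset.prod_le_one' fun i _ => ?_)
    · rw [Λ.q.r_sub hX (hcj 0), Λ.ov.r _ hx, ← Λ2.q.r_eq_iff hx2 (h4 0), Λ2.ov.r _ hxv, hxr, hc0]; simp
    · rw [Λ.q.r_sub hX (hcj i), Λ.ov.r _ hx]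
      exact Λ2.q.v_sub_le hx2 (h4 i)

theorem exists_Dat (h : Cyc σ l s d a C') [FiniteDimensional F Ψ] [IsGalois F Ψ] [Finite k1] [Finite k2] (p : ℕ) [Fact p.Prime] [CharP κ p]
    (v : Place F κ) (w1 : Place κ k1) (w2 : Place κ k2) (lκ : (l : κ) ≠ 0) (l1 : (l : k1) ≠ 0) (l2 : (l : k2) ≠ 0)
    (hq1 : l ^ s ∣ Nat.card k1 - 1) (hq2 : l ^ s ∣ Nat.card k2 - 1)
    (approx : ∀ α1 α2 : κ, ∃ α, w1.v (α - α1) ≤ exp (-2 : ℤ) ∧ w2.v (α - α2) ≤ exp (-2 : ℤ)) :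
    ∃ x μ θ : F, h.Dat v w1 w2 x μ θ := by
  obtain ⟨α1, hα1⟩ := h.exists_alpha p v w1 lκ l1 hq1
  obtain ⟨α2, hα2⟩ := h.exists_alpha p v w2 lκ l2 hq2
  obtain ⟨α, ha1, ha2⟩ := approx α1 α2
  obtain ⟨x, hx, rfl⟩ := v.surj α
  obtain ⟨π1, hπ1⟩ := w1.unif
  obtain ⟨m, hm1, hm2⟩ := approx π1 (v.r x)
  obtain ⟨μ, hμ, rfl⟩ := v.surj m
  obtain ⟨π2, hπ2⟩ := w2.unif
  obtain ⟨θ, hθ, hθr⟩ := v.surj (1 + π2)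
  refine ⟨x, μ, θ, lκ, l1, l2, hα1 x hx ha1, hα2 x hx ha2, hμ, ?_, hm2, hθ, ?_⟩
  · have := Valuation.map_add_eq_of_lt_right w1.v (x := v.r μ - π1) (y := π1)
      (by rw [hπ1]; exact hm1.trans_lt (exp_lt_exp.2 (by norm_num)))
    rwa [sub_add_cancel, hπ1] at this
  · rw [hθr]
    have hp2 : w2.v π2 ≤ 1 := by rw [hπ2]; exact m1lt.le
    have hone : w2.v (1 + π2) ≤ 1 := w2.v_add_le (map_one w2.v).le hp2
    have hrp : w2.r π2 = 0 := by rw [w2.r_eq_zero hp2, hπ2]; exact m1lt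
    have hr1 : w2.r (1 + π2) = 1 := by rw [w2.r_add (map_one w2.v).le hp2, hrp, w2.r_one, add_zero]
    rw [← mul_geom_sum, map_mul, add_sub_cancel_left, hπ2]
    have hsum : ∀ N : ℕ, w2.v (∑ i ∈ Finset.range N, (1 + π2) ^ i) ≤ 1 ∧ w2.r (∑ i ∈ Finset.range N, (1 + π2) ^ i) = N := by
      intro N
      induction N with
      | zero => simp [w2.r_zero]
      | succ N ih =>
        rw [Finset.sum_range_succ, w2.r_add ih.1 (w2.v_pow_le hone N), ih.2, w2.r_pow hone, hr1, one_pow]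
        exact ⟨w2.v_add_le ih.1 (w2.v_pow_le hone N), by push_cast; rfl⟩
    rw [w2.v_eq_one_of_r_ne (hsum _).1 (by rw [(hsum _).2]; exact cast_pow_ne l2 d), mul_one]

end Cyc
end PlB
end

section
set_option linter.unusedSectionVars false
set_option linter.style.haveILetI false
set_option linter.unusedSimpArgs false

open WithZero

namespace PlB

section QQ
variable {F Ψ : Type} [Field F] [Field Ψ] [Algebra F Ψ] (σ : Ψ ≃ₐ[F] Ψ) (b : Ψ) (A : ℕ)

noncomputable def QQ (m : ℕ) : Ψ := ∏ i ∈ Finset.range m, ((σ ^ (m - i)) b) ^ (A ^ i)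

theorem QQ_succ (m : ℕ) : QQ σ b A (m + 1) = σ (QQ σ b A m) * (σ b) ^ (A ^ m) := by
  rw [QQ, Finset.prod_range_succ, QQ, map_prod]
  congr 1
  · refine Finset.prod_congr rfl fun i hi => ?_
    rw [Finset.mem_range] at hi
    rw [map_pow, Nat.sub_add_comm hi.le, pow_succ', AlgEquiv.mul_apply]
  · simp

theorem QQ_succ' (m : ℕ) : QQ σ b A (m + 1) = (σ ^ (m + 1)) b * QQ σ b A m ^ A := by
  rw [QQ, Finset.prod_range_succ', QQ, ← Finset.prod_pow, mul_comm]
  congr 1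
  · simp
  · refine Finset.prod_congr rfl fun i hi => ?_
    rw [Nat.add_sub_add_right, pow_succ, pow_mul]

theorem QQ_rel {N nn D : ℕ} (hb : b ≠ 0) (hN : (σ ^ N) b = b) (hA : A ^ N = 1 + nn * D) :
    σ (QQ σ b A N) * ((σ b) ^ nn) ^ D = QQ σ b A N ^ A := by
  have h1 := (QQ_succ σ b A N).symm.trans (QQ_succ' σ b A N)
  rw [pow_succ', AlgEquiv.mul_apply, hN, hA, pow_add, pow_one, pow_mul] at h1
  have : σ b ≠ 0 := (map_ne_zero _).2 hb
  apply mul_left_cancel₀ this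
  rw [← h1]; ring

theorem iterY {S : Type} [CommRing S] (g : S →+* S) (φ : Ψ →+* S) (hg : ∀ z, g (φ z) = φ (σ z))
    {Y : S} {nn : ℕ} (hY : g Y * φ ((σ b) ^ nn) = Y ^ A) (m : ℕ) :
    g^[m] Y * φ (QQ σ b A m) ^ nn = Y ^ (A ^ m) := by
  induction m with
  | zero => simp [QQ]
  | succ m ih =>
    rw [Function.iterate_succ_apply', QQ_succ, map_mul, mul_pow, ← mul_assoc, ← hg, ← map_pow, ← map_mul, ih, map_pow,
      pow_succ', pow_mul Y, ← hY, mul_pow, map_pow, map_pow, ← pow_mul, ← pow_mul, mul_comm nn]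

theorem iterY' {S : Type} [CommRing S] (g : S →+* S) (φ : Ψ →+* S) (hg : ∀ z, g (φ z) = φ (σ z))
    {Y : S} {N nn D : ℕ} (hY : g Y * φ ((σ b) ^ nn) = Y ^ A) (hA : A ^ N = 1 + nn * D)
    (hD : Y ^ D = φ (QQ σ b A N)) (hy : QQ σ b A N ≠ 0) : g^[N] Y = Y := by
  have h1 := iterY σ b A g φ hg hY N
  rw [hA, pow_add, pow_one, mul_comm nn, pow_mul, hD] at h1
  have : IsUnit (φ (QQ σ b A N) ^ nn) := ((IsUnit.mk0 _ hy).map φ).pow _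
  exact this.mul_right_cancel h1

end QQ

theorem ev {K T : Type} [Field K] [CommRing T] (i : K →+* T) (x : T) (l : ℕ) (y : K) :
    Polynomial.eval₂ i x (Polynomial.X ^ l - Polynomial.C y) = x ^ l - i y := by simp

theorem ar_ext {K T : Type} [Field K] [CommRing T] {p : Polynomial K} {f g : AdjoinRoot p →+* T}
    (h1 : ∀ c, f (AdjoinRoot.of p c) = g (AdjoinRoot.of p c)) (h2 : f (AdjoinRoot.root p) = g (AdjoinRoot.root p)) (x : AdjoinRoot p) :
    f x = g x := by
  have : f.comp (AdjoinRoot.mk p) = g.comp (AdjoinRoot.mk p) := by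
    apply Polynomial.ringHom_ext
    · intro c; simpa using h1 c
    · simpa using h2
  induction x using AdjoinRoot.induction_on with
  | ih q => exact congrArg (fun F => F q) this

/-- interface of the top field -/
structure TL {F Ψ T : Type} [Field F] [Field Ψ] [Algebra F Ψ] [Field T] [Algebra F T] [Algebra Ψ T] (S : NCBi F T)
    (σ : Ψ ≃ₐ[F] Ψ) (l : ℕ) (ζ b y : Ψ) (A nn : ℕ) (Y : T) : Prop where
  hl : S.l = l
  hn : S.n = orderOf σ
  hY : Y ^ l = algebraMap Ψ T y
  taY : S.ta Y = algebraMap Ψ T ζ * Y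
  taΨ : ∀ c, S.ta (algebraMap Ψ T c) = algebraMap Ψ T c
  sgΨ : ∀ c, S.sg (algebraMap Ψ T c) = algebraMap Ψ T (σ c)
  sgY : S.sg Y * algebraMap Ψ T ((σ b) ^ nn) = Y ^ A

theorem fin_of_faith {F T : Type} [Field F] [Field T] [Algebra F T] [FiniteDimensional F T] (S : NCBi F T) : IsGalois F T := by
  apply IsGalois.of_fixedField_eq_bot
  rw [eq_bot_iff]
  intro x hx
  rw [IntermediateField.mem_fixedField_iff] at hx
  obtain ⟨c, hc⟩ := S.fix x (hx _ trivial) (hx _ trivial)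
  exact IntermediateField.mem_bot.2 ⟨c, hc⟩

theorem Cyc.exists_TL {F Ψ : Type} [Field F] [Field Ψ] [Algebra F Ψ] {σ : Ψ ≃ₐ[F] Ψ} {l s d a : ℕ} {C' : Ψ}
    (h : Cyc σ l s d a C') [FiniteDimensional F Ψ] [IsGalois F Ψ] {b : Ψ} {A N nn : ℕ} (lF : (l : F) ≠ 0)
    (hb : b ≠ 0) (hN : (σ ^ N) b = b) (hA : A ^ N = 1 + nn * l) (hy : QQ σ b A N ≠ 0)
    (hord : N ∣ orderOf σ) (hAa : A ≡ a [MOD l]) (hpow : ∀ z : Ψ, z ^ l ≠ QQ σ b A N) :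
    ∃ (T : Type) (_ : Field T) (_ : Algebra F T) (_ : Algebra Ψ T) (_ : IsScalarTower F Ψ T)
      (_ : FiniteDimensional F T) (S : NCBi F T) (Y : T),
      TL S σ l (C' ^ (l ^ (s + d - 1))) b (QQ σ b A N) A nn Y := by
  classical
  have hs := h.hs
  have hlp := h.hl.pos
  have hζ : IsPrimitiveRoot (C' ^ (l ^ (s + d - 1))) l := by
    refine h.prim.pow (pow_pos hlp _) ?_
    rw [← pow_succ]; congr 1; omega
  set ζ := C' ^ (l ^ (s + d - 1)) with hζd
  have hσζ : σ ζ = ζ ^ A := by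
    have : σ ζ = ζ ^ a := by rw [hζd, map_pow, h.act, ← pow_mul, ← pow_mul, mul_comm]
    rw [this]
    have := pow_mod_orderOf ζ A
    rw [← pow_mod_orderOf ζ A, ← pow_mod_orderOf ζ a, ← hζ.eq_orderOf, hAa]
  clear_value ζ
  set y := QQ σ b A N with hyd
  set P : Polynomial Ψ := Polynomial.X ^ l - Polynomial.C y with hP
  have hirr : Irreducible P := (X_pow_sub_C_irreducible_iff_of_prime h.hl).2 hpow
  haveI : Fact (Irreducible P) := ⟨hirr⟩
  have hmon : P.Monic := Polynomial.monic_X_pow_sub_C _ hlp.ne'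
  haveI : FiniteDimensional Ψ (AdjoinRoot P) := (AdjoinRoot.powerBasis hirr.ne_zero).finite
  haveI : FiniteDimensional F (AdjoinRoot P) := FiniteDimensional.trans F Ψ (AdjoinRoot P)
  set Y : AdjoinRoot P := AdjoinRoot.root P with hYd
  have hal : ∀ c, algebraMap Ψ (AdjoinRoot P) c = AdjoinRoot.of P c := fun c => rfl
  have hYl : Y ^ l = AdjoinRoot.of P y := by
    have := AdjoinRoot.eval₂_root P
    simpa [hP, sub_eq_zero] using this
  have hσb : (σ b) ^ nn ≠ 0 := pow_ne_zero _ ((map_ne_zero _).2 hb)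
  have hrel := QQ_rel σ b A hb hN hA
  let φ : Ψ →ₐ[F] AdjoinRoot P := (Algebra.ofId Ψ (AdjoinRoot P)).restrictScalars F
  have hφ : ∀ c, φ c = AdjoinRoot.of P c := fun c => rfl
  let sgH : AdjoinRoot P →ₐ[F] AdjoinRoot P := AdjoinRoot.liftAlgHom P (φ.comp (σ : Ψ →ₐ[F] Ψ))
    (Y ^ A * AdjoinRoot.of P (((σ b) ^ nn)⁻¹)) (by
      refine (ev _ _ _ _).trans (sub_eq_zero.2 ?_)
      change _ = AdjoinRoot.of P (σ y)
      rw [mul_pow, ← pow_mul, mul_comm A, pow_mul, hYl, ← map_pow, ← map_pow, ← map_mul, ← hrel]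
      congr 1
      rw [inv_pow, mul_assoc, mul_inv_cancel₀ (pow_ne_zero _ hσb), mul_one])
  have sgHo : ∀ c, sgH (AdjoinRoot.of P c) = AdjoinRoot.of P (σ c) := by
    intro c
    simp [sgH, hφ]
  have sgHY : sgH Y = Y ^ A * AdjoinRoot.of P (((σ b) ^ nn)⁻¹) := by
    simp [sgH, hYd]
  let taH : AdjoinRoot P →ₐ[F] AdjoinRoot P := AdjoinRoot.liftAlgHom P φ
    (AdjoinRoot.of P ζ * Y) (by
      refine (ev _ _ _ _).trans (sub_eq_zero.2 ?_)
      change _ = AdjoinRoot.of P y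
      rw [mul_pow, hYl, ← map_pow, hζ.pow_eq_one, map_one, one_mul])
  have taHo : ∀ c, taH (AdjoinRoot.of P c) = AdjoinRoot.of P c := by
    intro c
    simp [taH, hφ]
  have taHY : taH Y = AdjoinRoot.of P ζ * Y := by
    simp [taH, hYd]
  let sg : AdjoinRoot P ≃ₐ[F] AdjoinRoot P := AlgEquiv.ofBijective sgH (Algebra.IsAlgebraic.algHom_bijective sgH)
  let ta : AdjoinRoot P ≃ₐ[F] AdjoinRoot P := AlgEquiv.ofBijective taH (Algebra.IsAlgebraic.algHom_bijective taH)
  have sgo : ∀ c, sg (AdjoinRoot.of P c) = AdjoinRoot.of P (σ c) := sgHo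
  have tao : ∀ c, ta (AdjoinRoot.of P c) = AdjoinRoot.of P c := taHo
  have sgY : sg Y = Y ^ A * AdjoinRoot.of P (((σ b) ^ nn)⁻¹) := sgHY
  have taY : ta Y = AdjoinRoot.of P ζ * Y := taHY
  have ext' : ∀ f g : AdjoinRoot P ≃ₐ[F] AdjoinRoot P, (∀ c, f (AdjoinRoot.of P c) = g (AdjoinRoot.of P c)) → f Y = g Y → f = g := by
    intro f g h1 h2
    ext x
    exact ar_ext (f := (f : AdjoinRoot P →+* AdjoinRoot P)) (g := (g : AdjoinRoot P →+* AdjoinRoot P)) h1 h2 x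
  have sgpo : ∀ i c, (sg ^ i) (AdjoinRoot.of P c) = AdjoinRoot.of P ((σ ^ i) c) := by
    intro i
    induction i with
    | zero => intro c; simp
    | succ i ih => intro c; rw [pow_succ', AlgEquiv.mul_apply, ih, sgo, pow_succ', AlgEquiv.mul_apply]
  have tapo : ∀ i c, (ta ^ i) (AdjoinRoot.of P c) = AdjoinRoot.of P c := by
    intro i
    induction i with
    | zero => intro c; simp
    | succ i ih => intro c; rw [pow_succ', AlgEquiv.mul_apply, ih, tao]
  have tapY : ∀ i, (ta ^ i) Y = AdjoinRoot.of P (ζ ^ i) * Y := by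
    intro i
    induction i with
    | zero => simp
    | succ i ih => rw [pow_succ', AlgEquiv.mul_apply, ih, map_mul, tao, taY, ← mul_assoc, ← map_mul, pow_succ]
  have hYne : Y ≠ 0 := by
    intro h0
    rw [h0, zero_pow hlp.ne'] at hYl
    exact hy ((AdjoinRoot.of P).injective (by rw [← hYl, map_zero]))
  have sgYm : sg Y * AdjoinRoot.of P ((σ b) ^ nn) = Y ^ A := by
    rw [sgY, mul_assoc, ← map_mul, inv_mul_cancel₀ hσb, map_one, mul_one]
  have sgN : (sg ^ N) Y = Y := by
    have := iterY' σ b A (sg : AdjoinRoot P →+* AdjoinRoot P) (AdjoinRoot.of P) (fun z => sgo z) (Y := Y) (N := N) (nn := nn) (D := l)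
      sgYm hA hYl hy
    rw [AlgEquiv.coe_pow]; exact this
  have sgNk : ∀ k, (sg ^ (N * k)) Y = Y := by
    intro k
    induction k with
    | zero => simp
    | succ k ih => rw [mul_add, mul_one, pow_add, AlgEquiv.mul_apply, sgN, ih]
  let S : NCBi F (AdjoinRoot P) :=
    { sg := sg, ta := ta, n := orderOf σ, l := l
      hn := orderOf_pos σ
      hl := hlp
      comm := by
        apply ext'
        · intro c; rw [AlgEquiv.mul_apply, AlgEquiv.mul_apply, tao, sgo, tao]
        · rw [AlgEquiv.mul_apply, AlgEquiv.mul_apply, taY, map_mul, sgo, sgY, map_mul, map_pow, taY, tao, hσζ, mul_pow, map_pow]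
          ring
      sgn := by
        apply ext'
        · intro c; rw [sgpo, pow_orderOf_eq_one]; rfl
        · obtain ⟨k, hk⟩ := hord
          rw [hk, sgNk]; rfl
      tal := by
        apply ext'
        · intro c; rw [tapo]; rfl
        · rw [tapY, hζ.pow_eq_one, map_one, one_mul]; rfl
      inj := by
        rintro ⟨i, j⟩ ⟨i', j'⟩ hij
        simp only at hij
        have h1 := congrArg (fun g => g (AdjoinRoot.of P C')) hij
        simp only [AlgEquiv.mul_apply, tapo, sgpo] at h1
        have h2 := (AdjoinRoot.of P).injective h1
        have h3 : σ ^ (i : ℕ) = σ ^ (i' : ℕ) := by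
          rw [← inv_mul_eq_one]
          apply h.faith
          rw [AlgEquiv.mul_apply, ← h2, ← AlgEquiv.mul_apply, inv_mul_cancel]; rfl
        have h4 : (i : ℕ) = i' := pow_injOn_Iio_orderOf i.2 i'.2 h3
        have h4' : i = i' := Fin.ext h4
        subst h4'
        have h5 := congrArg (fun g => g Y) (mul_left_cancel hij)
        simp only [tapY] at h5
        have h6 := (AdjoinRoot.of P).injective (mul_right_cancel₀ hYne h5)
        have h7 : (j : ℕ) = j' := hζ.pow_inj j.2 j'.2 h6
        rw [Fin.ext h7]
      fix := by
        intro x hx1 hx2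
        have htr : ∀ x : AdjoinRoot P, ∃ c, ∑ j ∈ Finset.range l, (ta ^ j) x = AdjoinRoot.of P c := by
          intro x
          induction x using AdjoinRoot.induction_on with
          | ih q =>
            induction q using Polynomial.induction_on' with
            | add q r hq hr =>
              obtain ⟨c, hc⟩ := hq
              obtain ⟨c', hc'⟩ := hr
              refine ⟨c + c', ?_⟩
              rw [map_add, map_add, ← hc, ← hc', ← Finset.sum_add_distrib]
              exact Finset.sum_congr rfl fun j _ => by rw [map_add]
            | monomial k c =>
              have e1 : AdjoinRoot.mk P (Polynomial.monomial k c) = AdjoinRoot.of P c * Y ^ k := by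
                rw [← Polynomial.C_mul_X_pow_eq_monomial, map_mul, map_pow]; rfl
              have e2 : ∀ j ∈ Finset.range l, (ta ^ j) (AdjoinRoot.mk P (Polynomial.monomial k c))
                  = AdjoinRoot.of P ((ζ ^ k) ^ j) * (AdjoinRoot.of P c * Y ^ k) := by
                intro j _
                rw [e1, map_mul, tapo, map_pow, tapY, mul_pow, ← map_pow, ← pow_mul, ← pow_mul, mul_comm j]; ring
              rw [Finset.sum_congr rfl e2, ← Finset.sum_mul, ← map_sum]
              by_cases hk : l ∣ k
              · obtain ⟨m, rfl⟩ := hk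
                refine ⟨(∑ i ∈ Finset.range l, (ζ ^ (l * m)) ^ i) * (c * y ^ m), ?_⟩
                rw [map_mul, map_mul, map_pow, pow_mul Y, hYl]
              · refine ⟨0, ?_⟩
                have : IsPrimitiveRoot (ζ ^ k) l := hζ.pow_of_coprime _ (((Nat.Prime.coprime_iff_not_dvd h.hl).2 hk).symm)
                rw [this.geom_sum_eq_zero h.hl.one_lt, map_zero, zero_mul]
        have hj : ∀ j, (ta ^ j) x = x := by
          intro j
          induction j with
          | zero => rfl
          | succ j ih => rw [pow_succ', AlgEquiv.mul_apply, ih, hx2]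
        obtain ⟨c, hc⟩ := htr x
        rw [Finset.sum_congr rfl fun j _ => hj j, Finset.sum_const, Finset.card_range, nsmul_eq_mul] at hc
        have lΨ : (l : Ψ) ≠ 0 := by
          have := (map_ne_zero (algebraMap F Ψ)).2 lF
          simpa using this
        have hxc : x = AdjoinRoot.of P ((l : Ψ)⁻¹ * c) := by
          rw [map_mul, ← hc, ← mul_assoc, ← map_natCast (AdjoinRoot.of P), ← map_mul, inv_mul_cancel₀ lΨ, map_one, one_mul]
        rw [hxc, sgo] at hx1
        obtain ⟨f, hf⟩ := h.mem_F ((AdjoinRoot.of P).injective hx1)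
        refine ⟨f, ?_⟩
        rw [hxc, ← hf]
        rw [IsScalarTower.algebraMap_apply F Ψ (AdjoinRoot P)]; rfl }
  refine ⟨AdjoinRoot P, inferInstance, inferInstance, inferInstance, inferInstance, inferInstance, S, Y, ?_⟩
  exact ⟨rfl, rfl, hYl, taY, tao, sgo, sgYm⟩

end PlB
end

section
set_option linter.unusedSectionVars false
set_option linter.style.haveILetI false
set_option linter.unusedSimpArgs false

open WithZero

namespace PlB

section ring
variable {F T R ι : Type} [Field F] [Field T] [Algebra F T] [CommRing R] [Algebra T R] [Fintype ι] [DecidableEq ι]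

/-- matrix of a map on the basis -/
noncomputable def matOf (bs : Module.Basis ι T R) (φ : R → R) : Matrix ι ι T := fun i j => bs.repr (φ (bs j)) i

theorem matOf_comp (bs : Module.Basis ι T R) (s : T ≃ₐ[F] T) (g : R →+* R) (hg : ∀ c, g (algebraMap T R c) = algebraMap T R (s c))
    (z : R) (ψ : R → R) : matOf bs (fun x => z * g (ψ x)) = matOf bs (fun x => z * g x) * (matOf bs ψ).map s := by
  ext i j
  rw [Matrix.mul_apply]
  simp only [matOf, Matrix.map_apply]
  conv_lhs => rw [← bs.sum_repr (ψ (bs j))]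
  rw [map_sum, Finset.mul_sum, map_sum, Finset.sum_apply']
  refine Finset.sum_congr rfl fun k _ => ?_
  rw [Algebra.smul_def, map_mul g, hg, mul_left_comm, ← Algebra.smul_def, map_smul, Finsupp.smul_apply, smul_eq_mul, mul_comm]

theorem matOf_nrm (bs : Module.Basis ι T R) (s : T ≃ₐ[F] T) (g : R →+* R) (hg : ∀ c, g (algebraMap T R c) = algebraMap T R (s c))
    (z : R) (k : ℕ) : NCBi.nrm s (matOf bs (fun x => z * g x)) k =
      matOf bs (fun x => (∏ i ∈ Finset.range k, g^[i] z) * g^[k] x) := by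
  induction k with
  | zero =>
    ext i j
    simp [NCBi.nrm, matOf, Matrix.one_apply, Finsupp.single_apply, eq_comm]
  | succ k ih =>
    rw [NCBi.nrm, ih, ← matOf_comp bs s g hg]
    congr 1
    funext x
    rw [map_mul, map_prod, Finset.prod_range_succ', ← Function.iterate_succ_apply' g]
    simp only [Function.iterate_succ_apply', Function.iterate_zero, id]
    ring

theorem matOf_smul (bs : Module.Basis ι T R) (c : T) (φ : R → R) (hφ : ∀ j, φ (bs j) = algebraMap T R c * bs j) :
    matOf bs φ = c • (1 : Matrix ι ι T) := by
  ext i j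
  rw [matOf, hφ, ← Algebra.smul_def, map_smul]
  simp [Matrix.one_apply, Finsupp.single_apply, eq_comm]

theorem Tw_of_ring (S : NCBi F T) (bs : Module.Basis ι T R) (sH tH : R →+* R)
    (hs : ∀ c, sH (algebraMap T R c) = algebraMap T R (S.sg c)) (ht : ∀ c, tH (algebraMap T R c) = algebraMap T R (S.ta c))
    (hst : ∀ x, sH (tH x) = tH (sH x)) (hsn : ∀ x, sH^[S.n] x = x) (htl : ∀ x, tH^[S.l] x = x) {z c : R} {f t : F}
    (hz : ∏ i ∈ Finset.range S.n, sH^[i] z = algebraMap T R (algebraMap F T f))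
    (hc : ∏ i ∈ Finset.range S.l, tH^[i] c = algebraMap T R (algebraMap F T t))
    (hzc : z * sH c = c * tH z) :
    S.Tw f t (matOf bs (fun x => z * sH x)) (matOf bs (fun x => c * tH x)) := by
  refine ⟨?_, ?_, ?_⟩
  · rw [matOf_nrm bs S.sg sH hs]
    exact matOf_smul bs _ _ fun j => by rw [hz, hsn]
  · rw [matOf_nrm bs S.ta tH ht]
    exact matOf_smul bs _ _ fun j => by rw [hc, htl]
  · rw [← matOf_comp bs S.sg sH hs, ← matOf_comp bs S.ta tH ht]
    congr 1
    funext x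
    rw [map_mul, map_mul, ← mul_assoc, ← mul_assoc, hzc, hst]

end ring

theorem orth_prod {R : Type} [CommRing R] (u : R) (E : ℕ → R) (m : ℕ) (h : ∀ i j, i < m → j < m → i ≠ j → E i * E j = 0) :
    ∏ i ∈ Finset.range m, (1 + u * E i) = 1 + u * ∑ i ∈ Finset.range m, E i := by
  induction m with
  | zero => simp
  | succ m ih =>
    rw [Finset.prod_range_succ, ih fun i j hi hj => h i j (by omega) (by omega), Finset.sum_range_succ]
    have : (∑ i ∈ Finset.range m, E i) * E m = 0 := by
      rw [Finset.sum_mul]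
      exact Finset.sum_eq_zero fun i hi => by
        rw [Finset.mem_range] at hi
        exact h i m (by omega) (by omega) (by omega)
    linear_combination u * u * this

theorem idem_prod {R : Type} [CommRing R] (g : R →+* R) {U ω t li : R} {l : ℕ} (hl : 0 < l) (hU : U ^ l = 1) (hω1 : ω ^ l = 1)
    (hω : ∀ m, ¬ l ∣ m → ∑ k ∈ Finset.range l, (ω ^ m) ^ k = 0)
    (gU : g U = ω * U) (gω : g ω = ω) (gt : g t = t) (gli : g li = li) (hli : li * l = 1) :
    ∏ i ∈ Finset.range l, g^[i] (1 + (t - 1) * (li * ∑ k ∈ Finset.range l, U ^ k)) = t := by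
  have hgi : ∀ i, g^[i] (1 + (t - 1) * (li * ∑ k ∈ Finset.range l, U ^ k)) =
      1 + (t - 1) * (li * ∑ k ∈ Finset.range l, (ω ^ i * U) ^ k) := by
    intro i
    induction i with
    | zero => simp
    | succ i ih =>
      rw [Function.iterate_succ_apply', ih, map_add, map_one, map_mul, map_sub, gt, map_one, map_mul, gli, map_sum]
      congr 3
      refine Finset.sum_congr rfl fun k _ => ?_
      rw [map_pow, map_mul, map_pow, gω, gU, pow_succ, mul_assoc]
  rw [Finset.prod_congr rfl fun i _ => hgi i]
  have shift : ∀ V : R, V ^ l = 1 → V * ∑ k ∈ Finset.range l, V ^ k = ∑ k ∈ Finset.range l, V ^ k := by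
    intro V hV
    have := mul_geom_sum V l
    rw [hV, sub_self, sub_mul, one_mul, sub_eq_zero] at this
    exact this
  have hV : ∀ i, (ω ^ i * U) ^ l = 1 := by
    intro i; rw [mul_pow, hU, ← pow_mul, mul_comm i, pow_mul, hω1, one_pow, one_mul]
  have hO : ∀ i j, i < j → j < l → (∑ k ∈ Finset.range l, (ω ^ i * U) ^ k) * (∑ k ∈ Finset.range l, (ω ^ j * U) ^ k) = 0 := by
    intro i j hij hj
    set s := ∑ k ∈ Finset.range l, (ω ^ i * U) ^ k with hs
    have h1 : (ω ^ i * U) * s = s := shift _ (hV i)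
    have h2 : ∀ k, s * (ω ^ j * U) ^ k = (ω ^ (j - i)) ^ k * s := by
      intro k
      have e : ω ^ j * U = ω ^ (j - i) * (ω ^ i * U) := by
        rw [← mul_assoc, ← pow_add]; congr 2; omega
      induction k with
      | zero => simp
      | succ k ih => rw [pow_succ, ← mul_assoc, ih, e, pow_succ]; linear_combination (ω ^ (j - i)) ^ k * ω ^ (j - i) * h1
    rw [Finset.mul_sum, Finset.sum_congr rfl fun k _ => h2 k, ← Finset.sum_mul, hω, zero_mul]
    intro hd
    exact absurd (Nat.le_of_dvd (by omega) hd) (by omega)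
  rw [orth_prod]
  · have : ∑ i ∈ Finset.range l, li * ∑ k ∈ Finset.range l, (ω ^ i * U) ^ k = 1 := by
      rw [← Finset.mul_sum, Finset.sum_comm]
      have h3 : ∀ k ∈ Finset.range l, ∑ i ∈ Finset.range l, (ω ^ i * U) ^ k = if k = 0 then (l : R) else 0 := by
        intro k hk
        rw [Finset.mem_range] at hk
        split_ifs with h0
        · simp [h0]
        · have : ∀ i ∈ Finset.range l, (ω ^ i * U) ^ k = (ω ^ k) ^ i * U ^ k := by
            intro i _; rw [mul_pow, ← pow_mul, ← pow_mul, mul_comm i]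
          rw [Finset.sum_congr rfl this, ← Finset.sum_mul, hω, zero_mul]
          intro hd
          exact absurd (Nat.le_of_dvd (by omega) hd) (by omega)
      rw [Finset.sum_congr rfl h3, Finset.sum_ite_eq' , if_pos (Finset.mem_range.2 hl), hli]
    rw [this]; ring
  · intro i j hi hj hij
    rcases lt_or_gt_of_ne hij with h | h
    · rw [mul_mul_mul_comm, hO i j h hj, mul_zero]
    · rw [mul_mul_mul_comm, mul_comm (∑ k ∈ Finset.range l, (ω ^ i * U) ^ k), hO j i h hi, mul_zero]

theorem sum_pow_coprime {R : Type} [CommRing R] {U : R} {l A : ℕ} (hl : 0 < l) (hU : U ^ l = 1) (hA : l.Coprime A) :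
    ∑ k ∈ Finset.range l, (U ^ A) ^ k = ∑ k ∈ Finset.range l, U ^ k := by
  have hinj : Set.InjOn (fun k => A * k % l) (Finset.range l) := by
    intro i hi j hj hij
    have h1 : A * i ≡ A * j [MOD l] := hij
    have h2 := Nat.ModEq.cancel_left_of_coprime hA h1
    rw [Finset.coe_range, Set.mem_Iio] at hi hj
    exact Nat.ModEq.eq_of_lt_of_lt h2 hi hj
  have hmaps : ∀ k ∈ Finset.range l, (fun k => A * k % l) k ∈ Finset.range l := fun k _ => Finset.mem_range.2 (Nat.mod_lt _ hl)
  refine Finset.sum_nbij (fun k => A * k % l) hmaps hinj (Finset.surjOn_of_injOn_of_card_le _ hmaps hinj le_rfl) ?_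
  intro k _
  rw [← pow_mul, pow_eq_pow_mod _ hU]

theorem prod_range_mul' {R : Type} [CommRing R] (u : ℕ → R) (N M : ℕ) :
    ∏ i ∈ Finset.range (N * M), u i = ∏ j ∈ Finset.range N, ∏ k ∈ Finset.range M, u (j + N * k) := by
  induction M with
  | zero => simp
  | succ M ih =>
    rw [mul_add, mul_one, Finset.prod_range_add, ih, ← Finset.prod_mul_distrib]
    refine Finset.prod_congr rfl fun j _ => ?_
    rw [Finset.prod_range_succ, add_comm (N * M)]

open Polynomial in
theorem prod_roots {Ψ R : Type} [Field Ψ] [CommRing R] (φ : Ψ →+* R) {δ : ℕ} (hδ : 0 < δ) (ρ : ℕ → Ψ) (c : Ψ) (hρ : ∀ k, ρ k ^ δ = c)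
    (hinj : Set.InjOn ρ (Finset.range δ)) (w : R) : ∏ k ∈ Finset.range δ, (w - φ (ρ k)) = w ^ δ - φ c := by
  classical
  have key : (∏ k ∈ Finset.range δ, (X - C (ρ k)) : Ψ[X]) = X ^ δ - C c := by
    have hc : ((Finset.range δ).image ρ).card = δ := by
      rw [Finset.card_image_of_injOn hinj, Finset.card_range]
    have hm1 : (∏ k ∈ Finset.range δ, (X - C (ρ k)) : Ψ[X]).Monic := monic_prod_of_monic _ _ fun k _ => monic_X_sub_C _
    have hm2 : (X ^ δ - C c : Ψ[X]).Monic := monic_X_pow_sub_C _ hδ.ne'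
    have hd1 : (∏ k ∈ Finset.range δ, (X - C (ρ k)) : Ψ[X]).degree = δ := by
      rw [degree_prod]; simp
    have hd2 : (X ^ δ - C c : Ψ[X]).degree = δ := degree_X_pow_sub_C hδ _
    refine eq_of_degree_sub_lt_of_eval_finset_eq ((Finset.range δ).image ρ) ?_ ?_
    · rw [hc, ← hd1]
      exact degree_sub_lt (hd1.trans hd2.symm) hm1.ne_zero (by rw [hm1.leadingCoeff, hm2.leadingCoeff])
    · intro x hx
      obtain ⟨k, hk, rfl⟩ := Finset.mem_image.1 hx
      rw [eval_prod, Finset.prod_eq_zero hk (by simp)]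
      simp [hρ]
  have := congrArg (eval₂ φ w) key
  simpa [eval₂_finset_prod] using this

end PlB
end

section
set_option linter.unusedSectionVars false
set_option linter.style.haveILetI false
set_option linter.unusedSimpArgs false

open WithZero

namespace PlB

theorem iter_mul_fix {R : Type} (g : R → R) {Y : R} {N : ℕ} (h : g^[N] Y = Y) (k : ℕ) : g^[N * k] Y = Y := by
  rw [Function.iterate_mul]; exact Function.iterate_fixed h k

theorem Cyc.exists_Tw {F Ψ T : Type} [Field F] [Field Ψ] [Algebra F Ψ] [Field T] [Algebra F T] [Algebra Ψ T]
    [IsScalarTower F Ψ T] {σ : Ψ ≃ₐ[F] Ψ} {l s d a : ℕ} {C' : Ψ}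
    (h : Cyc σ l s d a C') [FiniteDimensional F Ψ] {S : NCBi F T} {b e : Ψ} {A nn : ℕ} {Y1 : T} (lF : (l : F) ≠ 0) (hd : 0 < d)
    (hb : b ≠ 0) (hN : (σ ^ h.ns) b = b) (hA : A ^ h.ns = 1 + nn * l ^ d) (hy : QQ σ b A h.ns ≠ 0)
    (hord : orderOf σ = h.ns * l ^ d) (hAl : l.Coprime A)
    (hT : TL S σ l (C' ^ (l ^ (s + d - 1))) b (QQ σ b A h.ns) A (nn * l ^ (d - 1)) Y1)
    (he : (σ ^ h.ns) e = e) {f t : F}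
    (hf : algebraMap F Ψ f = ∏ j ∈ Finset.range h.ns, (σ ^ j) (e ^ (l ^ d) * QQ σ b A h.ns - h.C)) :
    ∃ B B' : Matrix (Fin (l ^ d)) (Fin (l ^ d)) T, S.Tw f t B B' := by
  classical
  have hs := h.hs
  have hlp := h.hl.pos
  have hδ : 0 < l ^ d := pow_pos hlp _
  have hδ' : l ^ (d - 1) * l = l ^ d := by rw [← pow_succ]; congr 1; omega
  have hζ : IsPrimitiveRoot (C' ^ (l ^ (s + d - 1))) l := by
    refine h.prim.pow (pow_pos hlp _) ?_
    rw [← pow_succ]; congr 1; omega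
  have hrel := QQ_rel σ b A hb hN hA
  generalize C' ^ (l ^ (s + d - 1)) = ζ at hζ hT
  generalize hyd : QQ σ b A h.ns = y at hy hT hf hrel
  generalize hδd : l ^ d = δ at *
  set P : Polynomial T := Polynomial.X ^ δ - Polynomial.C (algebraMap Ψ T y) with hP
  have hmon : P.Monic := Polynomial.monic_X_pow_sub_C _ hδ.ne'
  have hdim : (AdjoinRoot.powerBasis' hmon).dim = δ := by
    rw [AdjoinRoot.powerBasis'_dim, hP, Polynomial.natDegree_X_pow_sub_C]
  let bs : Module.Basis (Fin δ) T (AdjoinRoot P) := (AdjoinRoot.powerBasis' hmon).basis.reindex (finCongr hdim)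
  set Y : AdjoinRoot P := AdjoinRoot.root P with hYd
  let φ : Ψ →+* AdjoinRoot P := (AdjoinRoot.of P).comp (algebraMap Ψ T)
  have hφ : ∀ c, φ c = AdjoinRoot.of P (algebraMap Ψ T c) := fun c => rfl
  have hYδ : Y ^ δ = φ y := by
    have := AdjoinRoot.eval₂_root P
    rw [hφ, hYd]
    simpa [hP, sub_eq_zero] using this
  have hσb : (σ b) ^ nn ≠ 0 := pow_ne_zero _ ((map_ne_zero _).2 hb)
  let sH : AdjoinRoot P →+* AdjoinRoot P := AdjoinRoot.lift ((AdjoinRoot.of P).comp (S.sg : T →+* T))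
    (Y ^ A * φ (((σ b) ^ nn)⁻¹)) (by
      refine (ev _ _ _ _).trans (sub_eq_zero.2 ?_)
      change _ = AdjoinRoot.of P (S.sg (algebraMap Ψ T y))
      rw [hT.sgΨ, ← hφ, mul_pow, ← pow_mul, mul_comm A, pow_mul, hYδ, ← map_pow, ← map_pow, ← map_mul, ← hrel]
      congr 1
      rw [inv_pow, mul_assoc, mul_inv_cancel₀ (pow_ne_zero _ hσb), mul_one])
  have sHo : ∀ c, sH (AdjoinRoot.of P c) = AdjoinRoot.of P (S.sg c) := by
    intro c
    simp [sH]
  have sHY : sH Y = Y ^ A * φ (((σ b) ^ nn)⁻¹) := by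
    simp [sH, hYd]
  let tH : AdjoinRoot P →+* AdjoinRoot P := AdjoinRoot.lift ((AdjoinRoot.of P).comp (S.ta : T →+* T)) Y (by
      refine (ev _ _ _ _).trans (sub_eq_zero.2 ?_)
      change _ = AdjoinRoot.of P (S.ta (algebraMap Ψ T y))
      rw [hT.taΨ, ← hφ, hYδ])
  have tHo : ∀ c, tH (AdjoinRoot.of P c) = AdjoinRoot.of P (S.ta c) := by
    intro c
    simp [tH]
  have tHY : tH Y = Y := by
    simp [tH, hYd]
  have sHφ : ∀ c, sH (φ c) = φ (σ c) := fun c => by rw [hφ, sHo, hT.sgΨ, ← hφ]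
  have tHφ : ∀ c, tH (φ c) = φ c := fun c => by rw [hφ, tHo, hT.taΨ]
  have sHip : ∀ i c, sH^[i] (φ c) = φ ((σ ^ i) c) := by
    intro i
    induction i with
    | zero => intro c; simp
    | succ i ih => intro c; rw [Function.iterate_succ_apply', ih, sHφ, pow_succ', AlgEquiv.mul_apply]
  have sHio : ∀ i c, sH^[i] (AdjoinRoot.of P c) = AdjoinRoot.of P ((S.sg ^ i) c) := by
    intro i
    induction i with
    | zero => intro c; simp
    | succ i ih => intro c; rw [Function.iterate_succ_apply', ih, sHo, pow_succ', AlgEquiv.mul_apply]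
  have tHio : ∀ i c, tH^[i] (AdjoinRoot.of P c) = AdjoinRoot.of P ((S.ta ^ i) c) := by
    intro i
    induction i with
    | zero => intro c; simp
    | succ i ih => intro c; rw [Function.iterate_succ_apply', ih, tHo, pow_succ', AlgEquiv.mul_apply]
  have sHN : sH^[h.ns] Y = Y := by
    refine iterY' σ b A sH φ sHφ (nn := nn) (D := δ) ?_ hA (by rw [hyd, hYδ]) (by rw [hyd]; exact hy)
    rw [sHY, mul_assoc, ← map_mul, inv_mul_cancel₀ hσb, map_one, mul_one]
  have sHNk : ∀ k, sH^[h.ns * k] Y = Y := iter_mul_fix _ sHN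
  have hn : S.n = h.ns * δ := hT.hn.trans hord
  have hY1 : Y1 ≠ 0 := by
    intro h0
    have := hT.hY
    rw [h0, zero_pow hlp.ne', eq_comm] at this
    exact hy ((map_eq_zero _).1 this)
  have sgY1 : S.sg Y1 = Y1 ^ A * (algebraMap Ψ T ((σ b) ^ (nn * l ^ (d - 1))))⁻¹ := by
    rw [← hT.sgY, mul_assoc, mul_inv_cancel₀, mul_one]
    exact (map_ne_zero _).2 (pow_ne_zero _ ((map_ne_zero _).2 hb))
  set U : AdjoinRoot P := Y ^ (l ^ (d - 1)) * AdjoinRoot.of P Y1⁻¹ with hU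
  have hUl : U ^ l = 1 := by
    rw [hU, mul_pow, ← pow_mul, hδ', hYδ, hφ, ← hT.hY, ← map_pow, ← map_mul, inv_pow, mul_inv_cancel₀ (pow_ne_zero _ hY1), map_one]
  have sHU : sH U = U ^ A := by
    rw [hU, map_mul, map_pow, sHo, sHY, map_inv₀ S.sg, sgY1, mul_pow, mul_pow, mul_inv, inv_inv, map_mul, ← hφ,
      ← inv_pow Y1, map_pow (AdjoinRoot.of P), pow_mul (σ b)]
    have : φ (((σ b) ^ nn)⁻¹) ^ l ^ (d - 1) * φ (((σ b) ^ nn) ^ l ^ (d - 1)) = 1 := by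
      rw [← map_pow, ← map_mul, inv_pow, inv_mul_cancel₀ (pow_ne_zero _ hσb), map_one]
    linear_combination (Y ^ A) ^ l ^ (d - 1) * AdjoinRoot.of P Y1⁻¹ ^ A * this
  have hζ0 : ζ ≠ 0 := hζ.ne_zero h.hl.ne_zero
  have tHU : tH U = φ ζ⁻¹ * U := by
    rw [hU, map_mul, map_pow, tHY, tHo, map_inv₀, hT.taY, mul_inv, map_mul, ← map_inv₀, ← hφ]; ring
  have lΨ : (l : Ψ) ≠ 0 := by
    have := (map_ne_zero (algebraMap F Ψ)).2 lF
    simpa using this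
  have hφF : ∀ c : F, φ (algebraMap F Ψ c) = algebraMap T (AdjoinRoot P) (algebraMap F T c) := by
    intro c
    rw [hφ, ← IsScalarTower.algebraMap_apply F Ψ T]; rfl
  set z : AdjoinRoot P := φ e * Y - φ C' with hz
  set c : AdjoinRoot P := 1 + (φ (algebraMap F Ψ t) - 1) * (φ ((l : Ψ)⁻¹) * ∑ k ∈ Finset.range l, U ^ k) with hc
  have sHc : sH c = c := by
    rw [hc, map_add, map_one, map_mul, map_sub, map_one, sHφ, AlgEquiv.commutes, map_mul, sHφ, map_inv₀, map_natCast, map_sum]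
    simp only [map_pow, sHU]
    rw [sum_pow_coprime hlp hUl hAl]
  have tHz : tH z = z := by
    rw [hz, map_sub, map_mul, tHφ, tHφ, tHY]
  refine ⟨_, _, Tw_of_ring S bs sH tH sHo tHo ?_ ?_ ?_ (z := z) (c := c) ?_ ?_ ?_⟩
  · apply ar_ext (f := sH.comp tH) (g := tH.comp sH)
    · intro x
      simp only [RingHom.comp_apply]
      rw [tHo, sHo, sHo, tHo, ← AlgEquiv.mul_apply, S.comm, AlgEquiv.mul_apply]
    · simp only [RingHom.comp_apply]
      rw [← hYd, tHY, sHY, map_mul, map_pow, tHY, tHφ]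
  · intro x
    have := ar_ext (f := sH ^ S.n) (g := RingHom.id _) (x := x) (by
      intro x
      rw [RingHom.coe_pow, sHio, S.sgn]; rfl) (by
      rw [RingHom.coe_pow, ← hYd, hn, sHNk]; rfl)
    rw [RingHom.coe_pow] at this
    exact this
  · intro x
    have := ar_ext (f := tH ^ S.l) (g := RingHom.id _) (x := x) (by
      intro x
      rw [RingHom.coe_pow, tHio, S.tal]; rfl) (by
      rw [RingHom.coe_pow, ← hYd, Function.iterate_fixed tHY]; rfl)
    rw [RingHom.coe_pow] at this
    exact this
  · have step : ∀ k, sH^[h.ns * k] z = φ e * Y - φ ((σ ^ (h.ns * k)) C') := by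
      intro k
      have he' : (σ ^ (h.ns * k)) e = e := by
        induction k with
        | zero => simp
        | succ k ih => rw [mul_add, mul_one, pow_add, AlgEquiv.mul_apply, he, ih]
      rw [← RingHom.coe_pow, hz, map_sub, map_mul, RingHom.coe_pow, sHNk, sHip, sHip, he']
    have hin : ∏ k ∈ Finset.range δ, sH^[h.ns * k] z = φ (e ^ δ * y - h.C) := by
      rw [Finset.prod_congr rfl fun k _ => step k]
      rw [prod_roots φ hδ (fun k => (σ ^ (h.ns * k)) C') h.C]
      · rw [mul_pow, hYδ, map_sub, map_mul, map_pow]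
      · intro k
        rw [← map_pow, ← hδd]
        exact (h.fixC _).2 (dvd_mul_right _ _)
      · intro i hi j hj hij
        simp only at hij
        rw [Finset.coe_range, Set.mem_Iio] at hi hj
        have h3 : σ ^ (h.ns * i) = σ ^ (h.ns * j) := by
          rw [← inv_mul_eq_one]
          apply h.faith
          rw [AlgEquiv.mul_apply, ← hij, ← AlgEquiv.mul_apply, inv_mul_cancel]; rfl
        have hns := h.ns_pos
        have h4 : h.ns * i = h.ns * j := pow_injOn_Iio_orderOf
          (by rw [Set.mem_Iio, hord]; exact Nat.mul_lt_mul_of_pos_left hi hns)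
          (by rw [Set.mem_Iio, hord]; exact Nat.mul_lt_mul_of_pos_left hj hns) h3
        exact Nat.eq_of_mul_eq_mul_left hns h4
    rw [hn, prod_range_mul', ← hφF, hf, map_prod]
    refine Finset.prod_congr rfl fun j _ => ?_
    rw [← sHip, ← hin, ← RingHom.coe_pow, map_prod, RingHom.coe_pow]
    exact Finset.prod_congr rfl fun k _ => by rw [Function.iterate_add_apply]
  · rw [hT.hl, ← hφF]
    refine idem_prod tH (ω := φ ζ⁻¹) hlp hUl ?_ ?_ tHU (tHφ _) (tHφ _) (tHφ _) ?_
    · rw [← map_pow, inv_pow, hζ.pow_eq_one, inv_one, map_one]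
    · intro m hm
      have : IsPrimitiveRoot (ζ⁻¹ ^ m) l := hζ.inv.pow_of_coprime _ (((Nat.Prime.coprime_iff_not_dvd h.hl).2 hm).symm)
      have h5 := congrArg φ (this.geom_sum_eq_zero h.hl.one_lt)
      rw [map_sum, map_zero] at h5
      simpa only [map_pow] using h5
    · rw [← map_natCast φ, ← map_mul, inv_mul_cancel₀ lΨ, map_one]
  · rw [sHc, tHz, mul_comm]

end PlB
end

section
set_option linter.unusedSectionVars false
set_option linter.style.haveILetI false
set_option linter.unusedSimpArgs false

open WithZero

namespace PlB

theorem pow1 {u : ℤᵐ⁰} {n : ℕ} (hn : n ≠ 0) (h : u ^ n = 1) : u = 1 := by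
  rcases lt_trichotomy u 1 with h1 | h1 | h1
  · exact absurd h (pow_lt_one₀ zero_le' h1 hn).ne
  · exact h1
  · exact absurd h (one_lt_pow₀ h1 hn).ne'

theorem Cyc.final {F Ψ κ k1 k2 : Type} [Field F] [Field Ψ] [Algebra F Ψ] [Field κ] [Field k1] [Field k2]
    {σ : Ψ ≃ₐ[F] Ψ} {l s d a : ℕ} {C' : Ψ}
    (h : Cyc σ l s d a C') [FiniteDimensional F Ψ] [IsGalois F Ψ] [Finite k1] [Finite k2] (p : ℕ) [Fact p.Prime] [CharP κ p]
    (v : Place F κ) (w1 : Place κ k1) (w2 : Place κ k2) (lF : (l : F) ≠ 0)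
    (lκ : (l : κ) ≠ 0) (l1 : (l : k1) ≠ 0) (l2 : (l : k2) ≠ 0)
    (hq1 : l ^ s ∣ Nat.card k1 - 1) (hq2 : l ^ s ∣ Nat.card k2 - 1) (hn : ¬ l ^ (s + 1) ∣ Nat.card k2 - 1) (h2 : l = 2 → 2 ≤ s)
    (approx : ∀ α1 α2 : κ, ∃ α, w1.v (α - α1) ≤ exp (-2 : ℤ) ∧ w2.v (α - α2) ≤ exp (-2 : ℤ))
    (hd : 0 < d) (bound : (Nat.card k1 - 1) * Nat.card k2 ^ (Nat.card k1 - 1) < l ^ d) :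
    ∃ D : CentralDivisionAlgebra F, Module.finrank F D.carrier = (l ^ d) ^ 2 ∧
      BrauerClassHasOrder F D.carrier (l ^ d) ∧ IsNoncrossedProduct F D.carrier := by
  classical
  obtain ⟨x, μ, θ, D⟩ := h.exists_Dat p v w1 w2 lκ l1 l2 hq1 hq2 approx
  have hlp := h.hl.pos
  set A := a ^ l ^ d with hAd
  have hla : ¬ l ∣ a := h.a_coprime
  have hlA : ¬ l ∣ A := fun hc => hla (h.hl.dvd_of_dvd_pow hc)
  have ha0 : 0 < a := Nat.pos_of_ne_zero fun h0 => hla (h0 ▸ dvd_zero _)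
  have hAN : ∃ nn, A ^ h.ns = 1 + nn * l ^ d := by
    have h1 := h.A0_ns
    rw [← hAd] at h1
    have h3 : 1 ≤ A ^ h.ns := Nat.one_le_pow _ _ (pow_pos ha0 _)
    have h4 : l ^ (s + d) ∣ A ^ h.ns - 1 := by
      have : (((A ^ h.ns - 1 : ℕ)) : ℤ) = ((A ^ h.ns : ℕ) : ℤ) - 1 := by push_cast [Nat.cast_sub h3]; ring
      rw [← this] at h1
      exact_mod_cast h1
    obtain ⟨c, hc⟩ := h4
    refine ⟨l ^ s * c, ?_⟩
    rw [pow_add] at hc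
    have : l ^ s * c * l ^ d = l ^ s * l ^ d * c := by ring
    rw [this]; omega
  obtain ⟨nn, hA⟩ := hAN
  have hAa : A ≡ a [MOD l] := by
    haveI : Fact l.Prime := ⟨h.hl⟩
    rw [← ZMod.natCast_eq_natCast_iff, hAd, Nat.cast_pow, ZMod.pow_card_pow]
  have hord := h.order_eq v w2 lκ l2 h2 hq2 hn
  set b := bb σ h.C h.ns x μ with hbd
  have hyq : yy σ h.C h.ns A x μ = QQ σ b A h.ns := rfl
  obtain ⟨Λ, Λ2, -, he, he2⟩ := h.exists_chain v w2 lκ l2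
  have hb : b ≠ 0 := by
    intro h0
    have := (D.b2 (AlgHom.id F Ψ) Λ.ov Λ2.ov 0).1
    rw [← hbd, h0] at this
    simp at this
  have hy : QQ σ b A h.ns ≠ 0 := by
    intro h0
    have := (D.y2 A (AlgHom.id F Ψ) Λ.ov Λ2.ov 0).1
    rw [hyq, h0] at this
    simp at this
  have hN : (σ ^ h.ns) b = b := h.bb_per
  have hpow : ∀ z : Ψ, z ^ l ≠ QQ σ b A h.ns := by
    intro z hz
    obtain ⟨M, M2, -, hM, hM2⟩ := h.exists_chain v w1 lκ l1
    obtain ⟨i, hi⟩ := D.y1 A (AlgHom.id F Ψ) M.ov M2.ov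
    have hv := D.yv A (AlgHom.id F Ψ) M.ov
    rw [hyq, ← hz] at hi hv
    rw [AlgHom.id_apply] at hi hv
    have hv1 : M.q.v z = 1 := by
      rw [map_pow] at hv
      exact pow1 hlp.ne' hv
    rw [M.q.r_pow hv1.le, M2.q.ord_pow, hM2] at hi
    have h3 : (l : ℤ) ∣ (A ^ i : ℕ) := ⟨_, by rw [hi]; push_cast; ring⟩
    exact hlA (h.hl.dvd_of_dvd_pow (by exact_mod_cast h3))
  have hd' : l ^ (d - 1) * l = l ^ d := by rw [← pow_succ]; congr 1; omega
  obtain ⟨T, _, _, _, _, _, S, Y, hT⟩ := h.exists_TL (nn := nn * l ^ (d - 1)) lF hb hN (by rw [mul_assoc, hd', hA]) hy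
    (hord ▸ dvd_mul_right _ _) hAa hpow
  haveI : IsGalois F T := fin_of_faith S
  obtain ⟨f, hf, hvf, hwf⟩ := D.f A
  obtain ⟨t, ht⟩ := v.unif
  obtain ⟨B, B', hTw⟩ := h.exists_Tw (e := algebraMap F Ψ θ * eps σ h.C h.ns x) (f := f) (t := t) lF hd hb hN hA hy hord
    ((Nat.Prime.coprime_iff_not_dvd h.hl).2 hlA) hT (by rw [map_mul, AlgEquiv.commutes, h.eps_per]) hf
  have hsgp : ∀ (i : ℕ) (c : Ψ), (S.sg ^ i) (algebraMap Ψ T c) = algebraMap Ψ T ((σ ^ i) c) := by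
    intro i
    induction i with
    | zero => intro c; simp
    | succ i ih => intro c; rw [pow_succ', AlgEquiv.mul_apply, ih, hT.sgΨ, pow_succ', AlgEquiv.mul_apply]
  have hι : ∀ (T' : Type) [Field T'] [Algebra F T'] [Algebra T T'] [IsScalarTower F T T'],
      ∃ ι : Ψ →ₐ[F] T', ι (yy σ h.C h.ns A x μ) = (algebraMap T T' Y) ^ l := by
    intro T' _ _ _ _
    refine ⟨(IsScalarTower.toAlgHom F T T').comp (IsScalarTower.toAlgHom F Ψ T), ?_⟩
    rw [← map_pow, hT.hY]; rfl
  have hYv : ∀ (T' : Type) [Field T'] [Algebra F T'] [Algebra T T'] [IsScalarTower F T T'] (R : Type)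
    [Field R] [Algebra κ R] (q : Place T' R) (e : ℕ), Over v q e → q.v (algebraMap T T' Y) = 1 := by
    intro T' _ _ _ _ R _ _ q e hq
    obtain ⟨ι, h1⟩ := hι T'
    have h3 := D.yv A ι hq
    rw [h1, map_pow] at h3
    exact pow1 hlp.ne' h3
  have hAr : Arith S v w1 w2 s d f t (algebraMap Ψ T C') Y :=
    { hl := by rw [hT.hl]; exact h.hl
      hM := by omega
      lκ := by rw [hT.hl]; exact lκ
      l1 := by rw [hT.hl]; exact l1
      l2 := by rw [hT.hl]; exact l2
      fin1 := inferInstance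
      fin2 := inferInstance
      prim := by rw [hT.hl]; exact h.prim.map_of_injective (algebraMap Ψ T).injective
      faith := by
        intro i hi
        rw [hsgp] at hi
        rw [hT.hn]
        exact orderOf_dvd_of_pow_eq_one (h.faith _ ((algebraMap Ψ T).injective hi))
      taC := hT.taΨ _
      taY := by rw [hT.taY, hT.hl, map_pow]
      vf := hvf
      wf := hwf
      vt := ht
      Yv := hYv
      Y2 := by
        intro T' _ _ _ _ R _ _ q e hq R2 _ _ W e2 hW
        obtain ⟨ι, h1⟩ := hι T'
        have h3 := (D.y2 A ι hq hW 0).2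
        rw [pow_zero, AlgEquiv.one_apply, h1, q.r_pow (hYv T' R q e hq).le, map_pow] at h3
        exact pow1 hlp.ne' h3
      Y1 := by
        intro T' _ _ _ _ R _ _ q e hq R1 _ _ W e1 hW
        obtain ⟨ι, h1⟩ := hι T'
        obtain ⟨i, hi⟩ := D.y1 A ι hq hW
        rw [h1, q.r_pow (hYv T' R q e hq).le, W.ord_pow] at hi
        refine ⟨(A ^ i : ℕ), ?_, ?_⟩
        · rw [hT.hl]
          intro hc
          exact hlA (h.hl.dvd_of_dvd_pow (by exact_mod_cast hc))
        · rw [hT.hl, ← hi, mul_comm]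
      hord := by
        rw [hT.hl]
        exact fun m hm => hord_of h.hl h.hs h2 Nat.card_pos hq2 hn d m hm
      bound := by rw [hT.hl]; exact bound }
  have hne : Nonempty (Fin (l ^ d)) := ⟨⟨0, pow_pos hlp _⟩⟩
  have hfin := NCBi.partA hTw hAr.f_ne hAr.t_ne
    (fun r b b' hsc => by rw [Fintype.card_fin, ← hT.hl]; exact hAr.LB r b b' hsc)
    (by rw [Fintype.card_fin, ← hT.hl]; exact hAr.NC)
  rw [Fintype.card_fin] at hfin
  exact hfin

end PlB
end

section
set_option linter.unusedSectionVars false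
set_option linter.style.haveILetI false
set_option linter.unusedSimpArgs false

open WithZero

namespace PlB
section cyclo
open Polynomial

/-- A root of the minimal polynomial over the prime field is a Frobenius power. -/
theorem frob_conj (p : ℕ) [Fact p.Prime] {k : Type} [Field k] [Algebra (ZMod p) k] (z : k) (hz : IsIntegral (ZMod p) z)
    (a : ℕ) (h : aeval (z ^ a) (minpoly (ZMod p) z) = 0) : ∃ i : ℕ, z ^ a = z ^ (p ^ i) := by
  let k1 := IntermediateField.adjoin (ZMod p) {z}
  haveI : FiniteDimensional (ZMod p) k1 := IntermediateField.adjoin.finiteDimensional hz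
  haveI : Finite k1 := Module.finite_of_finite (ZMod p)
  let g : k1 := IntermediateField.AdjoinSimple.gen (ZMod p) z
  have hg : algebraMap k1 k g = z := IntermediateField.AdjoinSimple.algebraMap_gen _ _
  have hm : minpoly (ZMod p) g = minpoly (ZMod p) z := IntermediateField.minpoly_gen _ _
  have h1 : aeval (g ^ a) (minpoly (ZMod p) g) = 0 := by
    apply (algebraMap k1 k).injective
    rw [map_zero, ← aeval_algebraMap_apply, map_pow, hg, hm, h]
  have hgi : IsIntegral (ZMod p) g := Algebra.IsIntegral.isIntegral g
  have hc : IsConjRoot (ZMod p) g (g ^ a) :=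
    minpoly.eq_of_irreducible_of_monic (minpoly.irreducible hgi) h1 (minpoly.monic hgi)
  haveI : IsGalois (ZMod p) k1 := inferInstance
  obtain ⟨τ, hτ⟩ := (isConjRoot_iff_exists_algEquiv).1 hc
  obtain ⟨n, hn⟩ := (FiniteField.bijective_frobeniusAlgEquivOfAlgebraic_pow (ZMod p) k1).2 τ⁻¹
  refine ⟨n, ?_⟩
  have h2 : τ⁻¹ g = g ^ a := by
    have := τ.symm_apply_apply (g ^ a)
    rw [hτ] at this; exact this
  rw [← hn] at h2
  simp only [AlgEquiv.coe_pow, FiniteField.coe_frobeniusAlgEquivOfAlgebraic, pow_iterate, ZMod.card] at h2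
  rw [← hg, ← map_pow, ← map_pow, h2]

theorem val_conj (p : ℕ) [Fact p.Prime] {L : Type} [Field L] (v : Valuation L NNReal) (hp : v (p : L) < 1) {M : ℕ}
    (hM : p.Coprime M) {C : L} (hC : C ^ M = 1) (hM0 : M ≠ 0) (a : ℕ)
    (h : ∀ f : ℤ[X], v (aeval C f) = v (aeval (C ^ a) f)) : ∃ i : ℕ, C ^ a = C ^ (p ^ i) := by
  let O := v.valuationSubring
  let k := IsLocalRing.ResidueField O
  let r : O →+* k := IsLocalRing.residue O
  have hr : ∀ x : O, r x = 0 ↔ v (x : L) < 1 := by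
    intro x
    rw [IsLocalRing.residue_eq_zero_iff]
    exact (v.valuationSubring.valuation_lt_one_iff x).trans (v.isEquiv_valuation_valuationSubring.lt_one_iff_lt_one.symm)
  have hchar : CharP k p := by
    rw [CharP.charP_iff_prime_eq_zero Fact.out]
    have := (hr (p : O)).2 (by simpa using hp)
    simpa using this
  letI : Algebra (ZMod p) k := ZMod.algebra k p
  have vC : v C = 1 := by
    have : v C ^ M = 1 := by rw [← map_pow, hC, map_one]
    exact (pow_eq_one_iff_of_nonneg zero_le hM0).1 this
  let c : O := ⟨C, vC.le⟩
  have hcC : ((c : O) : L) = C := rfl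
  have hcM : c ^ M = 1 := by
    apply Subtype.ext
    simp [hcC, hC]
  let z : k := r c
  have hzM : z ^ M = 1 := by rw [← map_pow, hcM, map_one]
  have hMk : (M : k) ≠ 0 := by
    intro h0
    have := (CharP.cast_eq_zero_iff k p M).1 h0
    have h1 := Nat.Coprime.eq_one_of_dvd hM this
    exact (Fact.out : p.Prime).one_lt.ne' h1
  have inj : ∀ i j : ℕ, z ^ i = z ^ j → C ^ i = C ^ j := by
    have key : ∀ i j : ℕ, i ≤ j → z ^ i = z ^ j → C ^ i = C ^ j := by
      intro i j hij h
      obtain ⟨t, rfl⟩ := Nat.exists_eq_add_of_le hij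
      have hz0 : z ≠ 0 := by
        intro h0; rw [h0, zero_pow hM0] at hzM; exact zero_ne_one hzM
      have hzt : z ^ t = 1 := by
        rw [pow_add] at h
        exact (mul_eq_left₀ (pow_ne_zero i hz0)).1 h.symm
      by_contra hne
      have hct : c ^ t ≠ 1 := by
        intro h1
        apply hne
        have : C ^ t = 1 := by
          have := congrArg (Subtype.val) h1
          simpa using this
        rw [pow_add, this, mul_one]
      have hs : ∑ i ∈ Finset.range M, (c ^ t) ^ i = 0 := by
        have := mul_geom_sum (c ^ t) M
        rw [← pow_mul, mul_comm t, pow_mul, hcM, one_pow, sub_self] at this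
        exact (mul_eq_zero.1 this).resolve_left (sub_ne_zero.2 hct)
      apply hMk
      have := congrArg r hs
      simp only [map_sum, map_pow, map_zero] at this
      change ∑ i ∈ Finset.range M, (z ^ t) ^ i = 0 at this
      simpa [hzt] using this
    intro i j h
    rcases le_total i j with h1 | h1
    · exact key i j h1 h
    · exact (key j i h1 h.symm).symm
  have hzi : IsIntegral (ZMod p) z :=
    IsIntegral.of_pow (Nat.pos_of_ne_zero hM0) (by rw [hzM]; exact isIntegral_one)
  obtain ⟨f, hf⟩ := Polynomial.map_surjective (Int.castRingHom (ZMod p)) (ZMod.ringHom_surjective _) (minpoly (ZMod p) z)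
  have hra : ∀ y : O, r (aeval y f) = aeval (r y) (minpoly (ZMod p) z) := by
    intro y
    rw [← hf, aeval_def, aeval_def, eval₂_map, hom_eval₂]
    congr 1
    exact RingHom.ext_int _ _
  have hva : ∀ y : O, v (aeval (y : L) f) < 1 ↔ aeval (r y) (minpoly (ZMod p) z) = 0 := by
    intro y
    rw [← hra, hr]
    have : ((aeval y f : O) : L) = aeval (y : L) f := by
      rw [aeval_def, aeval_def]
      change O.subtype _ = _
      rw [hom_eval₂]
      congr 1
    rw [this]
  have h1 : v (aeval (c : L) f) < 1 := (hva c).2 (minpoly.aeval _ _)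
  rw [hcC, h f] at h1
  have h2 := (hva (c ^ a)).1 (by simpa [hcC] using h1)
  rw [map_pow] at h2
  obtain ⟨i, hi⟩ := frob_conj p z hzi a h2
  exact ⟨i, inj _ _ hi⟩

/-- Automorphisms of a field over `ℚ_p` act on roots of unity of order prime to `p` through powers of `p`. -/
theorem padic_conj (p : ℕ) [Fact p.Prime] {Ψ : Type} [Field Ψ] [Algebra ℚ_[p] Ψ] {M : ℕ}
    (hM : p.Coprime M) {C : Ψ} (hC : C ^ M = 1) (hM0 : M ≠ 0) (a : ℕ) (g : Ψ ≃ₐ[ℚ_[p]] Ψ) (hg : g C = C ^ a) :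
    ∃ i : ℕ, C ^ a = C ^ (p ^ i) := by
  have hCi : IsIntegral ℚ_[p] C :=
    IsIntegral.of_pow (Nat.pos_of_ne_zero hM0) (by rw [hC]; exact isIntegral_one)
  let L := IntermediateField.adjoin ℚ_[p] {C}
  haveI : FiniteDimensional ℚ_[p] L := IntermediateField.adjoin.finiteDimensional hCi
  haveI : Algebra.IsAlgebraic ℚ_[p] L := inferInstance
  let N := spectralMulAlgNorm ℚ_[p] L
  have hN : ∀ x, N x = spectralNorm ℚ_[p] L x := fun x => rfl
  let v : Valuation L NNReal :=
    { toFun := fun x => ⟨N x, by rw [hN]; exact spectralNorm_nonneg x⟩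
      map_zero' := by apply Subtype.ext; simp
      map_one' := by
        apply Subtype.ext
        show N 1 = 1
        rw [hN]; exact spectralNorm_one
      map_mul' := by
        intro x y; apply Subtype.ext
        exact map_mul N x y
      map_add_le_max' := by
        intro x y
        have := isNonarchimedean_spectralNorm (K := ℚ_[p]) (L := L) x y
        exact_mod_cast this }
  have hv : ∀ x, (v x : ℝ) = spectralNorm ℚ_[p] L x := fun x => rfl
  let c : L := IntermediateField.AdjoinSimple.gen ℚ_[p] C
  have hc : algebraMap L Ψ c = C := IntermediateField.AdjoinSimple.algebraMap_gen _ _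
  have hp : v (p : L) < 1 := by
    rw [← NNReal.coe_lt_coe, hv]
    have := spectralNorm_extends (K := ℚ_[p]) (L := L) (p : ℚ_[p])
    rw [map_natCast] at this
    rw [this]
    exact_mod_cast Padic.norm_p_lt_one
  obtain ⟨i, hi⟩ := val_conj p v hp hM (C := c) (by apply (algebraMap L Ψ).injective; rw [map_pow, hc, hC, map_one]) hM0 a (by
    intro f
    apply NNReal.coe_injective
    rw [hv, hv, spectralNorm, spectralNorm]
    congr 1
    rw [← minpoly.algebraMap_eq (algebraMap L Ψ).injective, ← minpoly.algebraMap_eq (algebraMap L Ψ).injective (aeval (c ^ a) f)]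
    rw [← aeval_algebraMap_apply, ← aeval_algebraMap_apply, map_pow, hc, ← hg, ← minpoly.algEquiv_eq g (aeval C f)]
    congr 1
    exact (Polynomial.map_aeval_eq_aeval_map (φ := RingHom.id ℤ) (ψ := (g : Ψ →+* Ψ)) (RingHom.ext_int _ _) f C).trans (by rw [Polynomial.map_id]; rfl))
  refine ⟨i, ?_⟩
  rw [← hc, ← map_pow, ← map_pow, hi]

theorem exists_cyc (p : ℕ) [Fact p.Prime] (F : Type) [Field F] [Algebra ℚ_[p] F] (l s d : ℕ) (hl : l.Prime) (hlp : l ≠ p)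
    (hs : 0 < s) : ∃ (Ψ : Type) (_ : Field Ψ) (_ : Algebra F Ψ) (σ : Ψ ≃ₐ[F] Ψ) (a : ℕ) (C' : Ψ),
      FiniteDimensional F Ψ ∧ IsGalois F Ψ ∧ Cyc σ l s d a C' := by
  haveI : CharZero F := charZero_of_injective_algebraMap (algebraMap ℚ_[p] F).injective
  let M := l ^ (s + d)
  have hM0 : M ≠ 0 := pow_ne_zero _ hl.ne_zero
  haveI : NeZero M := ⟨hM0⟩
  haveI : NeZero ((M : ℕ) : F) := ⟨Nat.cast_ne_zero.2 hM0⟩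
  let Ψ := CyclotomicField M F
  haveI : IsCyclotomicExtension {M} F Ψ := inferInstance
  haveI : FiniteDimensional F Ψ := IsCyclotomicExtension.finiteDimensional {M} F Ψ
  haveI : IsGalois F Ψ := IsCyclotomicExtension.isGalois {M} F Ψ
  let C : Ψ := IsCyclotomicExtension.zeta M F Ψ
  have hC : IsPrimitiveRoot C M := IsCyclotomicExtension.zeta_spec M F Ψ
  haveI : IsScalarTower ℚ_[p] F Ψ := inferInstance
  have hcop : p.Coprime M := Nat.Coprime.pow_right _ ((Nat.coprime_primes Fact.out hl).2 (Ne.symm hlp))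
  have key : ∀ g : Ψ ≃ₐ[F] Ψ, ∃ i : ℕ, g C = C ^ (p ^ i) := by
    intro g
    have h1 : (g C) ^ M = 1 := by rw [← map_pow, hC.pow_eq_one, map_one]
    obtain ⟨a, -, ha⟩ := hC.eq_pow_of_pow_eq_one h1
    obtain ⟨i, hi⟩ := padic_conj p hcop hC.pow_eq_one hM0 a (g.restrictScalars ℚ_[p]) ha.symm
    exact ⟨i, ha.symm.trans hi⟩
  have faith : ∀ g : Ψ ≃ₐ[F] Ψ, g C = C → g = 1 := by
    intro g hg
    have : (hC.powerBasis F).gen = C := hC.powerBasis_gen F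
    have h2 : (g : Ψ →ₐ[F] Ψ) = AlgHom.id F Ψ := (hC.powerBasis F).algHom_ext (by rw [this]; simpa using hg)
    ext x
    exact DFunLike.congr_fun h2 x
  let u : (ZMod M)ˣ := ZMod.unitOfCoprime p hcop
  let φ : (Ψ ≃ₐ[F] Ψ) →* (ZMod M)ˣ := hC.autToPow F
  have φs : ∀ g : Ψ ≃ₐ[F] Ψ, C ^ ((φ g : ZMod M).val) = g C := fun g => hC.autToPow_spec F g
  have hφ : Function.Injective φ := hC.autToPow_injective F
  have hr : ∀ g, φ g ∈ Subgroup.zpowers u := by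
    intro g
    obtain ⟨i, hi⟩ := key g
    refine ⟨i, ?_⟩
    apply Units.ext
    have h1 := φs g
    rw [hi] at h1
    have h2 := (hC.isOfFinOrder hM0).pow_inj_mod.1 h1
    rw [← hC.eq_orderOf] at h2
    have h3 : (((φ g : ZMod M).val : ℕ) : ZMod M) = ((p ^ i : ℕ) : ZMod M) := (ZMod.natCast_eq_natCast_iff _ _ _).2 h2
    rw [ZMod.natCast_zmod_val] at h3
    rw [h3]
    simp [u]
  let φ' : (Ψ ≃ₐ[F] Ψ) →* Subgroup.zpowers u := φ.codRestrict _ hr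
  haveI : IsCyclic (Ψ ≃ₐ[F] Ψ) := isCyclic_of_injective φ' (fun x y h => hφ (congrArg Subtype.val h))
  obtain ⟨σ, hσ⟩ := IsCyclic.exists_generator (α := Ψ ≃ₐ[F] Ψ)
  obtain ⟨i, hi⟩ := key σ
  refine ⟨Ψ, inferInstance, inferInstance, σ, p ^ i, C, inferInstance, inferInstance, hl, hs, ?_, hC, faith, hi⟩
  intro g
  haveI : Finite (Ψ ≃ₐ[F] Ψ) := inferInstance
  obtain ⟨n, hn⟩ := (mem_powers_iff_mem_zpowers).2 (hσ g)
  exact ⟨n, hn.symm⟩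

end cyclo
end PlB
end

section
set_option linter.unusedSectionVars false
set_option linter.style.haveILetI false
set_option linter.unusedSimpArgs false

open WithZero IsDedekindDomain

namespace PlB
section curve
open Polynomial

theorem exists_point (p : ℕ) [Fact p.Prime] (K κ : Type) [Field K] [Field κ] [Algebra (ZMod p)[X] K]
    [IsFractionRing (ZMod p)[X] K] [Algebra K κ] [FiniteDimensional K κ] [Algebra.IsSeparable K κ] (N : ℕ) (hN : N ≠ 0) :
    ∃ (P : (ZMod p)[X]) (R : Type) (_ : Field R) (q : Place κ R) (f : ℕ), Irreducible P ∧ P.natDegree = N ∧ Finite R ∧ CharP R p ∧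
      f ≠ 0 ∧ Nat.card R = p ^ (N * f) ∧
      (∀ a : (ZMod p)[X], q.v (algebraMap K κ (algebraMap _ K a)) ≤ 1) ∧
      (q.v (algebraMap K κ (algebraMap _ K P)) < 1) := by
  let G := GaloisField p N
  haveI : FiniteDimensional (ZMod p) G := inferInstance
  obtain ⟨θ, hθ⟩ := Field.exists_primitive_element (ZMod p) G
  have hθi : IsIntegral (ZMod p) θ := Algebra.IsIntegral.isIntegral θ
  let P := minpoly (ZMod p) θ
  let ρ : (ZMod p)[X] →+* G := (aeval θ : (ZMod p)[X] →ₐ[ZMod p] G)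
  have hρ : ∀ a, ρ a = aeval θ a := fun a => rfl
  have hs : Function.Surjective ρ := by
    intro y
    have hy : y ∈ IntermediateField.adjoin (ZMod p) {θ} := by rw [hθ]; trivial
    rw [← IntermediateField.mem_toSubalgebra, IntermediateField.adjoin_simple_toSubalgebra_of_isAlgebraic hθi.isAlgebraic,
      Algebra.adjoin_singleton_eq_range_aeval] at hy
    exact hy
  let w : HeightOneSpectrum (ZMod p)[X] := ⟨RingHom.ker ρ, RingHom.ker_isPrime ρ, by
    intro h
    have : P ∈ RingHom.ker ρ := minpoly.aeval _ _
    rw [h] at this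
    exact minpoly.ne_zero hθi this⟩
  have hk : ∀ a, ρ a = 0 ↔ a ∈ w.asIdeal := fun a => Iff.rfl
  let p0 : Place K G := dedPlace w ρ K hk hs
  obtain ⟨R, fR, aR, fdR, q, e, ov⟩ := (p0.exists_level0 κ).1
  have hcG : Nat.card G = p ^ N := GaloisField.card p N hN
  haveI : Finite R := Module.finite_of_finite G
  haveI : CharP R p := charP_of_injective_algebraMap (algebraMap G R).injective p
  refine ⟨P, R, fR, q, Module.finrank G R, minpoly.irreducible hθi, ?_, inferInstance, inferInstance, Module.finrank_pos.ne', ?_, ?_, ?_⟩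
  · rw [(Field.primitive_element_iff_minpoly_natDegree_eq _ _).1 hθ]
    exact GaloisField.finrank p hN
  · rw [Module.natCard_eq_pow_finrank (K := G), hcG, pow_mul]
  · intro a
    rw [ov.v]
    exact pow_le_one₀ zero_le (w.valuation_le_one a)
  · rw [ov.v]
    refine pow_lt_one₀ zero_le ?_ ov.epos.ne'
    exact (w.valuation_lt_one_iff_mem P).2 (minpoly.aeval _ _)

theorem exists_small {x y : ℤᵐ⁰} (hx : x < 1) : ∃ n : ℕ, ∀ m, n ≤ m → x ^ m * y ≤ exp (-2 : ℤ) := by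
  by_cases hy : y = 0
  · exact ⟨0, fun m _ => by rw [hy, mul_zero]; exact zero_le⟩
  have hx1 : x ≤ exp (-1 : ℤ) := by
    by_cases h0 : x = 0
    · rw [h0]; exact zero_le
    · rw [← exp_log h0] at hx ⊢
      rw [← exp_zero, exp_lt_exp] at hx
      rw [exp_le_exp]; omega
  refine ⟨(log y + 2).toNat, fun m hm => ?_⟩
  have h1 : x ^ m ≤ exp (-(m : ℤ)) := by
    refine (pow_le_pow_left₀ zero_le hx1 m).trans ?_
    rw [← exp_nsmul]; simp
  refine (mul_le_mul' h1 le_rfl).trans ?_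
  rw [← exp_log hy, ← exp_add, exp_le_exp]
  omega

theorem exists_points (p : ℕ) [hp : Fact p.Prime] (K κ : Type) [Field K] [Field κ] [Algebra (ZMod p)[X] K]
    [IsFractionRing (ZMod p)[X] K] [Algebra K κ] [FiniteDimensional K κ] [Algebra.IsSeparable K κ] (l : ℕ) (hl : l.Prime)
    (hlp : l ≠ p) : ∃ (k1 k2 : Type) (_ : Field k1) (_ : Field k2) (w1 : Place κ k1) (w2 : Place κ k2) (s : ℕ),
      0 < s ∧ Finite k1 ∧ Finite k2 ∧ (l : k1) ≠ 0 ∧ (l : k2) ≠ 0 ∧ l ^ s ∣ Nat.card k1 - 1 ∧ l ^ s ∣ Nat.card k2 - 1 ∧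
      ¬ l ^ (s + 1) ∣ Nat.card k2 - 1 ∧ (l = 2 → 2 ≤ s) ∧
      (∀ α1 α2 : κ, ∃ α, w1.v (α - α1) ≤ exp (-2 : ℤ) ∧ w2.v (α - α2) ≤ exp (-2 : ℤ)) := by
  have hcop : p.Coprime l := (Nat.coprime_primes Fact.out hl).2 (Ne.symm hlp)
  have hpp : p.Prime := hp.out
  have lne : ∀ (R : Type) [Field R] [CharP R p], (l : R) ≠ 0 := by
    intro R _ _ h
    have := (CharP.cast_eq_zero_iff R p l).1 h
    exact hlp ((Nat.prime_dvd_prime_iff_eq hpp hl).1 this).symm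
  have hl2 := hl.two_le
  have tot : ∀ t m : ℕ, l ^ t ∣ p ^ ((l ^ t).totient * m) - 1 := by
    intro t m
    have h1 : p ^ ((l ^ t).totient) ≡ 1 [MOD l ^ t] := Nat.ModEq.pow_totient (hcop.pow_right t)
    have h2 := h1.pow m
    rw [← pow_mul, one_pow] at h2
    exact (Nat.modEq_iff_dvd' (Nat.one_le_pow _ _ hpp.pos)).1 h2.symm
  obtain ⟨P2, k2, F2, w2, f2, P2i, P2d, fin2, ch2, hf2, hc2, hv2, hP2⟩ := exists_point p K κ (2 * (l - 1)) (by omega)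
  have hq2 : 1 < Nat.card k2 := by
    haveI := fin2; exact Finite.one_lt_card
  obtain ⟨s, m, hm, hsm⟩ := Nat.exists_eq_pow_mul_and_not_dvd (n := Nat.card k2 - 1) (by omega) l hl.ne_one
  have hd2 : ∀ t, l ^ t ∣ Nat.card k2 - 1 → t ≤ s := by
    intro t ht
    by_contra hlt
    apply hm
    have : l ^ (s + 1) ∣ l ^ s * m := by
      rw [← hsm]; exact (pow_dvd_pow l (by omega)).trans ht
    rw [pow_succ] at this
    exact Nat.dvd_of_mul_dvd_mul_left (pow_pos hl.pos s) this
  have hs1 : 1 ≤ s := by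
    apply hd2
    have := tot 1 (2 * f2)
    rw [pow_one, Nat.totient_prime hl] at this
    rw [hc2, pow_one]
    convert this using 3; ring
  have hs2 : l = 2 → 2 ≤ s := by
    rintro rfl
    apply hd2
    have := tot 2 f2
    rw [hc2]
    have h4 : (2 ^ 2).totient = 2 := by decide
    rw [h4] at this
    exact this
  obtain ⟨P1, k1, F1, w1, f1, P1i, P1d, fin1, ch1, hf1, hc1, hv1, hP1⟩ := exists_point p K κ ((l ^ s).totient * (4 * (l - 1)))
    (mul_ne_zero (Nat.totient_pos.2 (pow_pos hl.pos s)).ne' (by omega))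
  have htp : 0 < (l ^ s).totient := Nat.totient_pos.2 (pow_pos hl.pos s)
  refine ⟨k1, k2, F1, F2, w1, w2, s, hs1, fin1, fin2, lne k1, lne k2, ?_, ⟨m, hsm⟩, fun h => by have := hd2 _ h; omega, hs2, ?_⟩
  · rw [hc1, mul_assoc]; exact tot _ _
  · intro α1 α2
    have hcp : IsCoprime P1 P2 := by
      rw [(P1i.coprime_iff_not_dvd)]
      intro hdvd
      have := (P1i.associated_of_dvd P2i hdvd)
      have h3 := Polynomial.natDegree_eq_of_degree_eq (Polynomial.degree_eq_degree_of_associated this)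
      rw [P1d, P2d] at h3
      have : 1 * (4 * (l - 1)) ≤ (l ^ s).totient * (4 * (l - 1)) := Nat.mul_le_mul_right _ htp
      omega
    obtain ⟨n1, hn1⟩ := exists_small (y := w1.v (α2 - α1)) hP1
    obtain ⟨n2, hn2⟩ := exists_small (y := w2.v (α1 - α2)) hP2
    let n := max n1 n2
    obtain ⟨a, b, hab⟩ := (hcp.pow (m := n) (n := n))
    have hab' : algebraMap K κ (algebraMap _ K (a * P1 ^ n)) + algebraMap K κ (algebraMap _ K (b * P2 ^ n)) = 1 := by
      rw [← map_add, ← map_add, hab, map_one, map_one]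
    refine ⟨algebraMap K κ (algebraMap _ K (b * P2 ^ n)) * α1 + algebraMap K κ (algebraMap _ K (a * P1 ^ n)) * α2, ?_, ?_⟩
    · have : algebraMap K κ (algebraMap _ K (b * P2 ^ n)) * α1 + algebraMap K κ (algebraMap _ K (a * P1 ^ n)) * α2 - α1 =
        algebraMap K κ (algebraMap _ K (a * P1 ^ n)) * (α2 - α1) := by linear_combination α1 * hab'
      rw [this, map_mul, map_mul, map_mul, map_mul, map_pow, map_pow, map_pow, mul_assoc]
      exact (mul_le_mul' (hv1 a) (hn1 n (le_max_left _ _))).trans (one_mul _).le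
    · have : algebraMap K κ (algebraMap _ K (b * P2 ^ n)) * α1 + algebraMap K κ (algebraMap _ K (a * P1 ^ n)) * α2 - α2 =
        algebraMap K κ (algebraMap _ K (b * P2 ^ n)) * (α1 - α2) := by linear_combination α2 * hab'
      rw [this, map_mul, map_mul, map_mul, map_mul, map_pow, map_pow, map_pow, mul_assoc]
      exact (mul_le_mul' (hv2 b) (hn2 n (le_max_right _ _))).trans (one_mul _).le

end curve
end PlB
end

section
set_option linter.unusedSectionVars false
set_option linter.style.haveILetI false
set_option linter.unusedSimpArgs false

open WithZero IsDedekindDomain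

namespace PlB
section base
open Polynomial

theorem frac_adjoin {k F : Type} [Field k] [Field F] [Algebra k F] (x : F) (hx : Transcendental k x) :
    ∃ i : k[X] →+* IntermediateField.adjoin k {x}, (∀ c, i (C c) = algebraMap k _ c) ∧
      @IsFractionRing k[X] _ (IntermediateField.adjoin k {x}) _ i.toAlgebra := by
  let e := RatFunc.algEquivOfTranscendental x hx
  let i : k[X] →+* IntermediateField.adjoin k {x} := (e : RatFunc k →+* IntermediateField.adjoin k {x}).comp (algebraMap k[X] (RatFunc k))
  refine ⟨i, ?_, ?_⟩
  · intro c
    show e (algebraMap k[X] (RatFunc k) (C c)) = _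
    have : algebraMap k[X] (RatFunc k) (C c) = algebraMap k (RatFunc k) c := by
      rw [RatFunc.algebraMap_C]; rfl
    rw [this, e.commutes]
  · letI := i.toAlgebra
    let e' : RatFunc k ≃ₐ[k[X]] IntermediateField.adjoin k {x} := AlgEquiv.ofRingEquiv (f := (e : RatFunc k ≃+* _)) (fun _ => rfl)
    exact IsLocalization.isLocalization_of_algEquiv _ e'

theorem fin_adjoin {k F : Type} [Field k] [Field F] [Algebra k F] [Algebra.EssFiniteType k F] (s : Set F)
    (hs : IsTranscendenceBasis k ((↑) : s → F)) : FiniteDimensional (IntermediateField.adjoin k s) F := by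
  have h := hs.isAlgebraic_field
  rw [Subtype.range_coe] at h
  haveI : Algebra.EssFiniteType (IntermediateField.adjoin k s) F := .of_comp k _ _
  exact Algebra.finite_of_essFiniteType_of_isAlgebraic

/-- A finite extension of a rational function field over `𝔽_p` is separable for a suitable variable. -/
theorem exists_sep (p : ℕ) [Fact p.Prime] (k0 κ : Type) [Field k0] [Field κ] [Algebra (ZMod p)[X] k0]
    [IsFractionRing (ZMod p)[X] k0] [Algebra k0 κ] [FiniteDimensional k0 κ] :
    ∃ (K : Type) (_ : Field K) (_ : Algebra (ZMod p)[X] K) (_ : Algebra K κ), IsFractionRing (ZMod p)[X] K ∧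
      FiniteDimensional K κ ∧ Algebra.IsSeparable K κ := by
  letI a1 : Algebra (ZMod p)[X] κ := ((algebraMap k0 κ).comp (algebraMap (ZMod p)[X] k0)).toAlgebra
  haveI t1 : IsScalarTower (ZMod p)[X] k0 κ := IsScalarTower.of_algebraMap_eq fun _ => rfl
  letI a2 : Algebra (ZMod p) κ := ((algebraMap (ZMod p)[X] κ).comp (algebraMap (ZMod p) (ZMod p)[X])).toAlgebra
  haveI t2 : IsScalarTower (ZMod p) (ZMod p)[X] κ := IsScalarTower.of_algebraMap_eq fun _ => rfl
  haveI e1 : Algebra.EssFiniteType (ZMod p)[X] k0 := Algebra.EssFiniteType.of_isLocalization k0 (nonZeroDivisors (ZMod p)[X])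
  haveI e2 : Algebra.EssFiniteType (ZMod p)[X] κ := Algebra.EssFiniteType.comp (ZMod p)[X] k0 κ
  haveI e3 : Algebra.EssFiniteType (ZMod p) κ := Algebra.EssFiniteType.comp (ZMod p) (ZMod p)[X] κ
  obtain ⟨s, hs, hsep⟩ := exists_isTranscendenceBasis_and_isSeparable_of_perfectField (ZMod p) κ
  haveI alg : Algebra.IsAlgebraic (ZMod p)[X] κ := (IsFractionRing.comap_isAlgebraic_iff (K := k0)).2 inferInstance
  have hinj : Function.Injective (algebraMap (ZMod p)[X] κ) := (algebraMap k0 κ).injective.comp (IsFractionRing.injective _ k0)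
  haveI : FaithfulSMul (ZMod p)[X] κ := (faithfulSMul_iff_algebraMap_injective _ _).2 hinj
  have htr : Algebra.trdeg (ZMod p) κ = 1 := by
    rw [← trdeg_add_eq (ZMod p) (ZMod p)[X] (A := κ), Polynomial.trdeg_of_isDomain, trdeg_eq_zero, add_zero]
  have hcard : s.card = 1 := by
    have := hs.cardinalMk_eq_trdeg
    rw [htr] at this
    simpa using this
  obtain ⟨y, rfl⟩ := Finset.card_eq_one.1 hcard
  have hy : Transcendental (ZMod p) y := by
    have := hs.1.transcendental ⟨y, by simp⟩
    exact this
  rw [Finset.coe_singleton] at hsep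
  have hfd : FiniteDimensional (IntermediateField.adjoin (ZMod p) {y}) κ := by
    have := fin_adjoin (k := ZMod p) ((({y} : Finset κ) : Set κ)) hs
    rwa [Finset.coe_singleton] at this
  obtain ⟨i, -, hi⟩ := frac_adjoin y hy
  exact ⟨IntermediateField.adjoin (ZMod p) {y}, inferInstance, i.toAlgebra, inferInstance, hi, hfd, hsep⟩

/-- The Gauss place of `ℚ_p(x)`. -/
theorem exists_gauss (p : ℕ) [hp : Fact p.Prime] (E : Type) [Field E] (i : ℚ_[p][X] →+* E)
    (hi : @IsFractionRing ℚ_[p][X] _ E _ i.toAlgebra) : Nonempty (Place E (RatFunc (ZMod p))) := by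
  let Z := ℤ_[p][X]
  let ψ : Z →+* (ZMod p)[X] := mapRingHom PadicInt.toZMod
  let P : Ideal Z := RingHom.ker ψ
  have hPs : P = Ideal.span {C (p : ℤ_[p])} := by
    show RingHom.ker (mapRingHom PadicInt.toZMod) = _
    rw [Polynomial.ker_mapRingHom, PadicInt.ker_toZMod, PadicInt.maximalIdeal_eq_span_p, Ideal.map_span, Set.image_singleton]
  haveI hPp : P.IsPrime := RingHom.ker_isPrime ψ
  let A := Localization.AtPrime P
  have hZA : P.primeCompl ≤ nonZeroDivisors Z := P.primeCompl_le_nonZeroDivisors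
  haveI : IsDomain A := IsLocalization.isDomain_localization hZA
  haveI : IsNoetherianRing A := IsLocalization.isNoetherianRing P.primeCompl A inferInstance
  let π : A := algebraMap Z A (C (p : ℤ_[p]))
  have hmax : IsLocalRing.maximalIdeal A = Ideal.span {π} := by
    rw [← Localization.AtPrime.map_eq_maximalIdeal]
    have : Ideal.map (algebraMap Z A) P = Ideal.map (algebraMap Z A) (Ideal.span {C (p : ℤ_[p])}) := by rw [← hPs]
    rw [this, Ideal.map_span, Set.image_singleton]
  have hπ : π ≠ 0 := by
    intro h
    have := IsLocalization.injective A hZA (h.trans (map_zero _).symm)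
    rw [C_eq_zero] at this
    exact hp.out.ne_zero (by exact_mod_cast this)
  have hne : IsLocalRing.maximalIdeal A ≠ ⊥ := by
    rw [hmax]
    intro h
    exact hπ (Ideal.span_singleton_eq_bot.1 h)
  haveI : IsDedekindDomain A :=
    ((tfae_of_isNoetherianRing_of_isLocalRing_of_isDomain A).out 4 2).1 (by rw [hmax]; exact ⟨⟨π, rfl⟩⟩)
  let ψ' : Z →+* RatFunc (ZMod p) := (algebraMap (ZMod p)[X] (RatFunc (ZMod p))).comp ψ
  have hinjR : Function.Injective (algebraMap (ZMod p)[X] (RatFunc (ZMod p))) := IsFractionRing.injective _ _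
  have hψ' : ∀ a, ψ' a = 0 ↔ a ∈ P := fun a =>
    ⟨fun h => hinjR (h.trans (map_zero _).symm), fun h => by
      show algebraMap _ _ (ψ a) = 0
      rw [(show ψ a = 0 from h), map_zero]⟩
  have hu : ∀ y : P.primeCompl, IsUnit (ψ' y) := fun y => IsUnit.mk0 _ (fun h => y.2 ((hψ' _).1 h))
  let ρ : A →+* RatFunc (ZMod p) := IsLocalization.lift hu
  have hρ : ∀ a, ρ (algebraMap Z A a) = ψ' a := fun a => IsLocalization.lift_eq hu a
  have ψs : Function.Surjective ψ := Polynomial.map_surjective _ (ZMod.ringHom_surjective _)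
  have hs : Function.Surjective ρ := by
    intro y
    obtain ⟨a, b, hb, rfl⟩ := IsFractionRing.div_surjective (A := (ZMod p)[X]) y
    obtain ⟨a, rfl⟩ := ψs a
    obtain ⟨b, rfl⟩ := ψs b
    have hbP : b ∈ P.primeCompl := fun h => nonZeroDivisors.ne_zero hb h
    refine ⟨IsLocalization.mk' A a ⟨b, hbP⟩, ?_⟩
    rw [IsLocalization.lift_mk', Units.mul_inv_eq_iff_eq_mul]
    have hb0 : ψ' b ≠ 0 := fun h => hbP ((hψ' _).1 h)
    exact (div_mul_cancel₀ _ hb0).symm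
  let w : HeightOneSpectrum A := ⟨IsLocalRing.maximalIdeal A, inferInstance, hne⟩
  have hk : ∀ a, ρ a = 0 ↔ a ∈ w.asIdeal := by
    intro a
    show _ ↔ a ∈ IsLocalRing.maximalIdeal A
    constructor
    · intro h
      by_contra hn
      have hu := IsLocalRing.notMem_maximalIdeal.1 hn
      exact (hu.map ρ).ne_zero h
    · intro h
      rw [hmax, Ideal.mem_span_singleton] at h
      obtain ⟨b, rfl⟩ := h
      rw [map_mul, hρ, (hψ' _).2 (by rw [hPs]; exact Ideal.mem_span_singleton_self _), zero_mul]
  -- the field E as fraction field of A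
  letI aE : Algebra ℚ_[p][X] E := i.toAlgebra
  haveI := hi
  let j : Z →+* ℚ_[p][X] := mapRingHom (algebraMap ℤ_[p] ℚ_[p])
  have hj : Function.Injective j := Polynomial.map_injective _ (IsFractionRing.injective ℤ_[p] ℚ_[p])
  have hiinj : Function.Injective i := IsFractionRing.injective ℚ_[p][X] E
  letI aZ : Algebra Z E := (i.comp j).toAlgebra
  have hZE : Function.Injective (algebraMap Z E) := hiinj.comp hj
  haveI : FaithfulSMul Z E := (faithfulSMul_iff_algebraMap_injective _ _).2 hZE
  have clear : ∀ f : ℚ_[p][X], ∃ (m : ℤ_[p]) (g : Z), m ≠ 0 ∧ f * C (algebraMap ℤ_[p] ℚ_[p] m) = j g := by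
    intro f
    obtain ⟨b, hbm, hb⟩ := IsLocalization.integerNormalization_spec (nonZeroDivisors ℤ_[p]) f
    refine ⟨b, IsLocalization.integerNormalization (nonZeroDivisors ℤ_[p]) f, nonZeroDivisors.ne_zero hbm, ?_⟩
    show _ = Polynomial.map _ _
    rw [hb]
    ext n
    rw [coeff_mul_C, coeff_smul, mul_comm]
    exact (Algebra.smul_def _ _).symm
  haveI hfr : IsFractionRing Z E := by
    apply IsFractionRing.of_field
    intro z
    obtain ⟨a, b, hb, rfl⟩ := IsFractionRing.div_surjective (A := ℚ_[p][X]) z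
    obtain ⟨m, g, hm, hg⟩ := clear a
    obtain ⟨n, h, hn, hh⟩ := clear b
    have hc : ∀ c : ℤ_[p], c ≠ 0 → i (C (algebraMap ℤ_[p] ℚ_[p] c)) ≠ 0 := by
      intro c hc h0
      have h1 := hiinj (h0.trans (map_zero i).symm)
      rw [C_eq_zero] at h1
      exact hc (IsFractionRing.injective ℤ_[p] ℚ_[p] (h1.trans (map_zero _).symm))
    refine ⟨g * C n, h * C m, ?_⟩
    have e1 : algebraMap Z E (g * C n) = i a * (i (C (algebraMap ℤ_[p] ℚ_[p] m)) * i (C (algebraMap ℤ_[p] ℚ_[p] n))) := by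
      show i (j (g * C n)) = _
      rw [map_mul, ← hg, map_mul, map_mul, mul_assoc]
      congr 3
      exact Polynomial.map_C _
    have e2 : algebraMap Z E (h * C m) = i b * (i (C (algebraMap ℤ_[p] ℚ_[p] m)) * i (C (algebraMap ℤ_[p] ℚ_[p] n))) := by
      show i (j (h * C m)) = _
      rw [map_mul, ← hh, map_mul, map_mul, mul_assoc, mul_comm (i (C (algebraMap ℤ_[p] ℚ_[p] m)))]
      congr 3
      exact Polynomial.map_C _
    rw [e1, e2]
    exact (mul_div_mul_right _ _ (mul_ne_zero (hc m hm) (hc n hn))).symm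
  have huE : ∀ y : P.primeCompl, IsUnit (algebraMap Z E y) := fun y => IsUnit.mk0 _ (fun h => y.2 (by
    have : (y : Z) = 0 := hZE (h.trans (map_zero _).symm)
    rw [this]; exact P.zero_mem))
  let liftE : A →+* E := IsLocalization.lift huE
  letI aA : Algebra A E := liftE.toAlgebra
  haveI : IsScalarTower Z A E := IsScalarTower.of_algebraMap_eq fun a => (IsLocalization.lift_eq huE a).symm
  haveI : IsFractionRing A E := IsFractionRing.isFractionRing_of_isDomain_of_isLocalization P.primeCompl A E
  exact ⟨dedPlace w ρ E hk hs⟩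

end base
end PlB
end

/-- **Existence of noncrossed products** (Brussel–Tengan).  Let `F` be a field extension of
`ℚ_p`, finitely generated and of transcendence degree one over `ℚ_p`, and let `ℓ ≠ p` be a
prime.  Then there exists a noncrossed product central division algebra `D` over `F` whose
period equals its index, both being a power `ℓ^d` of `ℓ` (so `dim_F D = ℓ^(2d)` and the
class of `D` has order `ℓ^d` in `Br(F)`). -/
theorem noncrossed_products_exist
    (p : ℕ) [Fact p.Prime] (F : Type) [Field F] [Algebra ℚ_[p] F]
    (hfg : ∃ s : Finset F, IntermediateField.adjoin ℚ_[p] (s : Set F) = ⊤)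
    (htd : ∃ x : F, IsTranscendenceBasis ℚ_[p] (fun _ : Fin 1 => x))
    (ℓ : ℕ) (hℓ : ℓ.Prime) (hℓp : ℓ ≠ p) :
    ∃ (d : ℕ) (D : CentralDivisionAlgebra F),
      1 ≤ d ∧
      Module.finrank F D.carrier = ℓ ^ (2 * d) ∧
      BrauerClassHasOrder F D.carrier (ℓ ^ d) ∧
      IsNoncrossedProduct F D.carrier := by
  obtain ⟨x, hx⟩ := htd
  haveI : Algebra.EssFiniteType ℚ_[p] F := IntermediateField.fg_top_iff.1 hfg
  haveI : CharZero F := charZero_of_injective_algebraMap (algebraMap ℚ_[p] F).injective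
  have hxt : Transcendental ℚ_[p] x := hx.1.transcendental 0
  obtain ⟨i, -, hi⟩ := PlB.frac_adjoin x hxt
  obtain ⟨g⟩ := PlB.exists_gauss p _ i hi
  have hr : Set.range (fun _ : Fin 1 => x) = {x} := Set.range_const
  have hE : FiniteDimensional (IntermediateField.adjoin ℚ_[p] {x}) F := by
    have := PlB.fin_adjoin (k := ℚ_[p]) _ hx.to_subtype_range
    rwa [hr] at this
  haveI : CharZero (IntermediateField.adjoin ℚ_[p] {x}) := charZero_of_injective_algebraMap (algebraMap ℚ_[p] _).injective
  obtain ⟨κ, fκ, aκ, fdκ, v, e, ov⟩ := (g.exists_level0 F).1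
  obtain ⟨K, fK, aK, aKκ, hKf, hKfd, hKs⟩ := PlB.exists_sep p (RatFunc (ZMod p)) κ
  obtain ⟨k1, k2, f1, f2, w1, w2, s, hs, fin1, fin2, l1, l2, hq1, hq2, hn, h2, approx⟩ := PlB.exists_points p K κ ℓ hℓ hℓp
  haveI : CharP (RatFunc (ZMod p)) p := charP_of_injective_algebraMap (algebraMap (ZMod p) (RatFunc (ZMod p))).injective p
  haveI : CharP κ p := charP_of_injective_algebraMap (algebraMap (RatFunc (ZMod p)) κ).injective p
  have lκ : (ℓ : κ) ≠ 0 := by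
    intro h
    have := (CharP.cast_eq_zero_iff κ p ℓ).1 h
    exact hℓp ((Nat.prime_dvd_prime_iff_eq Fact.out hℓ).1 this).symm
  let B := (Nat.card k1 - 1) * Nat.card k2 ^ (Nat.card k1 - 1)
  have hB : B + 1 < ℓ ^ (B + 1) := Nat.lt_pow_self hℓ.one_lt
  obtain ⟨Ψ, fΨ, aΨ, σ, a, C', hfd, hgal, hcyc⟩ := PlB.exists_cyc p F ℓ s (B + 1) hℓ hℓp hs
  obtain ⟨D, hD1, hD2, hD3⟩ := hcyc.final p v w1 w2 (Nat.cast_ne_zero.2 hℓ.ne_zero) lκ l1 l2 hq1 hq2 hn h2 approx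
    (Nat.succ_pos B) ((Nat.lt_succ_self B).trans hB)
  exact ⟨B + 1, D, Nat.succ_pos B, by rw [hD1, ← pow_mul, mul_comm], hD2, hD3⟩
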